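/- (Invasion implies convergence.) Assume V satisfies (H_coerc) and (H_gen), and let u be a radially symmetric solution satisfying (H_hom) for some m ∈ M and (H_inv). Then: (i) for t sufficiently large the function t ↦ r_Esc(t) is finite and of class C¹ and r_Esc'(t) → c_Esc as t → +∞; (ii) there exist a minimum point m_next ∈ M with V(m_next) < V(m), a travelling-front profile φ ∈ Φ_{c_Esc,norm}(m_next, m), and a C¹ function t ↦ r_next(t) such that, as t → +∞: r_Esc(t) − r_next(t) → +∞, r_next'(t) → c_Esc, sup over r ∈ [r_next(t), r_Hom(t)] of |u(r,t) − φ(r − r_Esc(t))| → 0, and for every L > 0, the H¹([−L,L],ℝ^n)-norm of r ↦ u(r_next(t)+r, t) − m_next tends to 0. -/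

import Mathlib

open Filter Topology Set MeasureTheory

noncomputable section

local notation "⟪" x ", " y "⟫" => @inner ℝ _ _ x y

abbrev Euc (n : ℕ) : Type := EuclideanSpace ℝ (Fin n)

variable {n : ℕ}

/-- Spatial partial derivative `u_r`. -/
def ur (u : ℝ → ℝ → Euc n) (r t : ℝ) : Euc n := deriv (fun s => u s t) r

/-- Second spatial partial derivative `u_rr`. -/
def urr (u : ℝ → ℝ → Euc n) (r t : ℝ) : Euc n := deriv (fun s => ur u s t) r

/-- Time partial derivative `u_t`. -/
def ut (u : ℝ → ℝ → Euc n) (r t : ℝ) : Euc n := deriv (fun s => u r s) t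

/-- Hessian (second differential) of the potential. -/
def hess (V : Euc n → ℝ) (x : Euc n) : Euc n →L[ℝ] Euc n := fderiv ℝ (gradient V) x

/-- Coercivity hypothesis. -/
def HCoerc (V : Euc n → ℝ) : Prop :=
  ∃ ε > (0:ℝ), ∃ R : ℝ, ∀ x : Euc n, R ≤ ‖x‖ → ε * ‖x‖ ^ 2 ≤ ⟪x, gradient V x⟫

/-- The set of nondegenerate minimum points of `V`. -/
def MinSet (V : Euc n → ℝ) : Set (Euc n) :=
  {m | gradient V m = 0 ∧ ∀ v : Euc n, v ≠ 0 → 0 < ⟪v, hess V m v⟫}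

/-- Data of the constants `λ_min`, `λ_max`, `d_Esc` from the paper, together with their
spectral characterizations. -/
structure EscData (n : ℕ) (V : Euc n → ℝ) where
  lmin : ℝ
  lmax : ℝ
  dEsc : ℝ
  lmin_pos : 0 < lmin
  dEsc_pos : 0 < dEsc
  lower : ∀ m ∈ MinSet V, ∀ v : Euc n, lmin * ‖v‖ ^ 2 ≤ ⟪v, hess V m v⟫
  upper : ∀ m ∈ MinSet V, ∀ v : Euc n, ⟪v, hess V m v⟫ ≤ lmax * ‖v‖ ^ 2
  esc_lower : ∀ m ∈ MinSet V, ∀ x : Euc n, ‖x - m‖ ≤ dEsc →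
    ∀ v : Euc n, lmin / 2 * ‖v‖ ^ 2 ≤ ⟪v, hess V x v⟫
  esc_upper : ∀ m ∈ MinSet V, ∀ x : Euc n, ‖x - m‖ ≤ dEsc →
    ∀ v : Euc n, ⟪v, hess V x v⟫ ≤ 2 * lmax * ‖v‖ ^ 2

/-- Radially symmetric solution of `u_t = -∇V(u) + ((d-1)/r) u_r + u_rr` with Neumann
boundary condition at the origin. -/
structure IsRadialSolution (d : ℕ) (V : Euc n → ℝ) (u : ℝ → ℝ → Euc n) : Prop where
  diff_r : ∀ t > (0:ℝ), ∀ r : ℝ, DifferentiableAt ℝ (fun s => u s t) r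
  diff_rr : ∀ t > (0:ℝ), ∀ r : ℝ, DifferentiableAt ℝ (fun s => ur u s t) r
  cont_rr : ∀ t > (0:ℝ), Continuous fun r => urr u r t
  diff_t : ∀ t > (0:ℝ), ∀ r : ℝ, DifferentiableAt ℝ (fun s => u r s) t
  cont_t : ∀ r : ℝ, ContinuousOn (fun s => ut u r s) (Ioi 0)
  bounded : ∃ C : ℝ, ∀ r t : ℝ, 0 ≤ r → 0 < t →
    ‖u r t‖ + ‖ur u r t‖ + ‖urr u r t‖ + ‖ut u r t‖ ≤ C
  pde : ∀ r > (0:ℝ), ∀ t > (0:ℝ),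
    ut u r t = -gradient V (u r t) + (((d : ℝ) - 1) / r) • ur u r t + urr u r t
  neumann : ∀ t > (0:ℝ), ur u 0 t = 0

/-- Profiles of fronts travelling at speed `c` connecting `um` to `up`
(nonconstant solutions of `φ'' = -cφ' + ∇V(φ)`). -/
def Phi (V : Euc n → ℝ) (c : ℝ) (um up : Euc n) : Set (ℝ → Euc n) :=
  {φ | (∃ ξ₁ ξ₂ : ℝ, φ ξ₁ ≠ φ ξ₂) ∧
    (∀ ξ : ℝ, DifferentiableAt ℝ φ ξ) ∧ (∀ ξ : ℝ, DifferentiableAt ℝ (deriv φ) ξ) ∧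
    (∀ ξ : ℝ, deriv (deriv φ) ξ = -(c • deriv φ ξ) + gradient V (φ ξ)) ∧
    Tendsto φ atBot (𝓝 um) ∧ Tendsto φ atTop (𝓝 up)}

/-- Fronts travelling at speed `c` invading the equilibrium `mp`. -/
def PhiInv (V : Euc n → ℝ) (c : ℝ) (mp : Euc n) : Set (ℝ → Euc n) :=
  ⋃ mm ∈ MinSet V, Phi V c mm mp

/-- Normalized front profiles. -/
def PhiNorm (V : Euc n → ℝ) (dEsc c : ℝ) (mm mp : Euc n) : Set (ℝ → Euc n) :=
  {φ | φ ∈ Phi V c mm mp ∧ ‖φ 0 - mp‖ = dEsc ∧ ∀ ξ > (0:ℝ), ‖φ ξ - mp‖ < dEsc}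

/-- Normalized front profiles invading `mp`. -/
def PhiNormInv (V : Euc n → ℝ) (dEsc c : ℝ) (mp : Euc n) : Set (ℝ → Euc n) :=
  ⋃ mm ∈ MinSet V, PhiNorm V dEsc c mm mp

/-- Every critical point of `V` is nondegenerate. -/
def HNonDeg (V : Euc n → ℝ) : Prop :=
  ∀ x : Euc n, gradient V x = 0 → ∀ v : Euc n, hess V x v = 0 → v = 0

/-- Every front travelling at a positive speed and invading a minimum point is bistable. -/
def HOnlyBist (V : Euc n → ℝ) : Prop :=
  ∀ mp ∈ MinSet V, ∀ um : Euc n, gradient V um = 0 →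
    ∀ c > (0:ℝ), (Phi V c um mp).Nonempty → um ∈ MinSet V

/-- The set of invading speeds has empty interior. -/
def HDiscVel (V : Euc n → ℝ) : Prop :=
  ∀ mp ∈ MinSet V, interior {c : ℝ | 0 ≤ c ∧ (PhiInv V c mp).Nonempty} = ∅

/-- The set of initial values of normalized invading fronts is totally disconnected. -/
def HDiscFront (V : Euc n → ℝ) (dEsc : ℝ) : Prop :=
  ∀ mp ∈ MinSet V, ∀ c > (0:ℝ),
    IsTotallyDisconnected
      {p : Euc n × Euc n | ∃ φ ∈ PhiNormInv V dEsc c mp, p = (φ 0, deriv φ 0)}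

/-- The generic hypotheses on the potential. -/
def HGen (V : Euc n → ℝ) (dEsc : ℝ) : Prop :=
  HNonDeg V ∧ HOnlyBist V ∧ HDiscVel V ∧ HDiscFront V dEsc

/-- The solution is stable at infinity, close to the minimum point `m`. -/
def StableAtInfinity (V : Euc n → ℝ) (u : ℝ → ℝ → Euc n) (m : Euc n) : Prop :=
  m ∈ MinSet V ∧
    Tendsto (fun t => limsup (fun r => ‖u r t - m‖) atTop) atTop (𝓝 0)

/-- Propagating terrace of bistable fronts connecting `mLoc` to `mFar`. -/
def IsTerrace (V : Euc n → ℝ) (mLoc mFar : Euc n) (T : ℝ → ℝ → Euc n) : Prop :=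
  ∃ (q : ℕ) (ms : ℕ → Euc n) (cs : ℕ → ℝ) (φs : ℕ → ℝ → Euc n) (rs : ℕ → ℝ → ℝ),
    ms 0 = mFar ∧ ms q = mLoc ∧ (∀ i, i ≤ q → ms i ∈ MinSet V) ∧
    (∀ i, i < q → V (ms (i + 1)) < V (ms i)) ∧
    (∀ i, 1 ≤ i → i ≤ q → 0 < cs i) ∧
    (∀ i, 1 ≤ i → i + 1 ≤ q → cs (i + 1) ≤ cs i) ∧
    (∀ i, 1 ≤ i → i ≤ q → φs i ∈ Phi V (cs i) (ms i) (ms (i - 1))) ∧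
    (∀ i, 1 ≤ i → i ≤ q →
      (∀ t : ℝ, 0 ≤ t → 0 ≤ rs i t) ∧ (∀ t : ℝ, DifferentiableAt ℝ (rs i) t) ∧
        Tendsto (deriv (rs i)) atTop (𝓝 (cs i))) ∧
    (∀ i, 1 ≤ i → i + 1 ≤ q → Tendsto (fun t => rs (i + 1) t - rs i t) atTop atTop) ∧
    (∀ r t : ℝ, 0 ≤ r → 0 ≤ t →
      T r t = ms 0 + ∑ i ∈ Finset.Icc 1 q, (φs i (r - rs i t) - ms (i - 1)))

/-- Hypothesis `(H_hom)` unbundled: `u` is close to `m` on a growing interval around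
`rHom t`, travelling at asymptotic speed `cHom`; closeness is measured in `H¹` norm. -/
def HHomWith (u : ℝ → ℝ → Euc n) (m : Euc n) (cHom : ℝ) (rHom : ℝ → ℝ) : Prop :=
  0 < cHom ∧ (∀ t : ℝ, DifferentiableAt ℝ rHom t) ∧
    Tendsto (deriv rHom) atTop (𝓝 cHom) ∧
    ∀ L > (0:ℝ),
      Tendsto
        (fun t => ∫ r in (-L)..L,
          (‖u (rHom t + r) t - m‖ ^ 2 + ‖ur u (rHom t + r) t‖ ^ 2))
        atTop (𝓝 0)

/-- The set whose supremum defines the Escape point `r_Esc(t)`. -/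
def rEscSet (u : ℝ → ℝ → Euc n) (m : Euc n) (dEsc : ℝ) (rHom : ℝ → ℝ) (t : ℝ) : Set ℝ :=
  {r | r ∈ Icc 0 (rHom t) ∧ ‖u r t - m‖ = dEsc}

/-- The Escape point `r_Esc(t)`. -/
def rEscF (u : ℝ → ℝ → Euc n) (m : Euc n) (dEsc : ℝ) (rHom : ℝ → ℝ) (t : ℝ) : ℝ :=
  sSup (rEscSet u m dEsc rHom t)

/-- The upper limit mean speed `c_Esc` of the Escape point. -/
def cEscV (u : ℝ → ℝ → Euc n) (m : Euc n) (dEsc : ℝ) (rHom : ℝ → ℝ) : ℝ :=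
  limsup (fun t => rEscF u m dEsc rHom t / t) atTop

/-- `q_hull`: minimal convexity of the lower quadratic hulls of `V` at minimum points. -/
def qHull (V : Euc n → ℝ) : ℝ :=
  sInf {q : ℝ | ∃ m ∈ MinSet V, ∃ x : Euc n, x ≠ m ∧ q = (V x - V m) / ‖x - m‖ ^ 2}

/-- The weight `w` of the energy in the firewall functionals. -/
def wV (V : Euc n → ℝ) : ℝ := 1 / max 1 (-(4 * qHull V))

/-- The decay rate `κ₀`. -/
def kappa0 (lmin : ℝ) : ℝ := min (1 / 2) (lmin / 8)

/-- The "small curvature" radius `r_sc`. -/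
def rsc (d : ℕ) (lmin : ℝ) : ℝ := max (2 * ((d : ℝ) - 1)) (8 * ((d : ℝ) - 1) / lmin)

/-- The weight function `T_ρ ψ₀`. -/
def Tpsi (d : ℕ) (lmin : ℝ) (ρ r : ℝ) : ℝ :=
  if r ≤ rsc d lmin then Real.exp (-(kappa0 lmin) * |r - ρ|) * (r / rsc d lmin) ^ (d - 1)
  else Real.exp (-(kappa0 lmin) * |r - ρ|)

/-- The firewall functional `F₀` in the laboratory frame. -/
def F0 (V : Euc n → ℝ) (d : ℕ) (lmin : ℝ) (u : ℝ → ℝ → Euc n) (ρ t : ℝ) : ℝ :=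
  ∫ r in Ioi (0:ℝ),
    Tpsi d lmin ρ r * (wV V * (‖ur u r t‖ ^ 2 / 2 + V (u r t)) + ‖u r t‖ ^ 2 / 2)

/-- The set `Σ₀(t)` where the solution Escapes at distance `dEsc` from the origin. -/
def Sigma0 (u : ℝ → ℝ → Euc n) (dEsc t : ℝ) : Set ℝ := {r | 0 ≤ r ∧ dEsc < ‖u r t‖}

/-- The firewall differential inequality in the laboratory frame. -/
def FireIneq (V : Euc n → ℝ) (d : ℕ) (lmin dEsc : ℝ) (u : ℝ → ℝ → Euc n) (ν K : ℝ) : Prop :=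
  ∀ ρ ≥ rsc d lmin, ∀ t > (0:ℝ),
    DifferentiableAt ℝ (fun s => F0 V d lmin u ρ s) t ∧
    deriv (fun s => F0 V d lmin u ρ s) t ≤
      -ν * F0 V d lmin u ρ t + K * ∫ r in Sigma0 u dEsc t, Tpsi d lmin ρ r

/-- The quantity `δ = d_Esc √(min(w/2,1/4)/(κ₀+1))`. -/
def deltaEsc (dEsc w κ₀ : ℝ) : ℝ := dEsc * Real.sqrt (min (w / 2) (1 / 4) / (κ₀ + 1))

/-- The length `L₀`. -/
def L0c (κ₀ ν K δ : ℝ) : ℝ := κ₀⁻¹ * Real.log (16 * K / (ν * δ ^ 2 * κ₀))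

/-- The no-escape speed `c_noesc`. -/
def cNoEsc (κ₀ K L₀ δ : ℝ) : ℝ := 8 * K * L₀ / (κ₀ * δ ^ 2)

/-- The no-escape hull `h`. -/
def hull (δ L₀ : ℝ) (x : ℝ) : EReal :=
  if x < 0 then ⊤
  else if x ≤ L₀ then ((δ ^ 2 / 2 * (1 - x / (2 * L₀)) : ℝ) : EReal)
  else ((δ ^ 2 / 4 : ℝ) : EReal)

/-- The standing hypothesis that the firewall is below the two mirror hulls positioned
around `rHom t`. -/
def HullBound (V : Euc n → ℝ) (d : ℕ) (lmin : ℝ) (u : ℝ → ℝ → Euc n) (δ L₀ : ℝ)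
    (rHom : ℝ → ℝ) : Prop :=
  ∀ t ≥ (0:ℝ), rsc d lmin ≤ rHom t - 1 ∧
    ∀ r ≥ rsc d lmin, ((F0 V d lmin u r t : ℝ) : EReal) ≤
      max (hull δ L₀ (r - (rHom t - 1))) (hull δ L₀ (rHom t - r))

/-- The set whose infimum defines the escape point `r_esc(t)`. -/
def rescSet (V : Euc n → ℝ) (d : ℕ) (lmin : ℝ) (u : ℝ → ℝ → Euc n) (δ L₀ : ℝ)
    (rHom : ℝ → ℝ) (t : ℝ) : Set ℝ :=
  {rl | rl ∈ Icc (rsc d lmin) (rHom t) ∧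
    ∀ r ≥ rsc d lmin, ((F0 V d lmin u r t : ℝ) : EReal) ≤
      max (hull δ L₀ (r - rl)) (hull δ L₀ (rHom t - r))}

/-- The escape point `r_esc(t)`. -/
def rescF (V : Euc n → ℝ) (d : ℕ) (lmin : ℝ) (u : ℝ → ℝ → Euc n) (δ L₀ : ℝ)
    (rHom : ℝ → ℝ) (t : ℝ) : ℝ :=
  sInf (rescSet V d lmin u δ L₀ rHom t)

/-- `c̄`: upper limit of mean variations of a function over time intervals of length `s`. -/
def cbarF (f : ℝ → ℝ) : ℝ :=
  limsup (fun s => sSup {x : ℝ | ∃ t ≥ (0:ℝ), x = f (t + s) - f t} / s) atTop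

/-- `c̲`: lower limit of mean variations of a function over time intervals of length `s`. -/
def cunderF (f : ℝ → ℝ) : ℝ :=
  liminf (fun s => sInf {x : ℝ | ∃ t ≥ (0:ℝ), x = f (t + s) - f t} / s) atTop

/-- The decay rate `κ` in the travelling frame. -/
def kappaTF (lmin cno : ℝ) : ℝ := min (1 / 4) (lmin / (16 * (cno + 1)))

/-- The cut-off speed `c_cut` in the travelling frame. -/
def ccutTF (lmin lmax cno : ℝ) : ℝ := min (lmin / (8 * lmax)) (lmin / (8 * (cno + 1)))

/-- The energy weight `w'` in the travelling frame. -/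
def wTF (V : Euc n → ℝ) (cno : ℝ) : ℝ := min (wV V) (1 / (cno + 1) ^ 2)

/-- The weight function `χ` of the localized energy in the travelling frame. -/
def chiTF (d : ℕ) (lmin lmax cno c xcut r0 : ℝ) (ρ s : ℝ) : ℝ :=
  if ρ ≤ -r0 - c * s + rsc d lmin then
    Real.exp (c * ρ) * ((r0 + c * s + ρ) / rsc d lmin) ^ (d - 1)
  else if ρ ≤ xcut + ccutTF lmin lmax cno * s then Real.exp (c * ρ)
  else
    Real.exp ((c + kappaTF lmin cno) * (xcut + ccutTF lmin lmax cno * s) -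
      kappaTF lmin cno * ρ)

/-- The weight function `ψ` of the firewall in the travelling frame. -/
def psiTF (d : ℕ) (lmin lmax cno c xcut r0 : ℝ) (ρ s : ℝ) : ℝ :=
  if ρ ≤ -r0 - c * s + rsc d lmin then
    Real.exp ((c + kappaTF lmin cno) * ρ -
        kappaTF lmin cno * (xcut + ccutTF lmin lmax cno * s)) *
      ((r0 + c * s + ρ) / rsc d lmin) ^ (d - 1)
  else if ρ ≤ xcut + ccutTF lmin lmax cno * s then
    Real.exp ((c + kappaTF lmin cno) * ρ -
      kappaTF lmin cno * (xcut + ccutTF lmin lmax cno * s))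
  else
    Real.exp ((c + kappaTF lmin cno) * (xcut + ccutTF lmin lmax cno * s) -
      kappaTF lmin cno * ρ)

/-- The firewall functional `F(s)` in the travelling frame. -/
def FTF (V : Euc n → ℝ) (d : ℕ) (lmin lmax cno : ℝ) (u : ℝ → ℝ → Euc n)
    (t0 c xcut r0 : ℝ) (s : ℝ) : ℝ :=
  ∫ ρ in Ioi (-r0 - c * s),
    psiTF d lmin lmax cno c xcut r0 ρ s *
      (wTF V cno *
          (‖ur u (r0 + c * s + ρ) (t0 + s)‖ ^ 2 / 2 + V (u (r0 + c * s + ρ) (t0 + s))) +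
        ‖u (r0 + c * s + ρ) (t0 + s)‖ ^ 2 / 2)

/-- The set `Σ(s)` where the solution Escapes, in the travelling frame. -/
def SigmaTF (u : ℝ → ℝ → Euc n) (d : ℕ) (lmin dEsc : ℝ) (t0 c r0 : ℝ) (s : ℝ) : Set ℝ :=
  {ρ | -r0 - c * s + rsc d lmin ≤ ρ ∧ dEsc < ‖u (r0 + c * s + ρ) (t0 + s)‖}

/-- The weight function `ψ̃` in the standing frame. -/
def psiSF (d : ℕ) (κ cm cp : ℝ) (r t : ℝ) : ℝ :=
  if r ≤ cm * t then r ^ (d - 1) * Real.exp (-κ * (cm * t - r))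
  else if r ≤ cp * t then r ^ (d - 1)
  else r ^ (d - 1) * Real.exp (-κ * (r - cp * t))

/-- The firewall functional `F̃` in the standing frame. -/
def FSF (V : Euc n → ℝ) (d : ℕ) (κ cm cp : ℝ) (u : ℝ → ℝ → Euc n) (t : ℝ) : ℝ :=
  ∫ r in Ioi (0:ℝ),
    psiSF d κ cm cp r t * (wV V * (‖ur u r t‖ ^ 2 / 2 + V (u r t)) + ‖u r t‖ ^ 2 / 2)

/-- The quantity `δ_dissip(t)` measuring the dissipation around the escape point. -/
def deltaDissip (u : ℝ → ℝ → Euc n) (re : ℝ → ℝ) (cesc : ℝ) (t : ℝ) : ℝ :=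
  sInf {ε : ℝ | 0 < ε ∧
    (∫ τ in (-1:ℝ)..1, ∫ ρ in (-(1/ε))..(1/ε),
      ‖ut u (re (t + τ) + ρ) (t + τ) + cesc • ur u (re (t + τ) + ρ) (t + τ)‖ ^ 2) ≤ ε}

/-- `u` solves the radially symmetric system with initial datum `u₀`, in the sense of the
semi-flow on bounded continuous functions (classical for positive times). -/
def SolvesWithInit (d : ℕ) (V : Euc n → ℝ) (u : ℝ → ℝ → Euc n) (u₀ : ℝ → Euc n) : Prop :=
  (∀ r : ℝ, 0 ≤ r → u r 0 = u₀ r) ∧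
  (∀ t : ℝ, 0 ≤ t → ContinuousOn (fun r => u r t) (Ici 0) ∧ ∃ C, ∀ r : ℝ, 0 ≤ r → ‖u r t‖ ≤ C) ∧
  (∀ t : ℝ, 0 ≤ t → ∀ ε > (0:ℝ), ∃ δ > (0:ℝ), ∀ t' : ℝ, 0 ≤ t' → |t' - t| ≤ δ →
    ∀ r : ℝ, 0 ≤ r → ‖u r t' - u r t‖ ≤ ε) ∧
  (∀ t > (0:ℝ), ∀ r > (0:ℝ),
    DifferentiableAt ℝ (fun s => u s t) r ∧ DifferentiableAt ℝ (fun s => ur u s t) r) ∧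
  (∀ t > (0:ℝ), ∀ r : ℝ, 0 ≤ r → DifferentiableAt ℝ (fun s => u r s) t) ∧
  (∀ t > (0:ℝ), ∀ r > (0:ℝ),
    ut u r t = -gradient V (u r t) + (((d : ℝ) - 1) / r) • ur u r t + urr u r t) ∧
  (∀ t > (0:ℝ), DifferentiableAt ℝ (fun s => u s t) 0 ∧ ur u 0 t = 0)

section

/-- First and second order conditions at an interior maximum. -/
theorem IsLocalMax.deriv_two_conditions {h h' : ℝ → ℝ} {h'' x : ℝ}
    (h1 : ∀ᶠ y in 𝓝 x, HasDerivAt h (h' y) y) (h2 : HasDerivAt h' h'' x)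
    (hx : IsLocalMax h x) : h' x = 0 ∧ h'' ≤ 0 := by
  have e0 : h' x = 0 := hx.hasDerivAt_eq_zero h1.self_of_nhds
  refine ⟨e0, ?_⟩
  by_contra hpos
  push Not at hpos
  have e1 : deriv h =ᶠ[𝓝 x] h' := h1.mono fun y hy => hy.deriv
  have e2 : deriv (deriv h) x = h'' := by rw [e1.deriv_eq]; exact h2.deriv
  have hmin : IsLocalMin h x := isLocalMin_of_deriv_deriv_pos (by rw [e2]; exact hpos)
    (by rw [e1.self_of_nhds, e0]) h1.self_of_nhds.continuousAt
  have hc : h =ᶠ[𝓝 x] fun _ => h x := by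
    filter_upwards [hx, hmin] with y hy hy'
    exact le_antisymm hy hy'
  have h3 : deriv h =ᶠ[𝓝 x] fun _ => 0 := by
    filter_upwards [hc.eventually_nhds] with y hy
    rw [Filter.EventuallyEq.deriv_eq hy]; simp
  have : deriv (deriv h) x = 0 := by rw [h3.deriv_eq]; simp
  linarith

/-- The derivative is nonnegative at a point dominating its left neighbourhood. -/
theorem HasDerivAt.nonneg_of_le_left {z : ℝ → ℝ} {z' a x : ℝ} (hz : HasDerivAt z z' x) (hax : a < x)
    (hle : ∀ s ∈ Icc a x, z s ≤ z x) : 0 ≤ z' := by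
  have h1 := (hasDerivAt_iff_tendsto_slope.1 hz).mono_left
    (nhdsWithin_mono x (fun y (hy : y ∈ Iio x) => ne_of_lt hy))
  refine ge_of_tendsto h1 ?_
  filter_upwards [Ioo_mem_nhdsLT hax] with s hs
  rw [slope_def_field]
  exact div_nonneg_of_nonpos (by linarith [hle s ⟨hs.1.le, hs.2.le⟩]) (by linarith [hs.2])

set_option maxHeartbeats 2000000 in
/-- Interior Lipschitz estimate, by doubling of variables, for solutions of a linear parabolic
equation with a bounded source term. -/
theorem parabolic_doubling {y yr yrr yt : ℝ → ℝ → ℝ} {a : ℝ → ℝ} {R t0 M N ā A : ℝ}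
    (hc : ContinuousOn (fun p : ℝ × ℝ => y p.1 p.2) (Icc (R - 3/2) (R + 3/2) ×ˢ Icc (t0 - 1) t0))
    (h1 : ∀ r ∈ Icc (R - 3/2) (R + 3/2), ∀ t ∈ Icc (t0 - 1) t0,
      HasDerivAt (fun x => y x t) (yr r t) r)
    (h2 : ∀ r ∈ Icc (R - 3/2) (R + 3/2), ∀ t ∈ Icc (t0 - 1) t0,
      HasDerivAt (fun x => yr x t) (yrr r t) r)
    (h3 : ∀ r ∈ Icc (R - 3/2) (R + 3/2), ∀ t ∈ Icc (t0 - 1) t0,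
      HasDerivAt (fun s => y r s) (yt r t) t)
    (pde : ∀ r ∈ Icc (R - 3/2) (R + 3/2), ∀ t ∈ Icc (t0 - 1) t0,
      |yt r t - yrr r t - a r * yr r t| ≤ N)
    (bd : ∀ r ∈ Icc (R - 3/2) (R + 3/2), ∀ t ∈ Icc (t0 - 1) t0, |y r t| ≤ M)
    (ha : AntitoneOn a (Icc (R - 3/2) (R + 3/2)))
    (hā : ∀ r ∈ Icc (R - 3/2) (R + 3/2), |a r| ≤ ā)
    (hA1 : 2 * M ≤ A) (hA2 : 4 * M + 4 * M * ā + 2 * N < 4 * A)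
    {ρ : ℝ} (hρ : ρ ∈ Icc (0:ℝ) 1) :
    y (R + ρ / 2) t0 - y (R - ρ / 2) t0 ≤ A * (2 * ρ - ρ ^ 2) := by
  have hM : 0 ≤ M := (abs_nonneg _).trans (bd R ⟨by linarith, by linarith⟩ t0 ⟨by linarith, le_rfl⟩)
  have hā0 : 0 ≤ ā := (abs_nonneg _).trans (hā R ⟨by linarith, by linarith⟩)
  let K : Set (ℝ × ℝ × ℝ) := Icc (-1:ℝ) 1 ×ˢ Icc (0:ℝ) 1 ×ˢ Icc (t0 - 1) t0
  have hK : IsCompact K := isCompact_Icc.prod (isCompact_Icc.prod isCompact_Icc)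
  let Z : ℝ × ℝ × ℝ → ℝ := fun p => y (R + p.1 + p.2.1 / 2) p.2.2 - y (R + p.1 - p.2.1 / 2) p.2.2
    - (A * (2 * p.2.1 - p.2.1 ^ 2) + 2 * M * p.1 ^ 2 + 2 * M * (t0 - p.2.2))
  have hZc : ContinuousOn Z K := by
    have c1 : ContinuousOn (fun p : ℝ × ℝ × ℝ => y (R + p.1 + p.2.1 / 2) p.2.2) K := by
      refine hc.comp (f := fun p : ℝ × ℝ × ℝ => (R + p.1 + p.2.1 / 2, p.2.2)) (by fun_prop) ?_
      rintro ⟨σ, r, t⟩ ⟨⟨a1, a2⟩, ⟨b1, b2⟩, ht⟩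
      simp only at a1 a2 b1 b2
      exact ⟨⟨by simp only; linarith, by simp only; linarith⟩, ht⟩
    have c2 : ContinuousOn (fun p : ℝ × ℝ × ℝ => y (R + p.1 - p.2.1 / 2) p.2.2) K := by
      refine hc.comp (f := fun p : ℝ × ℝ × ℝ => (R + p.1 - p.2.1 / 2, p.2.2)) (by fun_prop) ?_
      rintro ⟨σ, r, t⟩ ⟨⟨a1, a2⟩, ⟨b1, b2⟩, ht⟩
      simp only at a1 a2 b1 b2
      exact ⟨⟨by simp only; linarith, by simp only; linarith⟩, ht⟩
    exact (c1.sub c2).sub (by fun_prop)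
  obtain ⟨⟨σ, q, t⟩, hm, hmax⟩ := hK.exists_isMaxOn
    ⟨(0, 0, t0), ⟨by norm_num, by norm_num⟩, ⟨by norm_num, by norm_num⟩, by simp, by simp⟩ hZc
  suffices hZ : Z (σ, q, t) ≤ 0 by
    have := hmax (show ((0:ℝ), ρ, t0) ∈ K from ⟨⟨by norm_num, by norm_num⟩, hρ, by simp, by simp⟩)
    have h4 : Z (0, ρ, t0) ≤ 0 := le_trans this hZ
    simp only [Z] at h4
    norm_num at h4
    linarith
  by_contra hpos
  push Not at hpos
  obtain ⟨⟨s1, s2⟩, ⟨q1, q2⟩, ⟨t1, t2⟩⟩ := hm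
  simp only at s1 s2 q1 q2 t1 t2
  set r := R + σ + q / 2 with hr
  set r' := R + σ - q / 2 with hr'
  have hrI : r ∈ Icc (R - 3/2) (R + 3/2) := ⟨by linarith, by linarith⟩
  have hrI' : r' ∈ Icc (R - 3/2) (R + 3/2) := ⟨by linarith, by linarith⟩
  have hposE : 0 < y r t - y r' t - (A * (2 * q - q ^ 2) + 2 * M * σ ^ 2 + 2 * M * (t0 - t)) := hpos
  have hyb := abs_le.1 (bd r hrI t ⟨t1, t2⟩)
  have hyb' := abs_le.1 (bd r' hrI' t ⟨t1, t2⟩)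
  have hA0 : 0 ≤ A := by linarith
  have hq0 : 0 < q := by
    rcases q1.lt_or_eq with h | h
    · exact h
    · exfalso
      have : r = r' := by rw [hr, hr', ← h]; ring
      rw [this, ← h] at hposE
      nlinarith [mul_nonneg hM (sq_nonneg σ), mul_nonneg hM (sub_nonneg.2 t2)]
  have hw : 0 ≤ A * (2 * q - q ^ 2) := mul_nonneg hA0 (by nlinarith)
  have hMσ : 0 ≤ M * σ ^ 2 := mul_nonneg hM (sq_nonneg σ)
  have hMt : 0 ≤ M * (t0 - t) := mul_nonneg hM (by linarith)
  have hq1 : q < 1 := by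
    rcases q2.lt_or_eq with h | h
    · exact h
    · exfalso; rw [h] at hposE; nlinarith
  have hσ1 : σ < 1 := by
    rcases s2.lt_or_eq with h | h
    · exact h
    · exfalso; rw [h] at hposE; nlinarith
  have hσ2 : -1 < σ := by
    rcases s1.lt_or_eq with h | h
    · exact h
    · exfalso; rw [← h] at hposE; nlinarith
  have ht1 : t0 - 1 < t := by
    rcases t1.lt_or_eq with h | h
    · exact h
    · exfalso; rw [← h] at hposE; nlinarith
  -- the time derivative
  have dt : 0 ≤ yt r t - yt r' t + 2 * M := by
    have hd : HasDerivAt (fun s => Z (σ, q, s)) (yt r t - yt r' t + 2 * M) t := by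
      have := ((h3 r hrI t ⟨t1, t2⟩).sub (h3 r' hrI' t ⟨t1, t2⟩)).sub
        (((((hasDerivAt_id t).const_sub t0).const_mul (2 * M)).const_add
          (A * (2 * q - q ^ 2) + 2 * M * σ ^ 2)))
      exact this.congr_deriv (by ring)
    exact hd.nonneg_of_le_left ht1 fun s hs =>
      hmax ⟨⟨s1, s2⟩, ⟨q1, q2⟩, ⟨hs.1, hs.2.trans t2⟩⟩
  -- derivatives with respect to the first point
  have near : ∀ᶠ x in 𝓝 (0:ℝ), |x| < (1 - σ) ∧ |x| < σ + 1 ∧ |x| < q ∧ |x| < 1 - q := by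
    have hh : Tendsto (fun x : ℝ => |x|) (𝓝 0) (𝓝 0) := by
      simpa using (continuous_abs.tendsto (0:ℝ))
    exact (hh.eventually_lt_const (by linarith)).and ((hh.eventually_lt_const (by linarith)).and
      ((hh.eventually_lt_const hq0).and (hh.eventually_lt_const (by linarith))))
  have inK : ∀ x : ℝ, (|x| < (1 - σ) ∧ |x| < σ + 1 ∧ |x| < q ∧ |x| < 1 - q) →
      (σ + x / 2, q + x, t) ∈ K ∧ (σ + x / 2, q - x, t) ∈ K := by
    rintro x ⟨x1, x2, x3, x4⟩
    have := abs_lt.1 x1; have := abs_lt.1 x2; have := abs_lt.1 x3; have := abs_lt.1 x4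
    exact ⟨⟨⟨by simp only; linarith, by simp only; linarith⟩,
      ⟨by simp only; linarith, by simp only; linarith⟩, t1, t2⟩,
      ⟨⟨by simp only; linarith, by simp only; linarith⟩,
      ⟨by simp only; linarith, by simp only; linarith⟩, t1, t2⟩⟩
  have nearI : ∀ x : ℝ, (|x| < (1 - σ) ∧ |x| < σ + 1 ∧ |x| < q ∧ |x| < 1 - q) →
      r + x ∈ Icc (R - 3/2) (R + 3/2) ∧ r' + x ∈ Icc (R - 3/2) (R + 3/2) := by
    rintro x ⟨x1, x2, x3, x4⟩
    have := abs_lt.1 x1; have := abs_lt.1 x2; have := abs_lt.1 x3; have := abs_lt.1 x4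
    exact ⟨⟨by linarith, by linarith⟩, ⟨by linarith, by linarith⟩⟩
  have first : yr r t = A * (2 - 2 * q) + 2 * M * σ ∧ yrr r t ≤ -2 * A + M := by
    let h : ℝ → ℝ := fun x => Z (σ + x / 2, q + x, t)
    let h' : ℝ → ℝ := fun x => yr (r + x) t - (A * (2 - 2 * (q + x)) + 2 * M * (σ + x / 2))
    have hh : ∀ x, h x = y (r + x) t - y r' t
        - (A * (2 * (q + x) - (q + x) ^ 2) + 2 * M * (σ + x / 2) ^ 2 + 2 * M * (t0 - t)) := by
      intro x
      simp only [h, Z]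
      have e1 : R + (σ + x / 2) + (q + x) / 2 = r + x := by rw [hr]; ring
      have e2 : R + (σ + x / 2) - (q + x) / 2 = r' := by rw [hr']; ring
      rw [e1, e2]
    have l1 : ∀ᶠ x in 𝓝 (0:ℝ), HasDerivAt h (h' x) x := by
      filter_upwards [near] with x hx
      rw [show h = _ from funext hh]
      have d1 : HasDerivAt (fun x => y (r + x) t) (yr (r + x) t) x := by
        have := (h1 (r + x) (nearI x hx).1 t ⟨t1, t2⟩)
        simpa using HasDerivAt.comp_const_add r x this
      have d2 : HasDerivAt (fun x => A * (2 * (q + x) - (q + x) ^ 2) + 2 * M * (σ + x / 2) ^ 2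
          + 2 * M * (t0 - t)) (A * (2 - 2 * (q + x)) + 2 * M * (σ + x / 2)) x := by
        have e1 := (hasDerivAt_id x).const_add q
        have e2 := ((hasDerivAt_id x).div_const 2).const_add σ
        exact (((((e1.const_mul 2).sub (e1.pow 2)).const_mul A).add
          ((e2.pow 2).const_mul (2 * M))).add_const (2 * M * (t0 - t))).congr_deriv
          (by simp only [id, Nat.cast_ofNat, Nat.add_one_sub_one, pow_one]; ring)
      exact (d1.sub_const _).sub d2
    have l2 : HasDerivAt h' (yrr r t - (-2 * A + M)) 0 := by
      have d1 : HasDerivAt (fun x => yr (r + x) t) (yrr r t) 0 := by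
        have := h2 r hrI t ⟨t1, t2⟩
        rw [← add_zero r] at this
        simpa using HasDerivAt.comp_const_add r 0 this
      have e1 := (hasDerivAt_id (0:ℝ)).const_add q
      have e2 := ((hasDerivAt_id (0:ℝ)).div_const 2).const_add σ
      exact (d1.sub ((((e1.const_mul 2).const_sub 2).const_mul A).add
        (e2.const_mul (2 * M)))).congr_deriv (by ring)
    have lm : IsLocalMax h 0 := by
      filter_upwards [near] with x hx
      have := hmax (inK x hx).1
      simpa [h] using this
    have := lm.deriv_two_conditions l1 l2
    simp only [h', add_zero, zero_div] at this
    exact ⟨by linarith [this.1], by linarith [this.2]⟩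
  have second : yr r' t = A * (2 - 2 * q) - 2 * M * σ ∧ -yrr r' t ≤ -2 * A + M := by
    let h : ℝ → ℝ := fun x => Z (σ + x / 2, q - x, t)
    let h' : ℝ → ℝ := fun x => -yr (r' + x) t - (-A * (2 - 2 * (q - x)) + 2 * M * (σ + x / 2))
    have hh : ∀ x, h x = y r t - y (r' + x) t
        - (A * (2 * (q - x) - (q - x) ^ 2) + 2 * M * (σ + x / 2) ^ 2 + 2 * M * (t0 - t)) := by
      intro x
      simp only [h, Z]
      have e1 : R + (σ + x / 2) + (q - x) / 2 = r := by rw [hr]; ring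
      have e2 : R + (σ + x / 2) - (q - x) / 2 = r' + x := by rw [hr']; ring
      rw [e1, e2]
    have l1 : ∀ᶠ x in 𝓝 (0:ℝ), HasDerivAt h (h' x) x := by
      filter_upwards [near] with x hx
      rw [show h = _ from funext hh]
      have d1 : HasDerivAt (fun x => y (r' + x) t) (yr (r' + x) t) x := by
        have := (h1 (r' + x) (nearI x hx).2 t ⟨t1, t2⟩)
        simpa using HasDerivAt.comp_const_add r' x this
      have d2 : HasDerivAt (fun x => A * (2 * (q - x) - (q - x) ^ 2) + 2 * M * (σ + x / 2) ^ 2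
          + 2 * M * (t0 - t)) (-A * (2 - 2 * (q - x)) + 2 * M * (σ + x / 2)) x := by
        have e1 := (hasDerivAt_id x).const_sub q
        have e2 := ((hasDerivAt_id x).div_const 2).const_add σ
        exact (((((e1.const_mul 2).sub (e1.pow 2)).const_mul A).add
          ((e2.pow 2).const_mul (2 * M))).add_const (2 * M * (t0 - t))).congr_deriv
          (by simp only [id, Nat.cast_ofNat, Nat.add_one_sub_one, pow_one]; ring)
      exact (d1.const_sub _).sub d2
    have l2 : HasDerivAt h' (-yrr r' t - (-2 * A + M)) 0 := by
      have d1 : HasDerivAt (fun x => yr (r' + x) t) (yrr r' t) 0 := by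
        have := h2 r' hrI' t ⟨t1, t2⟩
        rw [← add_zero r'] at this
        simpa using HasDerivAt.comp_const_add r' 0 this
      have e1 := (hasDerivAt_id (0:ℝ)).const_sub q
      have e2 := ((hasDerivAt_id (0:ℝ)).div_const 2).const_add σ
      exact (d1.neg.sub ((((e1.const_mul 2).const_sub 2).const_mul (-A)).add
        (e2.const_mul (2 * M)))).congr_deriv (by ring)
    have lm : IsLocalMax h 0 := by
      filter_upwards [near] with x hx
      have := hmax (inK x hx).2
      simpa [h] using this
    have := lm.deriv_two_conditions l1 l2
    simp only [h', add_zero, sub_zero, zero_div] at this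
    exact ⟨by linarith [this.1], by linarith [this.2]⟩
  have p1 := (abs_le.1 (pde r hrI t ⟨t1, t2⟩)).2
  have p2 := (abs_le.1 (pde r' hrI' t ⟨t1, t2⟩)).1
  have har : a r ≤ a r' := ha hrI' hrI (by rw [hr, hr']; linarith)
  have b1 := abs_le.1 (hā r hrI)
  have b2 := abs_le.1 (hā r' hrI')
  have k1 : (a r - a r') * (A * (2 - 2 * q)) ≤ 0 :=
    mul_nonpos_of_nonpos_of_nonneg (by linarith) (mul_nonneg hA0 (by linarith))
  have k2 : (a r + a r') * (2 * M * σ) ≤ 4 * M * ā := by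
    have : |(a r + a r') * σ| ≤ (2 * ā) * 1 := by
      rw [abs_mul]
      refine mul_le_mul ?_ (abs_le.2 ⟨hσ2.le, hσ1.le⟩) (abs_nonneg _) (by linarith)
      exact abs_le.2 ⟨by linarith, by linarith⟩
    nlinarith [(abs_le.1 this).2]
  rw [first.1] at p1
  rw [second.1] at p2
  nlinarith [first.2, second.2]

end

section

variable {E : Type*} [NormedAddCommGroup E] [InnerProductSpace ℝ E]

theorem HasDerivAt.const_inner {f : ℝ → E} {f' : E} {x : ℝ} (e : E) (hf : HasDerivAt f f' x) :
    HasDerivAt (fun y => ⟪e, f y⟫) ⟪e, f'⟫ x := by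
  simpa using (hasDerivAt_const x e).inner ℝ hf

/-- A vector whose inner products with all unit vectors are bounded is bounded. -/
theorem norm_le_of_forall_inner_le {x : E} {B : ℝ} (hB : 0 ≤ B)
    (h : ∀ e : E, ‖e‖ ≤ 1 → ⟪e, x⟫ ≤ B) : ‖x‖ ≤ B := by
  by_cases hx : ‖x‖ = 0
  · rw [hx]; exact hB
  · have h1 := h (‖x‖⁻¹ • x) (by rw [norm_smul, norm_inv, norm_norm, inv_mul_cancel₀ hx])
    rw [real_inner_smul_left, real_inner_self_eq_norm_sq] at h1
    calc ‖x‖ = ‖x‖⁻¹ * ‖x‖ ^ 2 := by field_simp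
      _ ≤ B := h1

theorem abs_inner_le_of_norm_le_one {e x : E} {B : ℝ} (he : ‖e‖ ≤ 1) (hx : ‖x‖ ≤ B) :
    |⟪e, x⟫| ≤ B :=
  (abs_real_inner_le_norm e x).trans ((mul_le_of_le_one_left (norm_nonneg _) he).trans hx)

/-- Interior Lipschitz estimate for vector-valued solutions of a parabolic equation. -/
theorem parabolic_lipschitz {Y Yr Yrr Yt : ℝ → ℝ → E} {a : ℝ → ℝ} {R t0 M N ā : ℝ}
    (hc : ContinuousOn (fun p : ℝ × ℝ => Y p.1 p.2) (Icc (R - 3/2) (R + 3/2) ×ˢ Icc (t0 - 1) t0))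
    (h1 : ∀ r ∈ Icc (R - 3/2) (R + 3/2), ∀ t ∈ Icc (t0 - 1) t0,
      HasDerivAt (fun x => Y x t) (Yr r t) r)
    (h2 : ∀ r ∈ Icc (R - 3/2) (R + 3/2), ∀ t ∈ Icc (t0 - 1) t0,
      HasDerivAt (fun x => Yr x t) (Yrr r t) r)
    (h3 : ∀ r ∈ Icc (R - 3/2) (R + 3/2), ∀ t ∈ Icc (t0 - 1) t0,
      HasDerivAt (fun s => Y r s) (Yt r t) t)
    (pde : ∀ r ∈ Icc (R - 3/2) (R + 3/2), ∀ t ∈ Icc (t0 - 1) t0,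
      ‖Yt r t - Yrr r t - a r • Yr r t‖ ≤ N)
    (bd : ∀ r ∈ Icc (R - 3/2) (R + 3/2), ∀ t ∈ Icc (t0 - 1) t0, ‖Y r t‖ ≤ M)
    (ha : AntitoneOn a (Icc (R - 3/2) (R + 3/2)))
    (hā : ∀ r ∈ Icc (R - 3/2) (R + 3/2), |a r| ≤ ā)
    {ρ : ℝ} (hρ : ρ ∈ Icc (0:ℝ) 1) :
    ‖Y (R + ρ / 2) t0 - Y (R - ρ / 2) t0‖ ≤ 2 * (2 * M + M * ā + N) * ρ := by
  have hR : R ∈ Icc (R - 3/2) (R + 3/2) := ⟨by linarith, by linarith⟩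
  have ht0 : t0 ∈ Icc (t0 - 1) t0 := ⟨by linarith, le_rfl⟩
  have hM : 0 ≤ M := (norm_nonneg _).trans (bd R hR t0 ht0)
  have hN : 0 ≤ N := (norm_nonneg _).trans (pde R hR t0 ht0)
  have hā0 : 0 ≤ ā := (abs_nonneg _).trans (hā R hR)
  have hMa : 0 ≤ M * ā := mul_nonneg hM hā0
  have key : ∀ ε > 0, ‖Y (R + ρ / 2) t0 - Y (R - ρ / 2) t0‖ ≤ 2 * (2 * M + M * ā + N + ε) * ρ := by
    intro ε hε
    refine norm_le_of_forall_inner_le (mul_nonneg (by linarith) hρ.1) fun e he => ?_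
    have := parabolic_doubling (y := fun r t => ⟪e, Y r t⟫) (yr := fun r t => ⟪e, Yr r t⟫)
      (yrr := fun r t => ⟪e, Yrr r t⟫) (yt := fun r t => ⟪e, Yt r t⟫) (a := a) (M := M) (N := N)
      (A := 2 * M + M * ā + N + ε) (R := R) (t0 := t0) (ā := ā)
      (continuousOn_const.inner hc) (fun r hr t ht => (h1 r hr t ht).const_inner e)
      (fun r hr t ht => (h2 r hr t ht).const_inner e)
      (fun r hr t ht => (h3 r hr t ht).const_inner e)
      (fun r hr t ht => by
        have := abs_inner_le_of_norm_le_one he (pde r hr t ht)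
        rwa [inner_sub_right, inner_sub_right, real_inner_smul_right] at this)
      (fun r hr t ht => abs_inner_le_of_norm_le_one he (bd r hr t ht)) ha hā
      (by linarith) (by linarith) hρ
    rw [inner_sub_right]
    refine this.trans ?_
    nlinarith [mul_nonneg (show 0 ≤ 2 * M + M * ā + N + ε by linarith) (sq_nonneg ρ)]
  refine le_of_forall_pos_le_add fun ε hε => (key (ε / 2) (by linarith)).trans ?_
  nlinarith [hρ.1, hρ.2]

/-- Interior gradient estimate for vector-valued solutions of a parabolic equation. -/
theorem parabolic_gradient {Y Yr Yrr Yt : ℝ → ℝ → E} {a : ℝ → ℝ} {R t0 M N ā : ℝ}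
    (hc : ContinuousOn (fun p : ℝ × ℝ => Y p.1 p.2) (Icc (R - 3/2) (R + 3/2) ×ˢ Icc (t0 - 1) t0))
    (h1 : ∀ r ∈ Icc (R - 3/2) (R + 3/2), ∀ t ∈ Icc (t0 - 1) t0,
      HasDerivAt (fun x => Y x t) (Yr r t) r)
    (h2 : ∀ r ∈ Icc (R - 3/2) (R + 3/2), ∀ t ∈ Icc (t0 - 1) t0,
      HasDerivAt (fun x => Yr x t) (Yrr r t) r)
    (h3 : ∀ r ∈ Icc (R - 3/2) (R + 3/2), ∀ t ∈ Icc (t0 - 1) t0,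
      HasDerivAt (fun s => Y r s) (Yt r t) t)
    (pde : ∀ r ∈ Icc (R - 3/2) (R + 3/2), ∀ t ∈ Icc (t0 - 1) t0,
      ‖Yt r t - Yrr r t - a r • Yr r t‖ ≤ N)
    (bd : ∀ r ∈ Icc (R - 3/2) (R + 3/2), ∀ t ∈ Icc (t0 - 1) t0, ‖Y r t‖ ≤ M)
    (ha : AntitoneOn a (Icc (R - 3/2) (R + 3/2)))
    (hā : ∀ r ∈ Icc (R - 3/2) (R + 3/2), |a r| ≤ ā) :
    ‖Yr R t0‖ ≤ 2 * (2 * M + M * ā + N) := by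
  have hd := h1 R ⟨by linarith, by linarith⟩ t0 ⟨by linarith, le_rfl⟩
  have g : HasDerivAt (fun ρ : ℝ => Y (R + ρ / 2) t0 - Y (R - ρ / 2) t0) (Yr R t0) 0 := by
    have e1 : HasDerivAt (fun ρ : ℝ => R + ρ / 2) (1 / 2) 0 :=
      ((hasDerivAt_id (0:ℝ)).div_const 2).const_add R
    have e2 : HasDerivAt (fun ρ : ℝ => R - ρ / 2) (-(1 / 2)) 0 :=
      ((hasDerivAt_id (0:ℝ)).div_const 2).const_sub R
    have f1 := HasDerivAt.scomp_of_eq (0:ℝ) hd e1 (by simp)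
    have f2 := HasDerivAt.scomp_of_eq (0:ℝ) hd e2 (by simp)
    refine (f1.sub f2).congr_deriv ?_
    module
  have h4 := (hasDerivAt_iff_tendsto_slope.1 g).mono_left
    (nhdsWithin_mono 0 (fun y (hy : y ∈ Ioi (0:ℝ)) => ne_of_gt hy))
  refine le_of_tendsto h4.norm ?_
  filter_upwards [Ioo_mem_nhdsGT (zero_lt_one (α := ℝ))] with ρ hρ
  have := parabolic_lipschitz hc h1 h2 h3 pde bd ha hā (ρ := ρ) ⟨hρ.1.le, hρ.2.le⟩
  rw [slope_def_module]
  simp only [zero_div, add_zero, sub_zero, sub_self, norm_smul, norm_inv, Real.norm_eq_abs,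
    abs_of_pos hρ.1]
  rw [inv_mul_le_iff₀ hρ.1]
  linarith

end

section

variable {E : Type*} [NormedAddCommGroup E] [InnerProductSpace ℝ E]

/-- A potential `W` with gradient `G` on a ball of radius `C`, having a nondegenerate minimum point
at the origin, together with the relevant constants. -/
structure Pot (E : Type*) [NormedAddCommGroup E] [InnerProductSpace ℝ E] where
  G : E → E
  W : E → ℝ
  C : ℝ
  L : ℝ
  δ : ℝ
  lam : ℝ
  C_pos : 0 < C
  L_pos : 0 < L
  δ_pos : 0 < δ
  lam_pos : 0 < lam
  G_zero : G 0 = 0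
  W_zero : W 0 = 0
  lip : ∀ x y, ‖x‖ ≤ C → ‖y‖ ≤ C → ‖G x - G y‖ ≤ L * ‖x - y‖
  quad : ∀ x y, ‖x‖ ≤ C → ‖y‖ ≤ C → |W y - W x - ⟪y - x, G x⟫| ≤ L * ‖y - x‖ ^ 2
  coer : ∀ x, ‖x‖ ≤ δ → lam / 2 * ‖x‖ ^ 2 ≤ ⟪x, G x⟫
  grad : ∀ x, HasFDerivAt W (innerSL ℝ (G x)) x

/-- Radially symmetric solutions, with named partial derivatives. -/
structure RadSol (p : Pot E) (κ K : ℝ) (u ur urr ut : ℝ → ℝ → E) : Prop where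
  κ_nonneg : 0 ≤ κ
  dr : ∀ r t, 0 < t → HasDerivAt (fun x => u x t) (ur r t) r
  drr : ∀ r t, 0 < t → HasDerivAt (fun x => ur x t) (urr r t) r
  dt : ∀ r t, 0 < t → HasDerivAt (fun s => u r s) (ut r t) t
  bu : ∀ r t, 0 ≤ r → 0 < t → ‖u r t‖ ≤ p.C
  bur : ∀ r t, 0 ≤ r → 0 < t → ‖ur r t‖ ≤ K
  burr : ∀ r t, 0 ≤ r → 0 < t → ‖urr r t‖ ≤ K
  but : ∀ r t, 0 ≤ r → 0 < t → ‖ut r t‖ ≤ K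
  pde : ∀ r t, 0 < r → 0 < t → ut r t = -p.G (u r t) + (κ / r) • ur r t + urr r t

theorem norm_taylor_le {F : Type*} [NormedAddCommGroup F] [NormedSpace ℝ F] {f f' : ℝ → F}
    {x y B : ℝ} {D : F} (hf : ∀ z ∈ uIcc x y, HasDerivAt f (f' z) z)
    (hB : ∀ z ∈ uIcc x y, ‖f' z - D‖ ≤ B) : ‖f y - f x - (y - x) • D‖ ≤ B * |y - x| := by
  have h := (convex_uIcc x y).norm_image_sub_le_of_norm_hasDerivWithin_le
    (f := fun z => f z - z • D) (f' := fun z => f' z - (1:ℝ) • D) (C := B)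
    (fun z hz => ((hf z hz).sub ((hasDerivAt_id z).smul_const D)).hasDerivWithinAt)
    (fun z hz => by simpa using hB z hz) left_mem_uIcc right_mem_uIcc
  rw [Real.norm_eq_abs] at h
  convert h using 2
  module

theorem norm_sub_le_of_deriv_le {F : Type*} [NormedAddCommGroup F] [NormedSpace ℝ F]
    {f f' : ℝ → F} {x y B : ℝ} (hf : ∀ z ∈ uIcc x y, HasDerivAt f (f' z) z)
    (hB : ∀ z ∈ uIcc x y, ‖f' z‖ ≤ B) : ‖f y - f x‖ ≤ B * |y - x| := by
  simpa using norm_taylor_le (D := 0) hf (by simpa using hB)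

theorem le_of_mem_uIcc_of_le {a x y z : ℝ} (hz : z ∈ uIcc x y) (hx : a ≤ x) (hy : a ≤ y) :
    a ≤ z := (le_min hx hy).trans hz.1

theorem abs_sub_le_of_mem_uIcc {x y z : ℝ} (hz : z ∈ uIcc x y) : |z - x| ≤ |y - x| :=
  Set.abs_sub_left_of_mem_uIcc hz

namespace RadSol

variable {p : Pot E} {κ K : ℝ} {u ur urr ut : ℝ → ℝ → E}

theorem K_nonneg (S : RadSol p κ K u ur urr ut) : 0 ≤ K :=
  (norm_nonneg _).trans (S.bur 0 1 le_rfl one_pos)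

theorem lip_r (S : RadSol p κ K u ur urr ut) {r r' t : ℝ} (hr : 0 ≤ r) (hr' : 0 ≤ r') (ht : 0 < t) :
    ‖u r' t - u r t‖ ≤ K * |r' - r| :=
  norm_sub_le_of_deriv_le (f := fun x => u x t) (fun z _ => S.dr z t ht) fun z hz =>
    S.bur z t (le_of_mem_uIcc_of_le hz hr hr') ht

theorem lip_t (S : RadSol p κ K u ur urr ut) {r t t' : ℝ} (hr : 0 ≤ r) (ht : 0 < t) (ht' : 0 < t') :
    ‖u r t' - u r t‖ ≤ K * |t' - t| :=
  norm_sub_le_of_deriv_le (f := fun x => u r x)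
    (fun z hz => S.dt r z ((lt_min ht ht').trans_le hz.1)) fun z hz =>
    S.but r z hr ((lt_min ht ht').trans_le hz.1)

theorem continuousOn (S : RadSol p κ K u ur urr ut) :
    ContinuousOn (fun q : ℝ × ℝ => u q.1 q.2) (Ici 0 ×ˢ Ioi 0) := by
  have hl : LipschitzOnWith (2 * K).toNNReal (fun q : ℝ × ℝ => u q.1 q.2) (Ici 0 ×ˢ Ioi 0) := by
    refine LipschitzOnWith.of_dist_le_mul ?_
    rintro ⟨r, t⟩ ⟨hr, ht⟩ ⟨r', t'⟩ ⟨hr', ht'⟩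
    simp only [mem_Ici, mem_Ioi] at hr ht hr' ht'
    rw [Real.coe_toNNReal _ (by linarith [S.K_nonneg]), dist_eq_norm]
    have h1 := S.lip_r hr' hr ht
    have h2 := S.lip_t hr' ht' ht
    have h3 : |r - r'| ≤ dist (r, t) (r', t') := by
      rw [Prod.dist_eq, ← Real.dist_eq]; exact le_max_left _ _
    have h4 : |t - t'| ≤ dist (r, t) (r', t') := by
      rw [Prod.dist_eq, ← Real.dist_eq]; exact le_max_right _ _
    have hK := S.K_nonneg
    calc ‖u r t - u r' t'‖ = ‖(u r t - u r' t) + (u r' t - u r' t')‖ := by congr 1; abel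
      _ ≤ K * |r - r'| + K * |t - t'| := (norm_add_le _ _).trans (add_le_add h1 h2)
      _ ≤ 2 * K * dist (r, t) (r', t') := by nlinarith
  exact hl.continuousOn

/-- The interior estimates applied to time difference quotients. -/
theorem quotient_estimates (S : RadSol p κ K u ur urr ut) {R t0 h : ℝ} (hR : 3 ≤ R) (ht : 2 ≤ t0)
    (hh : |h| ≤ 1 / 2) (h0 : h ≠ 0) :
    (∀ ρ ∈ Icc (0:ℝ) 1, ‖h⁻¹ • (u (R + ρ / 2) (t0 + h) - u (R + ρ / 2) t0) -
      h⁻¹ • (u (R - ρ / 2) (t0 + h) - u (R - ρ / 2) t0)‖ ≤ 2 * (2 * K + K * κ + p.L * K) * ρ) ∧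
    ‖h⁻¹ • (ur R (t0 + h) - ur R t0)‖ ≤ 2 * (2 * K + K * κ + p.L * K) := by
  have hK := S.K_nonneg
  have hh' := abs_le.1 hh
  have hr : ∀ r ∈ Icc (R - 3/2) (R + 3/2), 1 ≤ r := fun r hr => by linarith [hr.1]
  have htt : ∀ t ∈ Icc (t0 - 1) t0, 0 < t := fun t ht' => by linarith [ht'.1]
  have htt' : ∀ t ∈ Icc (t0 - 1) t0, 0 < t + h := fun t ht' => by linarith [ht'.1]
  have ha0 : 0 < |h| := abs_pos.2 h0
  have hdiff : ∀ r ∈ Icc (R - 3/2) (R + 3/2), ∀ t ∈ Icc (t0 - 1) t0,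
      ‖u r (t + h) - u r t‖ ≤ K * |h| := fun r hr' t ht' => by
    simpa using S.lip_t (by linarith [hr r hr']) (htt t ht') (htt' t ht')
  let Y : ℝ → ℝ → E := fun r t => h⁻¹ • (u r (t + h) - u r t)
  let Yr : ℝ → ℝ → E := fun r t => h⁻¹ • (ur r (t + h) - ur r t)
  let Yrr : ℝ → ℝ → E := fun r t => h⁻¹ • (urr r (t + h) - urr r t)
  let Yt : ℝ → ℝ → E := fun r t => h⁻¹ • (ut r (t + h) - ut r t)
  have hc : ContinuousOn (fun q : ℝ × ℝ => Y q.1 q.2)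
      (Icc (R - 3/2) (R + 3/2) ×ˢ Icc (t0 - 1) t0) := by
    refine ContinuousOn.const_smul (ContinuousOn.sub ?_ ?_) _
    · refine S.continuousOn.comp (f := fun q : ℝ × ℝ => (q.1, q.2 + h)) (by fun_prop) ?_
      rintro ⟨r, t⟩ ⟨h1, h2⟩
      exact ⟨by simpa using zero_le_one.trans (hr r h1), htt' t h2⟩
    · refine S.continuousOn.mono ?_
      rintro ⟨r, t⟩ ⟨h1, h2⟩
      exact ⟨by simpa using zero_le_one.trans (hr r h1), htt t h2⟩
  have d1 : ∀ r ∈ Icc (R - 3/2) (R + 3/2), ∀ t ∈ Icc (t0 - 1) t0,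
      HasDerivAt (fun x => Y x t) (Yr r t) r := fun r hr t ht =>
    ((S.dr r _ (htt' t ht)).sub (S.dr r _ (htt t ht))).const_smul h⁻¹
  have d2 : ∀ r ∈ Icc (R - 3/2) (R + 3/2), ∀ t ∈ Icc (t0 - 1) t0,
      HasDerivAt (fun x => Yr x t) (Yrr r t) r := fun r hr t ht =>
    ((S.drr r _ (htt' t ht)).sub (S.drr r _ (htt t ht))).const_smul h⁻¹
  have d3 : ∀ r ∈ Icc (R - 3/2) (R + 3/2), ∀ t ∈ Icc (t0 - 1) t0,
      HasDerivAt (fun s => Y r s) (Yt r t) t := fun r hr t ht =>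
    (((S.dt r _ (htt' t ht)).comp_add_const t h).sub (S.dt r _ (htt t ht))).const_smul h⁻¹
  have hp : ∀ r ∈ Icc (R - 3/2) (R + 3/2), ∀ t ∈ Icc (t0 - 1) t0,
      ‖Yt r t - Yrr r t - (κ / r) • Yr r t‖ ≤ p.L * K := by
    intro r hr' t ht'
    have r0 : 0 < r := by linarith [hr r hr']
    have e : Yt r t - Yrr r t - (κ / r) • Yr r t = -(h⁻¹ • (p.G (u r (t + h)) - p.G (u r t))) := by
      simp only [Yt, Yrr, Yr, S.pde r t r0 (htt t ht'), S.pde r (t + h) r0 (htt' t ht')]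
      module
    rw [e, norm_neg, norm_smul, norm_inv, Real.norm_eq_abs, inv_mul_le_iff₀ ha0]
    have := p.lip _ _ (S.bu r (t + h) r0.le (htt' t ht')) (S.bu r t r0.le (htt t ht'))
    have h2 := mul_le_mul_of_nonneg_left (hdiff r hr' t ht') p.L_pos.le
    linarith
  have hb : ∀ r ∈ Icc (R - 3/2) (R + 3/2), ∀ t ∈ Icc (t0 - 1) t0, ‖Y r t‖ ≤ K := by
    intro r hr' t ht'
    simp only [Y]
    rw [norm_smul, norm_inv, Real.norm_eq_abs, inv_mul_le_iff₀ ha0]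
    linarith [hdiff r hr' t ht']
  have ha : AntitoneOn (fun r => κ / r) (Icc (R - 3/2) (R + 3/2)) := fun r h1 r' _ h3 =>
    div_le_div_of_nonneg_left S.κ_nonneg (by linarith [hr r h1]) h3
  have hā : ∀ r ∈ Icc (R - 3/2) (R + 3/2), |κ / r| ≤ κ := fun r h1 => by
    rw [abs_of_nonneg (div_nonneg S.κ_nonneg (by linarith [hr r h1]))]
    exact div_le_self S.κ_nonneg (hr r h1)
  exact ⟨fun ρ hρ => parabolic_lipschitz hc d1 d2 d3 hp hb ha hā hρ,
    parabolic_gradient hc d1 d2 d3 hp hb ha hā⟩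

/-- A Lipschitz constant for the derivatives. -/
def lipConst (p : Pot E) (κ K : ℝ) : ℝ := 2 * (2 * K + K * κ + p.L * K)

theorem four_K_le (S : RadSol p κ K u ur urr ut) : 4 * K ≤ lipConst p κ K := by
  have hK := S.K_nonneg
  have := mul_nonneg hK S.κ_nonneg
  have := mul_nonneg p.L_pos.le hK
  unfold lipConst; linarith

theorem ur_lip_t (S : RadSol p κ K u ur urr ut) {r t t' : ℝ} (hr : 3 ≤ r) (ht : 2 ≤ t)
    (ht' : 2 ≤ t') : ‖ur r t' - ur r t‖ ≤ lipConst p κ K * |t' - t| := by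
  rcases eq_or_ne t' t with h | h
  · simp [h]
  have h0 : 0 < |t' - t| := abs_pos.2 (sub_ne_zero.2 h)
  by_cases hh : |t' - t| ≤ 1 / 2
  · have := (S.quotient_estimates hr ht hh (sub_ne_zero.2 h)).2
    rw [add_sub_cancel, norm_smul, norm_inv, Real.norm_eq_abs, inv_mul_le_iff₀ h0] at this
    unfold lipConst; linarith
  · have h1 := S.bur r t (by linarith) (by linarith)
    have h2 := S.bur r t' (by linarith) (by linarith)
    have := norm_sub_le (ur r t') (ur r t)
    have := S.four_K_le
    have := S.K_nonneg
    push Not at hh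
    nlinarith

theorem ut_lip_r (S : RadSol p κ K u ur urr ut) {r r' t : ℝ} (hr : 3 ≤ r) (hr' : 3 ≤ r')
    (ht : 2 ≤ t) : ‖ut r' t - ut r t‖ ≤ lipConst p κ K * |r' - r| := by
  wlog hle : r ≤ r' generalizing r r'
  · rw [norm_sub_rev, abs_sub_comm]; exact this hr' hr (by linarith)
  rw [abs_of_nonneg (sub_nonneg.2 hle)]
  by_cases hh : r' - r ≤ 1
  · have l1 : ∀ x, Tendsto (fun h : ℝ => h⁻¹ • (u x (t + h) - u x t)) (𝓝[≠] 0) (𝓝 (ut x t)) :=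
      fun x => (S.dt x t (by linarith)).tendsto_slope_zero
    refine le_of_tendsto ((l1 r').sub (l1 r)).norm ?_
    have : ∀ᶠ h in 𝓝[≠] (0:ℝ), |h| ≤ 1 / 2 := by
      refine nhdsWithin_le_nhds ?_
      have := (continuous_abs.tendsto (0:ℝ)).eventually_le_const (u := 1/2) (by norm_num)
      exact this
    filter_upwards [this, self_mem_nhdsWithin] with h h1 h2
    have := (S.quotient_estimates (R := (r + r') / 2) (by linarith) ht h1 h2).1 (r' - r)
      ⟨by linarith, hh⟩
    rw [show (r + r') / 2 + (r' - r) / 2 = r' by ring,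
      show (r + r') / 2 - (r' - r) / 2 = r by ring] at this
    exact this
  · have h1 := S.but r t (by linarith) (by linarith)
    have h2 := S.but r' t (by linarith) (by linarith)
    have := norm_sub_le (ut r' t) (ut r t)
    have := S.four_K_le
    have := S.K_nonneg
    push Not at hh
    nlinarith

theorem norm_coeff_le (S : RadSol p κ K u ur urr ut) {r : ℝ} (hr : 1 ≤ r) : ‖κ / r‖ ≤ κ := by
  rw [Real.norm_eq_abs, abs_of_nonneg (div_nonneg S.κ_nonneg (by linarith))]
  exact div_le_self S.κ_nonneg hr

theorem coeff_lip (S : RadSol p κ K u ur urr ut) {r r' : ℝ} (hr : 1 ≤ r) (hr' : 1 ≤ r') :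
    ‖κ / r' - κ / r‖ ≤ κ * |r' - r| := by
  have e : κ / r' - κ / r = κ * ((r - r') / (r * r')) := by
    have : r ≠ 0 := by linarith
    have : r' ≠ 0 := by linarith
    field_simp
  rw [e, norm_mul, Real.norm_eq_abs, Real.norm_eq_abs, abs_of_nonneg S.κ_nonneg, abs_div,
    abs_sub_comm r r', abs_of_pos (show 0 < r * r' by positivity)]
  exact mul_le_mul_of_nonneg_left (div_le_self (abs_nonneg _) (by nlinarith)) S.κ_nonneg

theorem urr_lip_r (S : RadSol p κ K u ur urr ut) {r r' t : ℝ} (hr : 3 ≤ r) (hr' : 3 ≤ r')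
    (ht : 2 ≤ t) : ‖urr r' t - urr r t‖ ≤ (2 * lipConst p κ K) * |r' - r| := by
  have e : ∀ x, 3 ≤ x → urr x t = ut x t + p.G (u x t) - (κ / x) • ur x t := fun x hx => by
    rw [S.pde x t (by linarith) (by linarith)]; abel
  have h1 := S.ut_lip_r hr hr' ht
  have h2 := (p.lip _ _ (S.bu r' t (by linarith) (by linarith)) (S.bu r t (by linarith)
    (by linarith))).trans (mul_le_mul_of_nonneg_left (S.lip_r (by linarith) (by linarith)
      (by linarith)) p.L_pos.le)
  have h3 : ‖(κ / r') • ur r' t - (κ / r) • ur r t‖ ≤ κ * (K * |r' - r|) + κ * |r' - r| * K := by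
    have : (κ / r') • ur r' t - (κ / r) • ur r t =
        (κ / r') • (ur r' t - ur r t) + (κ / r' - κ / r) • ur r t := by module
    rw [this]
    refine (norm_add_le _ _).trans (add_le_add ?_ ?_)
    · rw [norm_smul]
      refine mul_le_mul (S.norm_coeff_le (by linarith)) ?_ (norm_nonneg _) S.κ_nonneg
      exact norm_sub_le_of_deriv_le (f := fun x => ur x t) (fun z _ => S.drr z t (by linarith))
        fun z hz => S.burr z t (le_of_mem_uIcc_of_le hz (by linarith) (by linarith)) (by linarith)
    · rw [norm_smul]
      exact mul_le_mul (S.coeff_lip (by linarith) (by linarith))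
        (S.bur r t (by linarith) (by linarith)) (norm_nonneg _)
        (mul_nonneg S.κ_nonneg (abs_nonneg _))
  rw [e r hr, e r' hr']
  have h4 : ‖ut r' t + p.G (u r' t) - (κ / r') • ur r' t -
      (ut r t + p.G (u r t) - (κ / r) • ur r t)‖ ≤ ‖ut r' t - ut r t‖ +
      ‖p.G (u r' t) - p.G (u r t)‖ + ‖(κ / r') • ur r' t - (κ / r) • ur r t‖ := by
    rw [show ut r' t + p.G (u r' t) - (κ / r') • ur r' t -
      (ut r t + p.G (u r t) - (κ / r) • ur r t) = (ut r' t - ut r t) +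
      (p.G (u r' t) - p.G (u r t)) - ((κ / r') • ur r' t - (κ / r) • ur r t) by abel]
    exact (norm_sub_le _ _).trans (add_le_add_left (norm_add_le _ _) _)
  have hK := S.K_nonneg
  have h5 := mul_nonneg hK (abs_nonneg (r' - r))
  have h6 := mul_nonneg p.L_pos.le h5
  unfold lipConst at *
  nlinarith

theorem ut_holder_t (S : RadSol p κ K u ur urr ut) {r t t' : ℝ} (hr : 3 ≤ r) (ht : 2 ≤ t)
    (ht' : 2 ≤ t') :
    ‖ut r t' - ut r t‖ ≤ ((5 + κ) * lipConst p κ K) * Real.sqrt |t' - t| := by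
  have hK := S.K_nonneg
  have hA := S.four_K_le
  have hκ := S.κ_nonneg
  set A := lipConst p κ K with hAdef
  have hA0 : 0 ≤ A := by linarith
  have hκA := mul_nonneg hκ hA0
  set ε := Real.sqrt |t' - t| with hε
  have hε2 : ε ^ 2 = |t' - t| := Real.sq_sqrt (abs_nonneg _)
  have hε0 : 0 ≤ ε := Real.sqrt_nonneg _
  rcases hε0.eq_or_lt with h0 | h0
  · have : t' = t := by
      rw [← h0] at hε2
      have : |t' - t| = 0 := by rw [← hε2]; norm_num
      linarith [abs_eq_zero.1 this]
    simp [this, ← h0]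
  by_cases hh : 1 < ε
  · have h1 := S.but r t (by linarith) (by linarith)
    have h2 := S.but r t' (by linarith) (by linarith)
    have := norm_sub_le (ut r t') (ut r t)
    nlinarith
  push Not at hh
  set D := ut r t' - ut r t with hD
  have hmem : ∀ z ∈ uIcc r (r + ε), 3 ≤ z ∧ |z - r| ≤ ε := fun z hz =>
    ⟨le_of_mem_uIcc_of_le hz hr (by linarith), by
      simpa [abs_of_nonneg hε0] using abs_sub_le_of_mem_uIcc hz⟩
  have key := norm_taylor_le (f := fun x => ur x t' - ur x t) (D := D) (x := r) (y := r + ε)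
    (B := 2 * A * ε + p.L * (K * ε ^ 2) + κ * (A * ε ^ 2))
    (fun z _ => (S.drr z t' (by linarith)).sub (S.drr z t (by linarith))) (by
      intro z hz
      obtain ⟨hz1, hz2⟩ := hmem z hz
      have e : ∀ s, 2 ≤ s → urr z s = ut z s + p.G (u z s) - (κ / z) • ur z s := fun s hs => by
        rw [S.pde z s (by linarith) (by linarith)]; abel
      have k1 := (S.ut_lip_r hr hz1 ht').trans (mul_le_mul_of_nonneg_left hz2 hA0)
      have k2 := (S.ut_lip_r hr hz1 ht).trans (mul_le_mul_of_nonneg_left hz2 hA0)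
      have k3 := (p.lip _ _ (S.bu z t' (by linarith) (by linarith)) (S.bu z t (by linarith)
        (by linarith))).trans (mul_le_mul_of_nonneg_left (S.lip_t (by linarith) (by linarith)
          (by linarith)) p.L_pos.le)
      have k4 : ‖(κ / z) • (ur z t' - ur z t)‖ ≤ κ * (A * |t' - t|) := by
        rw [norm_smul]
        exact mul_le_mul (S.norm_coeff_le (by linarith)) (S.ur_lip_t hz1 ht ht') (norm_nonneg _) hκ
      rw [← hε2] at k3 k4
      rw [e t ht, e t' ht', show ut z t' + p.G (u z t') - (κ / z) • ur z t' -
        (ut z t + p.G (u z t) - (κ / z) • ur z t) - D = (ut z t' - ut r t') - (ut z t - ut r t) +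
        (p.G (u z t') - p.G (u z t)) - (κ / z) • (ur z t' - ur z t) by rw [hD]; module]
      have a1 := norm_sub_le ((ut z t' - ut r t') - (ut z t - ut r t) +
        (p.G (u z t') - p.G (u z t))) ((κ / z) • (ur z t' - ur z t))
      have a2 := norm_add_le ((ut z t' - ut r t') - (ut z t - ut r t)) (p.G (u z t') - p.G (u z t))
      have a3 := norm_sub_le (ut z t' - ut r t') (ut z t - ut r t)
      linarith)
  simp only [add_sub_cancel_left, abs_of_nonneg hε0] at key
  have b1 := S.ur_lip_t hr ht ht'
  have b2 := S.ur_lip_t (r := r + ε) (by linarith) ht ht'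
  rw [← hε2] at b1 b2
  have b3 : ‖ε • D‖ ≤ ‖ur (r + ε) t' - ur (r + ε) t - (ur r t' - ur r t) - ε • D‖ +
      (‖ur (r + ε) t' - ur (r + ε) t‖ + ‖ur r t' - ur r t‖) := by
    rw [show ε • D = -(ur (r + ε) t' - ur (r + ε) t - (ur r t' - ur r t) - ε • D) +
      (ur (r + ε) t' - ur (r + ε) t - (ur r t' - ur r t)) by abel]
    refine (norm_add_le _ _).trans (add_le_add (by rw [norm_neg]; simp) (norm_sub_le _ _))
  rw [norm_smul, Real.norm_eq_abs, abs_of_nonneg hε0] at b3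
  have hLK : 2 * (p.L * K) ≤ A := by
    rw [hAdef]; unfold lipConst; nlinarith [mul_nonneg hK hκ]
  have hLK0 := mul_nonneg p.L_pos.le hK
  have b4 : ε * ‖D‖ ≤ ε * (((5 + κ) * A) * ε) := by
    have c1 : p.L * (K * ε ^ 2) * ε ≤ A * ε ^ 2 := by
      have : ε ^ 2 * ε ≤ ε ^ 2 := by nlinarith
      nlinarith [mul_le_mul_of_nonneg_left this hLK0, sq_nonneg ε]
    have c2 : κ * (A * ε ^ 2) * ε ≤ κ * A * ε ^ 2 := by
      have : ε ^ 2 * ε ≤ ε ^ 2 := by nlinarith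
      nlinarith [mul_le_mul_of_nonneg_left this hκA]
    nlinarith
  exact le_of_mul_le_mul_left b4 h0

end RadSol

end

section

variable {E : Type*} [NormedAddCommGroup E] [InnerProductSpace ℝ E]

/-- Solutions of `U_s = U_ξξ - G(U)` defined for all times on the whole line, with named partial
derivatives and quantitative regularity. -/
structure EntireSol (p : Pot E) (K : ℝ) (U P Z W : ℝ → ℝ → E) : Prop where
  bU : ∀ ξ s, ‖U ξ s‖ ≤ p.C
  bP : ∀ ξ s, ‖P ξ s‖ ≤ K
  bZ : ∀ ξ s, ‖Z ξ s‖ ≤ K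
  bW : ∀ ξ s, ‖W ξ s‖ ≤ K
  U_x : ∀ ξ s h, ‖U (ξ + h) s - U ξ s - h • P ξ s‖ ≤ K * |h| * |h|
  P_x : ∀ ξ s h, ‖P (ξ + h) s - P ξ s - h • Z ξ s‖ ≤ K * |h| * |h|
  U_t : ∀ ξ s h, ‖U ξ (s + h) - U ξ s - h • W ξ s‖ ≤ K * Real.sqrt |h| * |h|
  P_t : ∀ ξ s h, ‖P ξ (s + h) - P ξ s‖ ≤ K * |h|
  W_x : ∀ ξ s h, ‖W (ξ + h) s - W ξ s‖ ≤ K * |h|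
  W_t : ∀ ξ s h, ‖W ξ (s + h) - W ξ s‖ ≤ K * Real.sqrt |h|
  pde : ∀ ξ s, W ξ s = Z ξ s - p.G (U ξ s)

/-- Families satisfying asymptotically the defining properties of an entire solution. -/
structure AsympSol {ι : Type*} (F : Filter ι) (p : Pot E) (K : ℝ) (U P Z W : ι → ℝ → ℝ → E) :
    Prop where
  bU : ∀ ξ s, ∀ᶠ i in F, ‖U i ξ s‖ ≤ p.C
  bP : ∀ ξ s, ∀ᶠ i in F, ‖P i ξ s‖ ≤ K
  bZ : ∀ ξ s, ∀ᶠ i in F, ‖Z i ξ s‖ ≤ K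
  bW : ∀ ξ s, ∀ᶠ i in F, ‖W i ξ s‖ ≤ K
  U_x : ∀ ξ s h, ∀ᶠ i in F, ‖U i (ξ + h) s - U i ξ s - h • P i ξ s‖ ≤ K * |h| * |h|
  P_x : ∀ ξ s h, ∀ᶠ i in F, ‖P i (ξ + h) s - P i ξ s - h • Z i ξ s‖ ≤ K * |h| * |h|
  U_t : ∀ ξ s h, ∀ᶠ i in F, ‖U i ξ (s + h) - U i ξ s - h • W i ξ s‖ ≤ K * Real.sqrt |h| * |h|
  P_t : ∀ ξ s h, ∀ᶠ i in F, ‖P i ξ (s + h) - P i ξ s‖ ≤ K * |h|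
  W_x : ∀ ξ s h, ∀ᶠ i in F, ‖W i (ξ + h) s - W i ξ s‖ ≤ K * |h|
  W_t : ∀ ξ s h, ∀ᶠ i in F, ‖W i ξ (s + h) - W i ξ s‖ ≤ K * Real.sqrt |h|
  pde : ∀ ξ s, Tendsto (fun i => W i ξ s - (Z i ξ s - p.G (U i ξ s))) F (𝓝 0)

theorem Ultrafilter.exists_tendsto_of_norm_le [ProperSpace E] {ι : Type*} (F : Ultrafilter ι)
    {f : ι → E} {K : ℝ} (h : ∀ᶠ i in (F : Filter ι), ‖f i‖ ≤ K) :
    ∃ x, Tendsto f F (𝓝 x) := by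
  obtain ⟨x, _, hx⟩ := (isCompact_closedBall (0:E) K).ultrafilter_le_nhds' (F.map f)
    (by
      change ∀ᶠ i in (F : Filter ι), f i ∈ Metric.closedBall (0:E) K
      filter_upwards [h] with i hi; simpa using hi)
  exact ⟨x, hx⟩

/-- Compactness: an asymptotic family converges pointwise along an ultrafilter towards an entire
solution. -/
theorem AsympSol.exists_limit [ProperSpace E] {ι : Type*} {F : Ultrafilter ι} {p : Pot E} {K : ℝ}
    {U P Z W : ι → ℝ → ℝ → E} (A : AsympSol (F : Filter ι) p K U P Z W) :
    ∃ U' P' Z' W' : ℝ → ℝ → E, EntireSol p K U' P' Z' W' ∧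
      (∀ ξ s, Tendsto (fun i => U i ξ s) F (𝓝 (U' ξ s))) ∧
      (∀ ξ s, Tendsto (fun i => P i ξ s) F (𝓝 (P' ξ s))) ∧
      (∀ ξ s, Tendsto (fun i => W i ξ s) F (𝓝 (W' ξ s))) := by
  choose U' hU using fun ξ s => F.exists_tendsto_of_norm_le (A.bU ξ s)
  choose P' hP using fun ξ s => F.exists_tendsto_of_norm_le (A.bP ξ s)
  choose Z' hZ using fun ξ s => F.exists_tendsto_of_norm_le (A.bZ ξ s)
  choose W' hW using fun ξ s => F.exists_tendsto_of_norm_le (A.bW ξ s)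
  have bU : ∀ ξ s, ‖U' ξ s‖ ≤ p.C := fun ξ s => le_of_tendsto (hU ξ s).norm (A.bU ξ s)
  refine ⟨U', P', Z', W', ⟨bU, ?_, ?_, ?_, ?_, ?_, ?_, ?_, ?_, ?_, ?_⟩, hU, hP, hW⟩
  · exact fun ξ s => le_of_tendsto (hP ξ s).norm (A.bP ξ s)
  · exact fun ξ s => le_of_tendsto (hZ ξ s).norm (A.bZ ξ s)
  · exact fun ξ s => le_of_tendsto (hW ξ s).norm (A.bW ξ s)
  · exact fun ξ s h => le_of_tendsto (((hU _ _).sub (hU _ _)).sub ((hP _ _).const_smul h)).norm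
      (A.U_x ξ s h)
  · exact fun ξ s h => le_of_tendsto (((hP _ _).sub (hP _ _)).sub ((hZ _ _).const_smul h)).norm
      (A.P_x ξ s h)
  · exact fun ξ s h => le_of_tendsto (((hU _ _).sub (hU _ _)).sub ((hW _ _).const_smul h)).norm
      (A.U_t ξ s h)
  · exact fun ξ s h => le_of_tendsto ((hP _ _).sub (hP _ _)).norm (A.P_t ξ s h)
  · exact fun ξ s h => le_of_tendsto ((hW _ _).sub (hW _ _)).norm (A.W_x ξ s h)
  · exact fun ξ s h => le_of_tendsto ((hW _ _).sub (hW _ _)).norm (A.W_t ξ s h)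
  · intro ξ s
    have hG : Tendsto (fun i => p.G (U i ξ s)) F (𝓝 (p.G (U' ξ s))) := by
      rw [tendsto_iff_norm_sub_tendsto_zero]
      have h0 : Tendsto (fun i => p.L * ‖U i ξ s - U' ξ s‖) F (𝓝 0) := by
        simpa using (tendsto_iff_norm_sub_tendsto_zero.1 (hU ξ s)).const_mul p.L
      refine squeeze_zero' (Eventually.of_forall fun i => norm_nonneg _) ?_ h0
      filter_upwards [A.bU ξ s] with i hi
      exact p.lip _ _ hi (bU ξ s)
    have := tendsto_nhds_unique (A.pde ξ s) ((hW ξ s).sub ((hZ ξ s).sub hG))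
    exact (sub_eq_zero.1 this.symm)

theorem hasDerivAt_of_norm_le {F : Type*} [NormedAddCommGroup F] [NormedSpace ℝ F] {f : ℝ → F}
    {D : F} {x : ℝ} {g : ℝ → ℝ} (hg : Tendsto g (𝓝 0) (𝓝 0))
    (h : ∀ᶠ y in 𝓝 (0:ℝ), ‖f (x + y) - f x - y • D‖ ≤ g y * |y|) : HasDerivAt f D x := by
  rw [hasDerivAt_iff_isLittleO_nhds_zero, Asymptotics.isLittleO_iff]
  intro c hc
  filter_upwards [h, hg.eventually_le_const hc] with y h1 h2
  exact h1.trans (mul_le_mul_of_nonneg_right h2 (abs_nonneg _))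

theorem tendsto_mul_abs_zero (K : ℝ) : Tendsto (fun h : ℝ => K * |h|) (𝓝 0) (𝓝 0) := by
  have : Continuous fun h : ℝ => K * |h| := by fun_prop
  simpa using this.tendsto 0

theorem tendsto_mul_sqrt_abs_zero (K : ℝ) :
    Tendsto (fun h : ℝ => K * Real.sqrt |h|) (𝓝 0) (𝓝 0) := by
  have : Continuous fun h : ℝ => K * Real.sqrt |h| := by fun_prop
  simpa using this.tendsto 0

theorem continuous_of_partial_modulus {f : ℝ → ℝ → E} {g₁ g₂ : ℝ → ℝ}
    (hg₁ : Tendsto g₁ (𝓝 0) (𝓝 0)) (hg₂ : Tendsto g₂ (𝓝 0) (𝓝 0))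
    (h₁ : ∀ ξ s h, ‖f (ξ + h) s - f ξ s‖ ≤ g₁ h) (h₂ : ∀ ξ s h, ‖f ξ (s + h) - f ξ s‖ ≤ g₂ h) :
    Continuous fun q : ℝ × ℝ => f q.1 q.2 := by
  rw [continuous_iff_continuousAt]
  rintro ⟨ξ, s⟩
  rw [ContinuousAt, tendsto_iff_norm_sub_tendsto_zero]
  have t1 : Tendsto (fun q : ℝ × ℝ => g₁ (q.1 - ξ)) (𝓝 (ξ, s)) (𝓝 0) :=
    hg₁.comp (by
      have : Continuous fun q : ℝ × ℝ => q.1 - ξ := by fun_prop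
      simpa using this.tendsto (ξ, s))
  have t2 : Tendsto (fun q : ℝ × ℝ => g₂ (q.2 - s)) (𝓝 (ξ, s)) (𝓝 0) :=
    hg₂.comp (by
      have : Continuous fun q : ℝ × ℝ => q.2 - s := by fun_prop
      simpa using this.tendsto (ξ, s))
  refine squeeze_zero (fun _ => norm_nonneg _) (fun q => ?_) (by simpa using t1.add t2)
  have a := h₁ ξ q.2 (q.1 - ξ)
  have b := h₂ ξ s (q.2 - s)
  rw [add_sub_cancel] at a b
  calc ‖f q.1 q.2 - f ξ s‖ = ‖(f q.1 q.2 - f ξ q.2) + (f ξ q.2 - f ξ s)‖ := by congr 1; abel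
    _ ≤ _ := (norm_add_le _ _).trans (add_le_add a b)

namespace EntireSol
variable {p : Pot E} {K : ℝ} {U P Z W : ℝ → ℝ → E}

theorem K_nonneg (S : EntireSol p K U P Z W) : 0 ≤ K := (norm_nonneg _).trans (S.bP 0 0)

theorem dU (S : EntireSol p K U P Z W) (ξ s : ℝ) : HasDerivAt (fun x => U x s) (P ξ s) ξ :=
  hasDerivAt_of_norm_le (tendsto_mul_abs_zero K) (Eventually.of_forall fun h => S.U_x ξ s h)

theorem dP (S : EntireSol p K U P Z W) (ξ s : ℝ) : HasDerivAt (fun x => P x s) (Z ξ s) ξ :=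
  hasDerivAt_of_norm_le (tendsto_mul_abs_zero K) (Eventually.of_forall fun h => S.P_x ξ s h)

theorem dt (S : EntireSol p K U P Z W) (ξ s : ℝ) : HasDerivAt (fun x => U ξ x) (W ξ s) s :=
  hasDerivAt_of_norm_le (tendsto_mul_sqrt_abs_zero K) (Eventually.of_forall fun h => S.U_t ξ s h)

theorem U_lip_x (S : EntireSol p K U P Z W) (ξ s h : ℝ) : ‖U (ξ + h) s - U ξ s‖ ≤ K * |h| := by
  simpa using norm_sub_le_of_deriv_le (x := ξ) (y := ξ + h) (fun z _ => S.dU z s)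
    fun z _ => S.bP z s

theorem U_lip_t (S : EntireSol p K U P Z W) (ξ s h : ℝ) : ‖U ξ (s + h) - U ξ s‖ ≤ K * |h| := by
  simpa using norm_sub_le_of_deriv_le (x := s) (y := s + h) (fun z _ => S.dt ξ z)
    fun z _ => S.bW ξ z

theorem P_lip_x (S : EntireSol p K U P Z W) (ξ s h : ℝ) : ‖P (ξ + h) s - P ξ s‖ ≤ K * |h| := by
  simpa using norm_sub_le_of_deriv_le (x := ξ) (y := ξ + h) (fun z _ => S.dP z s)
    fun z _ => S.bZ z s

theorem continuous_U (S : EntireSol p K U P Z W) : Continuous fun q : ℝ × ℝ => U q.1 q.2 :=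
  continuous_of_partial_modulus (tendsto_mul_abs_zero K) (tendsto_mul_abs_zero K)
    S.U_lip_x S.U_lip_t

theorem continuous_P (S : EntireSol p K U P Z W) : Continuous fun q : ℝ × ℝ => P q.1 q.2 :=
  continuous_of_partial_modulus (tendsto_mul_abs_zero K) (tendsto_mul_abs_zero K)
    S.P_lip_x S.P_t

theorem continuous_W (S : EntireSol p K U P Z W) : Continuous fun q : ℝ × ℝ => W q.1 q.2 :=
  continuous_of_partial_modulus (tendsto_mul_abs_zero K) (tendsto_mul_sqrt_abs_zero K)
    S.W_x S.W_t

theorem G_lip (S : EntireSol p K U P Z W) (ξ s ξ' s' : ℝ) :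
    ‖p.G (U ξ s) - p.G (U ξ' s')‖ ≤ p.L * ‖U ξ s - U ξ' s'‖ :=
  p.lip _ _ (S.bU _ _) (S.bU _ _)

theorem G_le (S : EntireSol p K U P Z W) (ξ s : ℝ) : ‖p.G (U ξ s)‖ ≤ p.L * ‖U ξ s‖ := by
  simpa [p.G_zero] using p.lip (U ξ s) 0 (S.bU _ _) (by simpa using p.C_pos.le)

theorem continuous_G (S : EntireSol p K U P Z W) : Continuous fun q : ℝ × ℝ => p.G (U q.1 q.2) := by
  refine continuous_of_partial_modulus (f := fun ξ s => p.G (U ξ s))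
    (tendsto_mul_abs_zero (p.L * K)) (tendsto_mul_abs_zero (p.L * K)) ?_ ?_
  · intro ξ s h
    rw [mul_assoc]
    exact (S.G_lip _ _ _ _).trans (mul_le_mul_of_nonneg_left (S.U_lip_x ξ s h) p.L_pos.le)
  · intro ξ s h
    rw [mul_assoc]
    exact (S.G_lip _ _ _ _).trans (mul_le_mul_of_nonneg_left (S.U_lip_t ξ s h) p.L_pos.le)

theorem continuous_Z (S : EntireSol p K U P Z W) : Continuous fun q : ℝ × ℝ => Z q.1 q.2 := by
  have : (fun q : ℝ × ℝ => Z q.1 q.2) = fun q => W q.1 q.2 + p.G (U q.1 q.2) := by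
    funext q; rw [S.pde]; abel
  rw [this]; exact S.continuous_W.add S.continuous_G

/-- Space-time translations of an entire solution form an asymptotic family. -/
theorem asymp_shift (S : EntireSol p K U P Z W) {ι : Type*} (F : Filter ι) (a b : ι → ℝ) :
    AsympSol F p K (fun i ξ s => U (a i + ξ) (b i + s)) (fun i ξ s => P (a i + ξ) (b i + s))
      (fun i ξ s => Z (a i + ξ) (b i + s)) (fun i ξ s => W (a i + ξ) (b i + s)) where
  bU _ _ := Eventually.of_forall fun _ => S.bU _ _
  bP _ _ := Eventually.of_forall fun _ => S.bP _ _
  bZ _ _ := Eventually.of_forall fun _ => S.bZ _ _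
  bW _ _ := Eventually.of_forall fun _ => S.bW _ _
  U_x ξ s h := Eventually.of_forall fun i => by simpa only [← add_assoc] using S.U_x _ _ h
  P_x ξ s h := Eventually.of_forall fun i => by simpa only [← add_assoc] using S.P_x _ _ h
  U_t ξ s h := Eventually.of_forall fun i => by simpa only [← add_assoc] using S.U_t _ _ h
  P_t ξ s h := Eventually.of_forall fun i => by simpa only [← add_assoc] using S.P_t _ _ h
  W_x ξ s h := Eventually.of_forall fun i => by simpa only [← add_assoc] using S.W_x _ _ h
  W_t ξ s h := Eventually.of_forall fun i => by simpa only [← add_assoc] using S.W_t _ _ h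
  pde ξ s := by simpa [S.pde] using tendsto_const_nhds

end EntireSol

namespace RadSol
variable {p : Pot E} {κ K : ℝ} {u ur urr ut : ℝ → ℝ → E}

/-- The regularity constant for translates of a radial solution. -/
def regConst (p : Pot E) (κ K : ℝ) : ℝ := (5 + κ) * lipConst p κ K

theorem lipConst_nonneg (S : RadSol p κ K u ur urr ut) : 0 ≤ lipConst p κ K := by
  linarith [S.four_K_le, S.K_nonneg]

theorem five_lip_le (S : RadSol p κ K u ur urr ut) : 5 * lipConst p κ K ≤ regConst p κ K :=
  mul_le_mul_of_nonneg_right (by linarith [S.κ_nonneg]) S.lipConst_nonneg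

theorem K_le (S : RadSol p κ K u ur urr ut) : K ≤ regConst p κ K := by
  linarith [S.four_K_le, S.K_nonneg, S.five_lip_le]

theorem taylor_r (S : RadSol p κ K u ur urr ut) {r r' t : ℝ} (hr : 0 ≤ r) (hr' : 0 ≤ r')
    (ht : 0 < t) : ‖u r' t - u r t - (r' - r) • ur r t‖ ≤ K * |r' - r| * |r' - r| := by
  refine norm_taylor_le (f := fun x => u x t) (fun z _ => S.dr z t ht) fun z hz => ?_
  have h0 : 0 ≤ z := le_of_mem_uIcc_of_le hz hr hr'
  have := norm_sub_le_of_deriv_le (f := fun x => ur x t) (x := r) (y := z)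
    (fun w _ => S.drr w t ht) fun w hw => S.burr w t (le_of_mem_uIcc_of_le hw hr h0) ht
  exact this.trans (mul_le_mul_of_nonneg_left (abs_sub_le_of_mem_uIcc hz) S.K_nonneg)

theorem taylor_rr (S : RadSol p κ K u ur urr ut) {r r' t : ℝ} (hr : 3 ≤ r) (hr' : 3 ≤ r')
    (ht : 2 ≤ t) :
    ‖ur r' t - ur r t - (r' - r) • urr r t‖ ≤ (2 * lipConst p κ K) * |r' - r| * |r' - r| := by
  refine norm_taylor_le (f := fun x => ur x t) (fun z _ => S.drr z t (by linarith)) fun z hz => ?_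
  refine (S.urr_lip_r hr (le_of_mem_uIcc_of_le hz hr hr') ht).trans ?_
  exact mul_le_mul_of_nonneg_left (abs_sub_le_of_mem_uIcc hz) (by linarith [S.lipConst_nonneg])

theorem taylor_t (S : RadSol p κ K u ur urr ut) {r t t' : ℝ} (hr : 3 ≤ r) (ht : 2 ≤ t)
    (ht' : 2 ≤ t') :
    ‖u r t' - u r t - (t' - t) • ut r t‖ ≤ regConst p κ K * Real.sqrt |t' - t| * |t' - t| := by
  have h2 : ∀ z ∈ uIcc t t', 2 ≤ z := fun z hz => le_of_mem_uIcc_of_le hz ht ht'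
  refine norm_taylor_le (f := fun x => u r x) (fun z hz => S.dt r z (by linarith [h2 z hz]))
    fun z hz => ?_
  refine (S.ut_holder_t hr ht (h2 z hz)).trans ?_
  exact mul_le_mul_of_nonneg_left (Real.sqrt_le_sqrt (abs_sub_le_of_mem_uIcc hz))
    (by linarith [S.K_le, S.K_nonneg, show regConst p κ K = (5 + κ) * lipConst p κ K from rfl])

/-- Translates of a radial solution escaping to infinity in space and time form an asymptotic
family. -/
theorem asymp (S : RadSol p κ K u ur urr ut) {ι : Type*} {F : Filter ι} {r t : ι → ℝ}
    (hr : Tendsto r F atTop) (ht : Tendsto t F atTop) :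
    AsympSol F p (regConst p κ K) (fun i ξ s => u (r i + ξ) (t i + s))
      (fun i ξ s => ur (r i + ξ) (t i + s)) (fun i ξ s => urr (r i + ξ) (t i + s))
      (fun i ξ s => ut (r i + ξ) (t i + s)) := by
  have er : ∀ ξ, ∀ᶠ i in F, 3 ≤ r i + ξ := fun ξ => by
    filter_upwards [hr.eventually_ge_atTop (3 - ξ)] with i hi; linarith
  have et : ∀ s, ∀ᶠ i in F, 2 ≤ t i + s := fun s => by
    filter_upwards [ht.eventually_ge_atTop (2 - s)] with i hi; linarith
  have hK := S.K_le
  have hA := S.five_lip_le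
  have hA0 := S.lipConst_nonneg
  have mono : ∀ {B h x : ℝ}, B ≤ regConst p κ K → x ≤ B * |h| * |h| →
      x ≤ regConst p κ K * |h| * |h| := fun hB hx => hx.trans (by gcongr)
  have mono' : ∀ {B h x : ℝ}, B ≤ regConst p κ K → x ≤ B * |h| →
      x ≤ regConst p κ K * |h| := fun hB hx => hx.trans (by gcongr)
  constructor
  · intro ξ s; filter_upwards [er ξ, et s] with i h1 h2
    exact S.bu _ _ (by linarith) (by linarith)
  · intro ξ s; filter_upwards [er ξ, et s] with i h1 h2
    exact (S.bur _ _ (by linarith) (by linarith)).trans hK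
  · intro ξ s; filter_upwards [er ξ, et s] with i h1 h2
    exact (S.burr _ _ (by linarith) (by linarith)).trans hK
  · intro ξ s; filter_upwards [er ξ, et s] with i h1 h2
    exact (S.but _ _ (by linarith) (by linarith)).trans hK
  · intro ξ s h; filter_upwards [er ξ, er (ξ + h), et s] with i h1 h3 h2
    have := S.taylor_r (r := r i + ξ) (r' := r i + (ξ + h)) (t := t i + s) (by linarith)
      (by linarith) (by linarith)
    rw [show r i + (ξ + h) - (r i + ξ) = h by ring] at this
    exact mono hK this
  · intro ξ s h; filter_upwards [er ξ, er (ξ + h), et s] with i h1 h3 h2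
    have := S.taylor_rr (r := r i + ξ) (r' := r i + (ξ + h)) (t := t i + s) h1 h3 h2
    rw [show r i + (ξ + h) - (r i + ξ) = h by ring] at this
    exact mono (by linarith) this
  · intro ξ s h; filter_upwards [er ξ, et (s + h), et s] with i h1 h3 h2
    have := S.taylor_t (r := r i + ξ) (t := t i + s) (t' := t i + (s + h)) h1 h2 h3
    rwa [show t i + (s + h) - (t i + s) = h by ring] at this
  · intro ξ s h; filter_upwards [er ξ, et (s + h), et s] with i h1 h3 h2
    have := S.ur_lip_t (r := r i + ξ) (t := t i + s) (t' := t i + (s + h)) h1 h2 h3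
    rw [show t i + (s + h) - (t i + s) = h by ring] at this
    exact mono' (by linarith) this
  · intro ξ s h; filter_upwards [er ξ, er (ξ + h), et s] with i h1 h3 h2
    have := S.ut_lip_r (r := r i + ξ) (r' := r i + (ξ + h)) (t := t i + s) h1 h3 h2
    rw [show r i + (ξ + h) - (r i + ξ) = h by ring] at this
    exact mono' (by linarith) this
  · intro ξ s h; filter_upwards [er ξ, et (s + h), et s] with i h1 h3 h2
    have := S.ut_holder_t (r := r i + ξ) (t := t i + s) (t' := t i + (s + h)) h1 h2 h3
    rwa [show t i + (s + h) - (t i + s) = h by ring] at this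
  · intro ξ s
    have h0 : Tendsto (fun i => κ / (r i + ξ) * K) F (𝓝 0) := by
      have : Tendsto (fun i => κ / (r i + ξ)) F (𝓝 0) :=
        (tendsto_atTop_add_const_right F ξ hr).const_div_atTop κ
      simpa using this.mul_const K
    refine squeeze_zero_norm' ?_ h0
    filter_upwards [er ξ, et s] with i h1 h2
    rw [S.pde _ _ (by linarith) (by linarith), show ∀ a b c : E, -a + b + c - (c - a) = b by
      intros; abel, norm_smul, Real.norm_eq_abs,
      abs_of_nonneg (div_nonneg S.κ_nonneg (by linarith))]
    exact mul_le_mul_of_nonneg_left (S.bur _ _ (by linarith) (by linarith))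
      (div_nonneg S.κ_nonneg (by linarith))

end RadSol

end

section

variable {E : Type*} [NormedAddCommGroup E] [InnerProductSpace ℝ E]

theorem Real.abs_le_two_mul_cosh (x : ℝ) : |x| ≤ 2 * Real.cosh x := by
  rw [← Real.cosh_abs, Real.cosh_eq]
  linarith [Real.add_one_le_exp |x|, Real.exp_pos (-|x|)]

theorem Real.abs_sinh_le_cosh (x : ℝ) : |Real.sinh x| ≤ Real.cosh x := by
  rw [abs_le, Real.sinh_eq, Real.cosh_eq]
  constructor <;> linarith [Real.exp_pos x, Real.exp_pos (-x)]

/-- Maximum principle for functions bounded above on a possibly unbounded closed set. -/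
theorem parabolic_max_principle {J : Set ℝ} (hJ : IsClosed J) {z zx zxx zs : ℝ → ℝ → ℝ}
    {c Λ s0 s1 B : ℝ} (hΛ : 0 ≤ Λ) (hc : Continuous fun q : ℝ × ℝ => z q.1 q.2)
    (dx : ∀ ξ s, HasDerivAt (fun x => z x s) (zx ξ s) ξ)
    (dxx : ∀ ξ s, HasDerivAt (fun x => zx x s) (zxx ξ s) ξ)
    (ds : ∀ ξ s, HasDerivAt (fun x => z ξ x) (zs ξ s) s)
    (hB : ∀ ξ ∈ J, ∀ s ∈ Icc s0 s1, z ξ s ≤ B) (h0 : ∀ ξ ∈ J, z ξ s0 ≤ 0)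
    (hin : ∀ ξ ∈ J, ∀ s ∈ Ioc s0 s1, 0 < z ξ s →
      J ∈ 𝓝 ξ ∧ zs ξ s ≤ zxx ξ s + c * zx ξ s + Λ * z ξ s) :
    ∀ ξ ∈ J, ∀ s ∈ Icc s0 s1, z ξ s ≤ 0 := by
  intro ξ' hξ' s' hs'
  by_contra hpos
  push Not at hpos
  set k : ℝ := 1 + |c| + Λ with hk
  have hk0 : 0 ≤ k := by positivity
  have hB0 : 0 < B := hpos.trans_le (hB ξ' hξ' s' hs')
  obtain ⟨ε, hε, hε'⟩ : ∃ ε > 0, ε * Real.cosh ξ' < Real.exp (-k * (s' - s0)) * z ξ' s' := by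
    have hp : 0 < Real.exp (-k * (s' - s0)) * z ξ' s' := by positivity
    refine ⟨Real.exp (-k * (s' - s0)) * z ξ' s' / (2 * Real.cosh ξ'), by positivity, ?_⟩
    have := Real.cosh_pos ξ'
    field_simp
    norm_num
  let w : ℝ × ℝ → ℝ := fun q => Real.exp (-k * (q.2 - s0)) * z q.1 q.2 - ε * Real.cosh q.1
  have hw : Continuous w := by
    have : Continuous fun q : ℝ × ℝ => Real.cosh q.1 := Real.continuous_cosh.comp continuous_fst
    fun_prop
  set R : ℝ := 2 * B / ε + |ξ'| + 1 with hR
  have hfar : ∀ ξ ∈ J, ∀ s ∈ Icc s0 s1, 2 * B / ε < |ξ| → w (ξ, s) < 0 := by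
    intro ξ hξ s hs hx
    have h1 : Real.exp (-k * (s - s0)) ≤ 1 := Real.exp_le_one_iff.2 (by nlinarith [hs.1])
    have h2 : Real.exp (-k * (s - s0)) * z ξ s ≤ B := by
      have := mul_le_mul_of_nonneg_left (hB ξ hξ s hs) (Real.exp_pos (-k * (s - s0))).le
      nlinarith
    have h3 := Real.abs_le_two_mul_cosh ξ
    rw [div_lt_iff₀ hε] at hx
    simp only [w]
    nlinarith
  have hK : IsCompact ((J ∩ Icc (-R) R) ×ˢ Icc s0 s1) :=
    (isCompact_Icc.inter_left hJ).prod isCompact_Icc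
  have hmem' : (ξ', s') ∈ (J ∩ Icc (-R) R) ×ˢ Icc s0 s1 := by
    refine ⟨⟨hξ', abs_le.1 ?_⟩, hs'⟩
    have : 0 < 2 * B / ε := by positivity
    simp only; linarith
  obtain ⟨⟨ξ, s⟩, ⟨⟨hξJ, hξR⟩, hs⟩, hmax⟩ := hK.exists_isMaxOn ⟨_, hmem'⟩ hw.continuousOn
  simp only at hξJ hξR hs
  have hwpos : 0 < w (ξ, s) := by
    refine lt_of_lt_of_le ?_ (hmax hmem')
    simp only [w]; linarith
  have hξ2 : |ξ| ≤ 2 * B / ε := by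
    by_contra h
    push Not at h
    exact absurd (hfar ξ hξJ s hs h) (not_lt.2 hwpos.le)
  have hcosh := Real.cosh_pos ξ
  have hex := Real.exp_pos (-k * (s - s0))
  set e := Real.exp (-k * (s - s0)) with he
  have hez : ε * Real.cosh ξ < e * z ξ s := by simp only [w] at hwpos; linarith
  have hz : 0 < z ξ s := by
    have : 0 < e * z ξ s := lt_trans (by positivity) hez
    exact (pos_iff_pos_of_mul_pos this).1 hex
  have hs0 : s0 < s := by
    rcases hs.1.lt_or_eq with h | h
    · exact h
    · exact absurd (h0 ξ hξJ) (by rw [h]; exact not_le.2 hz)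
  obtain ⟨hJn, hineq⟩ := hin ξ hξJ s ⟨hs0, hs.2⟩ hz
  -- first order condition in time
  have ht : 0 ≤ e * (zs ξ s - k * z ξ s) := by
    have d1 : HasDerivAt (fun s => Real.exp (-k * (s - s0))) (e * -k) s := by
      exact (((hasDerivAt_id s).sub_const s0).const_mul (-k)).exp.congr_deriv
        (by rw [he]; simp only [id, mul_one])
    have : HasDerivAt (fun s => w (ξ, s)) (e * (zs ξ s - k * z ξ s)) s :=
      ((d1.mul (ds ξ s)).sub_const (ε * Real.cosh ξ)).congr_deriv (by ring)
    refine this.nonneg_of_le_left hs0 fun σ hσ => hmax ⟨⟨hξJ, hξR⟩, hσ.1, hσ.2.trans hs.2⟩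
  have hx : e * zx ξ s - ε * Real.sinh ξ = 0 ∧ e * zxx ξ s - ε * Real.cosh ξ ≤ 0 := by
    have lm : IsLocalMax (fun x => w (x, s)) ξ := by
      have hRn : Icc (-R) R ∈ 𝓝 ξ := by
        have h3 := abs_le.1 hξ2
        have := abs_nonneg ξ'
        exact Icc_mem_nhds (by linarith) (by linarith)
      filter_upwards [hJn, hRn] with x h1 h2
      exact hmax ⟨⟨h1, h2⟩, hs⟩
    exact lm.deriv_two_conditions (h' := fun x => e * zx x s - ε * Real.sinh x)
      (Eventually.of_forall fun x => ((dx x s).const_mul e).sub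
        ((Real.hasDerivAt_cosh x).const_mul ε))
      (((dxx ξ s).const_mul e).sub ((Real.hasDerivAt_sinh ξ).const_mul ε))
  have h4 : c * (e * zx ξ s) ≤ |c| * (ε * Real.cosh ξ) := by
    rw [show e * zx ξ s = ε * Real.sinh ξ by linarith [hx.1]]
    calc c * (ε * Real.sinh ξ) ≤ |c * (ε * Real.sinh ξ)| := le_abs_self _
      _ = |c| * (ε * |Real.sinh ξ|) := by rw [abs_mul, abs_mul, abs_of_pos hε]
      _ ≤ _ := by gcongr; exact Real.abs_sinh_le_cosh ξ
  have h5 : e * zs ξ s ≤ e * (zxx ξ s + c * zx ξ s + Λ * z ξ s) :=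
    mul_le_mul_of_nonneg_left hineq hex.le
  have h6 : |c| * (ε * Real.cosh ξ) ≤ |c| * (e * z ξ s) :=
    mul_le_mul_of_nonneg_left hez.le (abs_nonneg c)
  rw [hk] at ht
  linarith [hx.2]

namespace EntireSol
variable {p : Pot E} {K : ℝ} {U P Z W : ℝ → ℝ → E}

/-- Time derivative in a travelling frame. -/
theorem dframe (S : EntireSol p K U P Z W) (c x s : ℝ) :
    HasDerivAt (fun τ => U (x + c * τ) τ) (W (x + c * s) s + c • P (x + c * s) s) s := by
  have hg : Tendsto (fun h : ℝ => K * |c| * |c| * |h| + K * |c| * |h| + K * Real.sqrt |h|) (𝓝 0)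
      (𝓝 0) := by
    simpa using ((tendsto_mul_abs_zero (K * |c| * |c|)).add (tendsto_mul_abs_zero (K * |c|))).add
      (tendsto_mul_sqrt_abs_zero K)
  refine hasDerivAt_of_norm_le hg (Eventually.of_forall fun h => ?_)
  set X := x + c * s
  have e1 := S.U_x X (s + h) (c * h)
  have e2 := S.P_t X s h
  have e3 := S.U_t X s h
  rw [show x + c * (s + h) = X + c * h by simp only [X]; ring]
  have : U (X + c * h) (s + h) - U X s - h • (W X s + c • P X s) =
      (U (X + c * h) (s + h) - U X (s + h) - (c * h) • P X (s + h)) +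
      (c * h) • (P X (s + h) - P X s) + (U X (s + h) - U X s - h • W X s) := by module
  have e4 : ‖(c * h) • (P X (s + h) - P X s)‖ ≤ |c| * |h| * (K * |h|) := by
    rw [norm_smul, Real.norm_eq_abs, abs_mul]
    gcongr
  rw [this]
  refine norm_add₃_le.trans ?_
  rw [abs_mul] at e1
  linarith

theorem hasDerivAt_half_sq {f : ℝ → E} {f' : E} {x : ℝ} (hf : HasDerivAt f f' x) :
    HasDerivAt (fun y => ‖f y‖ ^ 2 / 2) ⟪f x, f'⟫ x :=
  (hf.norm_sq.div_const 2).congr_deriv (by ring)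

/-- The differential inequality for the squared norm. -/
theorem half_sq_ineq (S : EntireSol p K U P Z W) (c ξ s : ℝ) :
    ⟪U ξ s, W ξ s + c • P ξ s⟫ ≤ (‖P ξ s‖ ^ 2 + ⟪U ξ s, Z ξ s⟫) + c * ⟪U ξ s, P ξ s⟫
      - ⟪U ξ s, p.G (U ξ s)⟫ := by
  rw [S.pde, inner_add_right, inner_sub_right, real_inner_smul_right]
  nlinarith [sq_nonneg ‖P ξ s‖]

/-- Comparison in a travelling frame: the squared norm stays below any supersolution. -/
theorem compare (S : EntireSol p K U P Z W) {J : Set ℝ} (hJ : IsClosed J) {c Λ s0 s1 : ℝ}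
    {b bx bxx bs : ℝ → ℝ → ℝ} (hΛ : 0 ≤ Λ) (hb : Continuous fun q : ℝ × ℝ => b q.1 q.2)
    (dx : ∀ ξ s, HasDerivAt (fun x => b x s) (bx ξ s) ξ)
    (dxx : ∀ ξ s, HasDerivAt (fun x => bx x s) (bxx ξ s) ξ)
    (ds : ∀ ξ s, HasDerivAt (fun x => b ξ x) (bs ξ s) s)
    (bnn : ∀ ξ s, 0 ≤ b ξ s)
    (h0 : ∀ y ∈ J, ‖U (y + c * s0) s0‖ ^ 2 / 2 ≤ b y s0)
    (hin : ∀ y ∈ J, ∀ s ∈ Ioc s0 s1, b y s < ‖U (y + c * s) s‖ ^ 2 / 2 →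
      J ∈ 𝓝 y ∧ -⟪U (y + c * s) s, p.G (U (y + c * s) s)⟫ ≤ bs y s - bxx y s - c * bx y s
        + Λ * (‖U (y + c * s) s‖ ^ 2 / 2 - b y s)) :
    ∀ y ∈ J, ∀ s ∈ Icc s0 s1, ‖U (y + c * s) s‖ ^ 2 / 2 ≤ b y s := by
  intro y hy s hs
  have shiftx : ∀ {f : ℝ → ℝ → E} {f' : E} {y s : ℝ}, HasDerivAt (fun x => f x s) f' (y + c * s) →
      HasDerivAt (fun x => f (x + c * s) s) f' y := fun h => h.comp_add_const _ _
  have := parabolic_max_principle hJ (z := fun y s => ‖U (y + c * s) s‖ ^ 2 / 2 - b y s)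
    (zx := fun y s => ⟪U (y + c * s) s, P (y + c * s) s⟫ - bx y s)
    (zxx := fun y s => ‖P (y + c * s) s‖ ^ 2 + ⟪U (y + c * s) s, Z (y + c * s) s⟫ - bxx y s)
    (zs := fun y s => ⟪U (y + c * s) s, W (y + c * s) s + c • P (y + c * s) s⟫ - bs y s)
    (c := c) (Λ := Λ) (s0 := s0) (s1 := s1) (B := p.C ^ 2 / 2) hΛ
    (by
      have : Continuous fun q : ℝ × ℝ => U (q.1 + c * q.2) q.2 :=
        S.continuous_U.comp (f := fun q : ℝ × ℝ => (q.1 + c * q.2, q.2)) (by fun_prop)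
      exact ((this.norm.pow 2).div_const 2).sub hb)
    (fun y s => (hasDerivAt_half_sq (shiftx (S.dU _ s))).sub (dx y s))
    (fun y s => by
      refine (((shiftx (S.dU (y + c * s) s)).inner ℝ (shiftx (S.dP (y + c * s) s))).congr_deriv
        ?_).sub (dxx y s)
      rw [real_inner_self_eq_norm_sq]; ring)
    (fun y s => (hasDerivAt_half_sq (S.dframe c y s)).sub (ds y s))
    (fun y _ s _ => by
      have := S.bU (y + c * s) s
      have := norm_nonneg (U (y + c * s) s)
      have := bnn y s
      nlinarith)
    (fun y hy => by simpa using h0 y hy)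
    (fun y hy s hs hz => by
      obtain ⟨h1, h2⟩ := hin y hy s hs (by simpa using hz)
      refine ⟨h1, ?_⟩
      have := S.half_sq_ineq c (y + c * s) s
      linarith) y hy s hs
  simpa using this

/-- Decay of solutions staying close to the origin in the past of a travelling half-line. -/
theorem decay_halfline (S : EntireSol p K U P Z W) {b c μ s : ℝ} (hμ : 0 ≤ μ)
    (hμ' : μ ^ 2 - c * μ ≤ p.lam)
    (h : ∀ s' ≤ s, ∀ ξ, b + c * (s' - s) ≤ ξ → ‖U ξ s'‖ ≤ p.δ) {ξ : ℝ} (hξ : b ≤ ξ) :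
    ‖U ξ s‖ ^ 2 ≤ p.δ ^ 2 * Real.exp (-μ * (ξ - b)) := by
  set a := b - c * s with ha
  have key : ∀ s0 < s, ‖U ξ s‖ ^ 2 / 2 ≤
      p.δ ^ 2 / 2 * (Real.exp (-μ * (ξ - b)) + Real.exp (-p.lam * (s - s0))) := by
    intro s0 hs0
    have := S.compare (J := Ici a) isClosed_Ici (c := c) (Λ := 0) (s0 := s0) (s1 := s)
      (b := fun y σ => p.δ ^ 2 / 2 * (Real.exp (-μ * (y - a)) + Real.exp (-p.lam * (σ - s0))))
      (bx := fun y σ => p.δ ^ 2 / 2 * (-μ * Real.exp (-μ * (y - a))))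
      (bxx := fun y σ => p.δ ^ 2 / 2 * (μ ^ 2 * Real.exp (-μ * (y - a))))
      (bs := fun y σ => p.δ ^ 2 / 2 * (-p.lam * Real.exp (-p.lam * (σ - s0)))) le_rfl
      (by fun_prop)
      (fun y σ => by
        have := (((hasDerivAt_id y).sub_const a).const_mul (-μ)).exp
        exact ((this.add_const _).const_mul (p.δ ^ 2 / 2)).congr_deriv (by simp only [id]; ring))
      (fun y σ => by
        have := (((hasDerivAt_id y).sub_const a).const_mul (-μ)).exp
        exact ((this.const_mul (-μ)).const_mul (p.δ ^ 2 / 2)).congr_deriv (by simp only [id]; ring))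
      (fun y σ => by
        have := (((hasDerivAt_id σ).sub_const s0).const_mul (-p.lam)).exp
        exact ((this.const_add _).const_mul (p.δ ^ 2 / 2)).congr_deriv (by simp only [id]; ring))
      (fun y σ => by positivity)
      (fun y hy => by
        have := h s0 hs0.le (y + c * s0) (by rw [mem_Ici, ha] at hy; linarith)
        have := norm_nonneg (U (y + c * s0) s0)
        simp only [sub_self, mul_zero, Real.exp_zero]
        have : 0 ≤ p.δ ^ 2 / 2 * Real.exp (-μ * (y - a)) := by positivity
        nlinarith)
      (fun y hy σ hσ hz => by
        have hd := h σ hσ.2 (y + c * σ) (by rw [mem_Ici, ha] at hy; linarith)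
        have hn := norm_nonneg (U (y + c * σ) σ)
        have hco := p.coer _ hd
        constructor
        · rcases (mem_Ici.1 hy).lt_or_eq with h1 | h1
          · exact Ici_mem_nhds h1
          · exfalso
            rw [← h1] at hz hd hn
            simp only [sub_self, mul_zero, Real.exp_zero] at hz
            have : 0 ≤ p.δ ^ 2 / 2 * Real.exp (-p.lam * (σ - s0)) := by positivity
            nlinarith
        · have e0 := Real.exp_pos (-μ * (y - a))
          have hl := p.lam_pos
          have k1 := mul_lt_mul_of_pos_left hz hl
          have k2 : 0 ≤ p.δ ^ 2 / 2 * Real.exp (-μ * (y - a)) * (p.lam - (μ ^ 2 - c * μ)) :=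
            mul_nonneg (by positivity) (by linarith)
          nlinarith)
      (ξ - c * s) (by rw [mem_Ici, ha]; linarith) s ⟨hs0.le, le_rfl⟩
    simp only [sub_add_cancel] at this
    rwa [show ξ - c * s - a = ξ - b by rw [ha]; ring] at this
  have lim : Tendsto (fun s0 => p.δ ^ 2 / 2 * (Real.exp (-μ * (ξ - b)) +
      Real.exp (-p.lam * (s - s0)))) atBot (𝓝 (p.δ ^ 2 / 2 * (Real.exp (-μ * (ξ - b)) + 0))) := by
    refine (tendsto_const_nhds.add ?_).const_mul _
    refine Real.tendsto_exp_atBot.comp ?_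
    have : Tendsto (fun s0 : ℝ => s - s0) atBot atTop := by
      simpa [sub_eq_add_neg] using tendsto_atTop_add_const_left _ s tendsto_neg_atBot_atTop
    simpa using this.const_mul_atTop_of_neg (neg_lt_zero.2 p.lam_pos)
  have := ge_of_tendsto lim ((eventually_lt_atBot s).mono key)
  linarith

/-- Decay in time of solutions close to the origin everywhere at some time. -/
theorem decay_line (S : EntireSol p K U P Z W) {s0 s : ℝ} (hs : s0 ≤ s)
    (h : ∀ ξ, ‖U ξ s0‖ ≤ p.δ) (ξ : ℝ) :
    ‖U ξ s‖ ^ 2 ≤ p.δ ^ 2 * Real.exp (-p.lam * (s - s0)) := by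
  have hC := p.C_pos
  have hL := p.L_pos
  have hδ := p.δ_pos
  have hl := p.lam_pos
  have := S.compare (J := univ) isClosed_univ (c := 0) (Λ := 2 * p.C * p.L / p.δ)
      (s0 := s0) (s1 := s)
      (b := fun y σ => p.δ ^ 2 / 2 * Real.exp (-p.lam * (σ - s0)))
      (bx := fun y σ => 0) (bxx := fun y σ => 0)
      (bs := fun y σ => p.δ ^ 2 / 2 * (-p.lam * Real.exp (-p.lam * (σ - s0)))) (by positivity)
      (by fun_prop) (fun y σ => hasDerivAt_const _ _) (fun y σ => hasDerivAt_const _ _)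
      (fun y σ => by
        have := (((hasDerivAt_id σ).sub_const s0).const_mul (-p.lam)).exp
        exact (this.const_mul (p.δ ^ 2 / 2)).congr_deriv (by simp only [id]; ring))
      (fun y σ => by positivity)
      (fun y _ => by
        have := h (y + 0 * s0)
        have := norm_nonneg (U (y + 0 * s0) s0)
        simp only [sub_self, mul_zero, Real.exp_zero]
        nlinarith)
      (fun y _ σ hσ hz => by
        refine ⟨univ_mem, ?_⟩
        have hx := S.bU (y + 0 * σ) σ
        set x := U (y + 0 * σ) σ with hxd
        have e1 : Real.exp (-p.lam * (σ - s0)) ≤ 1 :=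
          Real.exp_le_one_iff.2 (by nlinarith [hσ.1])
        set e := Real.exp (-p.lam * (σ - s0)) with he
        have hb : p.δ ^ 2 / 2 * e ≤ p.δ ^ 2 / 2 := by nlinarith
        simp only [mul_zero, sub_zero]
        by_cases hxd : ‖x‖ ≤ p.δ
        · have := p.coer x hxd
          have k : 0 ≤ 2 * p.C * p.L / p.δ * (‖x‖ ^ 2 / 2 - p.δ ^ 2 / 2 * e) :=
            mul_nonneg (by positivity) (by linarith)
          nlinarith
        · push Not at hxd
          have hx0 : 0 < ‖x‖ := hδ.trans hxd
          set x' := (p.δ / ‖x‖) • x with hx'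
          have nx' : ‖x'‖ = p.δ := by
            rw [hx', norm_smul, Real.norm_eq_abs, abs_of_pos (by positivity)]; field_simp
          have dx' : ‖x - x'‖ = ‖x‖ - p.δ := by
            rw [hx', show x - (p.δ / ‖x‖) • x = (1 - p.δ / ‖x‖) • x by module, norm_smul,
              Real.norm_eq_abs, abs_of_nonneg (by rw [sub_nonneg, div_le_one hx0]; exact hxd.le)]
            field_simp
          have c1 := p.coer x' nx'.le
          rw [nx'] at c1
          have c2 := p.lip x x' hx (by rw [nx']; linarith)
          have c3 : ‖p.G x'‖ ≤ p.L * p.δ := by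
            have := p.lip x' 0 (by rw [nx']; linarith) (by simpa using hC.le)
            simpa [p.G_zero, nx'] using this
          have c4 : ⟪x', p.G x'⟫ - ⟪x, p.G x⟫ ≤ 2 * p.C * p.L * (‖x‖ - p.δ) := by
            have : ⟪x', p.G x'⟫ - ⟪x, p.G x⟫ = -⟪x, p.G x - p.G x'⟫ - ⟪x - x', p.G x'⟫ := by
              rw [inner_sub_right, inner_sub_left]; ring
            rw [this]
            have a1 := (abs_le.1 (abs_real_inner_le_norm x (p.G x - p.G x'))).1
            have a2 := (abs_le.1 (abs_real_inner_le_norm (x - x') (p.G x'))).1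
            rw [dx'] at a2 c2
            have b1 : ‖x‖ * ‖p.G x - p.G x'‖ ≤ p.C * (p.L * (‖x‖ - p.δ)) :=
              mul_le_mul hx c2 (norm_nonneg _) hC.le
            have b2 : (‖x‖ - p.δ) * ‖p.G x'‖ ≤ (‖x‖ - p.δ) * (p.L * p.C) :=
              mul_le_mul_of_nonneg_left (c3.trans (by nlinarith)) (by linarith)
            nlinarith
          have c5 : 2 * p.C * p.L * (‖x‖ - p.δ) ≤
              2 * p.C * p.L / p.δ * (‖x‖ ^ 2 / 2 - p.δ ^ 2 / 2) := by
            rw [div_mul_eq_mul_div, le_div_iff₀ hδ, mul_assoc (2 * p.C * p.L)]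
            refine mul_le_mul_of_nonneg_left ?_ (by positivity)
            nlinarith [sq_nonneg (‖x‖ - p.δ)]
          have c6 : 2 * p.C * p.L / p.δ * (‖x‖ ^ 2 / 2 - p.δ ^ 2 / 2) ≤
              2 * p.C * p.L / p.δ * (‖x‖ ^ 2 / 2 - p.δ ^ 2 / 2 * e) :=
            mul_le_mul_of_nonneg_left (by linarith) (by positivity)
          nlinarith)
      ξ (mem_univ _) s ⟨hs, le_rfl⟩
  simp only [zero_mul, add_zero] at this
  linarith

end EntireSol

end

section

variable {E : Type*} [NormedAddCommGroup E] [InnerProductSpace ℝ E]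

/-- Uniform bound, together with exponential decay ahead of a moving position `b s`. -/
def DecaysAhead (A ν : ℝ) (b : ℝ → ℝ) (X : ℝ → ℝ → E) : Prop :=
  ∀ ξ s, ‖X ξ s‖ ≤ A ∧ ‖X ξ s‖ ≤ A * Real.exp (-ν * (ξ - b s))

/-- Exponential decay passes to the spatial derivative of solutions of parabolic equations. -/
theorem exp_decay_deriv {Y Yr Yrr Yt : ℝ → ℝ → E} {M L ν : ℝ} {b : ℝ → ℝ} (hb : Monotone b)
    (hν : 0 ≤ ν) (hM : 0 ≤ M) (hL : 0 ≤ L) (hc : Continuous fun q : ℝ × ℝ => Y q.1 q.2)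
    (h1 : ∀ r t, HasDerivAt (fun x => Y x t) (Yr r t) r)
    (h2 : ∀ r t, HasDerivAt (fun x => Yr x t) (Yrr r t) r)
    (h3 : ∀ r t, HasDerivAt (fun s => Y r s) (Yt r t) t)
    (pde : ∀ r t, ‖Yt r t - Yrr r t‖ ≤ L * (M * Real.exp (-ν * (r - b t))))
    (bd : ∀ r t, ‖Y r t‖ ≤ M * Real.exp (-ν * (r - b t))) (ξ s : ℝ) :
    ‖Yr ξ s‖ ≤ 2 * (2 + L) * Real.exp (ν * (3 / 2)) * M * Real.exp (-ν * (ξ - b s)) := by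
  set M' := M * (Real.exp (ν * (3 / 2)) * Real.exp (-ν * (ξ - b s))) with hM'
  have key : ∀ r ∈ Icc (ξ - 3/2) (ξ + 3/2), ∀ t ∈ Icc (s - 1) s,
      M * Real.exp (-ν * (r - b t)) ≤ M' := by
    intro r hr t ht
    rw [hM', ← Real.exp_add]
    refine mul_le_mul_of_nonneg_left (Real.exp_le_exp.2 ?_) hM
    have := hb ht.2
    nlinarith [hr.1]
  have := parabolic_gradient (Y := Y) (Yr := Yr) (Yrr := Yrr) (Yt := Yt) (a := fun _ => 0)
    (R := ξ) (t0 := s) (M := M') (N := L * M') (ā := 0) hc.continuousOn (fun r _ t _ => h1 r t)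
    (fun r _ t _ => h2 r t) (fun r _ t _ => h3 r t)
    (fun r hr t ht => by
      rw [zero_smul, sub_zero]
      exact (pde r t).trans (mul_le_mul_of_nonneg_left (key r hr t ht) hL))
    (fun r hr t ht => (bd r t).trans (key r hr t ht)) (fun _ _ _ _ _ => le_rfl) (by simp)
  calc _ ≤ _ := this
    _ = _ := by rw [hM']; ring

namespace EntireSol
variable {p : Pot E} {K : ℝ} {U P Z W : ℝ → ℝ → E}

/-- Closeness to the origin ahead of the position `c * s + η * |s| + k`. -/
def SmallAhead (p : Pot E) (U : ℝ → ℝ → E) (c η k : ℝ) : Prop :=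
  ∀ s ξ, c * s + η * |s| + k ≤ ξ → ‖U ξ s‖ ≤ p.δ

theorem exists_decaysAhead (S : EntireSol p K U P Z W) {c η k μ : ℝ}
    (h : SmallAhead p U c η k) (hη : 0 ≤ η) (hηc : η ≤ c) (hμ : 0 ≤ μ)
    (hμ' : μ ^ 2 - (c - η) * μ ≤ p.lam) :
    ∃ A, 0 ≤ A ∧ ∀ X ∈ ({U, P, Z, W} : Set (ℝ → ℝ → E)),
      DecaysAhead A (μ / 2) (fun s => c * s + η * |s| + k) X := by
  set b : ℝ → ℝ := fun s => c * s + η * |s| + k with hb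
  have hlin : ∀ s' s, s' ≤ s → b s' ≤ b s + (c - η) * (s' - s) := by
    intro s' s hs
    simp only [hb]
    have : |s'| - |s| ≤ s - s' := by
      have := abs_sub_abs_le_abs_sub s' s
      rw [abs_of_nonpos (sub_nonpos.2 hs)] at this; linarith
    nlinarith
  have hmono : Monotone b := fun s' s hs => by
    have := hlin s' s hs; nlinarith
  have hν : 0 ≤ μ / 2 := by linarith
  have hL := p.L_pos
  have hexp : ∀ ξ s, ξ ≤ b s → 1 ≤ Real.exp (-(μ / 2) * (ξ - b s)) := fun ξ s hx =>
    Real.one_le_exp (by nlinarith)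
  set M := max p.C p.δ with hM
  have hM0 : 0 < M := lt_max_of_lt_left p.C_pos
  have dU : ∀ ξ s, ‖U ξ s‖ ≤ M * Real.exp (-(μ / 2) * (ξ - b s)) := by
    intro ξ s
    rcases le_total ξ (b s) with hx | hx
    · have := (S.bU ξ s).trans (le_max_left p.C p.δ)
      nlinarith [hexp ξ s hx]
    · have := S.decay_halfline (b := b s) (c := c - η) hμ hμ'
        (fun s' hs ξ' hξ' => h s' ξ' ((hlin s' s hs).trans hξ')) hx
      have e : Real.exp (-μ * (ξ - b s)) = Real.exp (-(μ / 2) * (ξ - b s)) ^ 2 := by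
        rw [← Real.exp_nat_mul]; congr 1; push_cast; ring
      rw [e, ← mul_pow] at this
      have := (pow_le_pow_iff_left₀ (norm_nonneg _) (mul_pos p.δ_pos (Real.exp_pos _)).le
        two_ne_zero).1 this
      exact this.trans (mul_le_mul_of_nonneg_right (le_max_right _ _) (Real.exp_pos _).le)
  set q := 2 * (2 + p.L) * Real.exp (μ / 2 * (3 / 2)) with hq
  have hq0 : 0 ≤ q := by positivity
  have dP : ∀ ξ s, ‖P ξ s‖ ≤ q * M * Real.exp (-(μ / 2) * (ξ - b s)) := fun ξ s =>
    exp_decay_deriv hmono hν hM0.le hL.le S.continuous_U S.dU S.dP S.dt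
      (fun r t => by
        rw [S.pde, sub_sub_cancel_left, norm_neg]
        exact (S.G_le r t).trans (mul_le_mul_of_nonneg_left (dU r t) hL.le)) dU ξ s
  have dZ : ∀ ξ s, ‖Z ξ s‖ ≤ q * (q * M) * Real.exp (-(μ / 2) * (ξ - b s)) := by
    intro ξ s
    have quot : ∀ r t x, 0 < x → ‖U (r + x) t - U r t‖ ≤
        q * M * Real.exp (-(μ / 2) * (r - b t)) * x := by
      intro r t x hx
      have := norm_sub_le_of_deriv_le (f := fun y => U y t) (x := r) (y := r + x)
        (B := q * M * Real.exp (-(μ / 2) * (r - b t))) (fun z _ => S.dU z t)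
        (fun z hz => (dP z t).trans (by
          rw [uIcc_of_le (by linarith)] at hz
          refine mul_le_mul_of_nonneg_left (Real.exp_le_exp.2 ?_) (by positivity)
          nlinarith [hz.1]))
      simpa [abs_of_pos hx] using this
    have bound : ∀ x, 0 < x → ‖x⁻¹ • (P (ξ + x) s - P ξ s)‖ ≤
        q * (q * M) * Real.exp (-(μ / 2) * (ξ - b s)) := by
      intro x hx
      have inv : ∀ {v : E} {B : ℝ}, ‖v‖ ≤ B * x → ‖x⁻¹ • v‖ ≤ B := fun {v B} hv => by
        rw [norm_smul, Real.norm_eq_abs, abs_of_pos (inv_pos.2 hx), inv_mul_le_iff₀ hx]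
        linarith
      refine exp_decay_deriv (Y := fun r t => x⁻¹ • (U (r + x) t - U r t))
        (Yr := fun r t => x⁻¹ • (P (r + x) t - P r t))
        (Yrr := fun r t => x⁻¹ • (Z (r + x) t - Z r t))
        (Yt := fun r t => x⁻¹ • (W (r + x) t - W r t)) hmono hν (by positivity) hL.le
        ?_ ?_ ?_ ?_ ?_ (fun r t => inv (quot r t x hx)) ξ s
      · have : Continuous fun q : ℝ × ℝ => U (q.1 + x) q.2 :=
          S.continuous_U.comp (f := fun q : ℝ × ℝ => (q.1 + x, q.2)) (by fun_prop)
        exact (this.sub S.continuous_U).const_smul _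
      · exact fun r t => (((S.dU (r + x) t).comp_add_const r x).sub (S.dU r t)).const_smul x⁻¹
      · exact fun r t => (((S.dP (r + x) t).comp_add_const r x).sub (S.dP r t)).const_smul x⁻¹
      · exact fun r t => ((S.dt (r + x) t).sub (S.dt r t)).const_smul x⁻¹
      · intro r t
        rw [← smul_sub]
        refine inv ?_
        rw [S.pde, S.pde, show Z (r + x) t - p.G (U (r + x) t) - (Z r t - p.G (U r t)) -
          (Z (r + x) t - Z r t) = -(p.G (U (r + x) t) - p.G (U r t)) by abel, norm_neg, mul_assoc]
        exact (S.G_lip _ _ _ _).trans (mul_le_mul_of_nonneg_left (quot r t x hx) hL.le)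
    have lim := ((S.dP ξ s).tendsto_slope_zero_right).norm
    exact le_of_tendsto lim (eventually_mem_nhdsWithin.mono fun x hx => bound x hx)
  have dW : ∀ ξ s, ‖W ξ s‖ ≤ (q * (q * M) + p.L * M) * Real.exp (-(μ / 2) * (ξ - b s)) := by
    intro ξ s
    rw [S.pde]
    refine (norm_sub_le _ _).trans ?_
    have := (S.G_le ξ s).trans (mul_le_mul_of_nonneg_left (dU ξ s) hL.le)
    linarith [dZ ξ s]
  have hK := S.K_nonneg
  set A := p.C + K + M + q * M + q * (q * M) + p.L * M with hA
  have n1 : 0 ≤ q * M := by positivity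
  have n2 : 0 ≤ q * (q * M) := by positivity
  have n3 : 0 ≤ p.L * M := by positivity
  have n4 := p.C_pos
  refine ⟨A, by positivity, ?_⟩
  have fin : ∀ {X : ℝ → ℝ → E} {a b' : ℝ}, (∀ ξ s, ‖X ξ s‖ ≤ a) → a ≤ A →
      (∀ ξ s, ‖X ξ s‖ ≤ b' * Real.exp (-(μ / 2) * (ξ - b s))) → b' ≤ A →
      DecaysAhead A (μ / 2) b X := fun h1 h2 h3 h4 ξ s =>
    ⟨(h1 ξ s).trans h2, (h3 ξ s).trans (mul_le_mul_of_nonneg_right h4 (Real.exp_pos _).le)⟩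
  rintro X (rfl | rfl | rfl | rfl)
  · exact fin S.bU (by linarith) dU (by linarith)
  · exact fin S.bP (by linarith) dP (by linarith)
  · exact fin S.bZ (by linarith) dZ (by linarith)
  · exact fin S.bW (by linarith) dW (by linarith)

end EntireSol

end

section

variable {E : Type*} [NormedAddCommGroup E] [InnerProductSpace ℝ E]

theorem integrable_exp_neg_mul_abs_sub {κ : ℝ} (hκ : 0 < κ) (β : ℝ) :
    Integrable fun ξ : ℝ => Real.exp (-κ * |ξ - β|) := by
  have h0 : Integrable fun ξ : ℝ => Real.exp (-κ * |ξ|) := by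
    rw [← integrableOn_univ, ← Iic_union_Ioi (a := (0:ℝ)), integrableOn_union]
    constructor
    · refine (integrableOn_exp_mul_Iic hκ 0).congr_fun (fun x hx => ?_) measurableSet_Iic
      rw [abs_of_nonpos (mem_Iic.1 hx)]; ring_nf
    · refine (integrableOn_exp_mul_Ioi (neg_lt_zero.2 hκ) 0).congr_fun (fun x hx => ?_)
        measurableSet_Ioi
      rw [abs_of_pos (mem_Ioi.1 hx)]
  exact h0.comp_sub_right β

/-- Weighted decay in both directions around `β`. -/
def WeightedLE (c κ β B : ℝ) (X : ℝ → E) : Prop :=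
  ∀ ξ, ‖X ξ‖ ≤ B * Real.exp (-(c * ξ + κ * |ξ - β|) / 2)

namespace WeightedLE
variable {c κ β B B' : ℝ} {X X' : ℝ → E}

theorem add (h : WeightedLE c κ β B X) (h' : WeightedLE c κ β B' X') :
    WeightedLE c κ β (B + B') (fun ξ => X ξ + X' ξ) := fun ξ =>
  (norm_add_le _ _).trans (by rw [add_mul]; exact add_le_add (h ξ) (h' ξ))

theorem sub (h : WeightedLE c κ β B X) (h' : WeightedLE c κ β B' X') :
    WeightedLE c κ β (B + B') (fun ξ => X ξ - X' ξ) := fun ξ =>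
  (norm_sub_le _ _).trans (by rw [add_mul]; exact add_le_add (h ξ) (h' ξ))

theorem smul (h : WeightedLE c κ β B X) (a : ℝ) :
    WeightedLE c κ β (|a| * B) (fun ξ => a • X ξ) := fun ξ => by
  rw [norm_smul, Real.norm_eq_abs, mul_assoc]
  exact mul_le_mul_of_nonneg_left (h ξ) (abs_nonneg a)

theorem nonneg (h : WeightedLE c κ β B X) : 0 ≤ B := by
  have := (norm_nonneg _).trans (h 0)
  exact nonneg_of_mul_nonneg_left this (Real.exp_pos _)

theorem mono (h : WeightedLE c κ β B X) (hB : B ≤ B') : WeightedLE c κ β B' X := fun ξ =>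
  (h ξ).trans (mul_le_mul_of_nonneg_right hB (Real.exp_pos _).le)

theorem norm_mul_norm_le (h : WeightedLE c κ β B X) (h' : WeightedLE c κ β B' X') (ξ : ℝ) :
    Real.exp (c * ξ) * (‖X ξ‖ * ‖X' ξ‖) ≤ B * B' * Real.exp (-κ * |ξ - β|) := by
  have e : Real.exp (-κ * |ξ - β|) = Real.exp (c * ξ) * (Real.exp (-(c * ξ + κ * |ξ - β|) / 2) *
      Real.exp (-(c * ξ + κ * |ξ - β|) / 2)) := by
    rw [← Real.exp_add, ← Real.exp_add]; congr 1; ring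
  rw [e]
  have := mul_le_mul (h ξ) (h' ξ) (norm_nonneg _) (mul_nonneg h.nonneg (Real.exp_pos _).le)
  calc _ ≤ Real.exp (c * ξ) * _ := mul_le_mul_of_nonneg_left this (Real.exp_pos _).le
    _ = _ := by ring

theorem integrable_inner (hκ : 0 < κ) (h : WeightedLE c κ β B X) (h' : WeightedLE c κ β B' X')
    (hX : Continuous X) (hX' : Continuous X') :
    Integrable fun ξ => Real.exp (c * ξ) * ⟪X ξ, X' ξ⟫ := by
  refine Integrable.mono' ((integrable_exp_neg_mul_abs_sub hκ β).const_mul (B * B'))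
    (by fun_prop : Continuous _).aestronglyMeasurable (Eventually.of_forall fun ξ => ?_)
  rw [norm_mul, Real.norm_eq_abs, abs_of_pos (Real.exp_pos _), Real.norm_eq_abs]
  exact (mul_le_mul_of_nonneg_left (abs_real_inner_le_norm _ _) (Real.exp_pos _).le).trans
    (h.norm_mul_norm_le h' ξ)

end WeightedLE

theorem Pot.abs_W_le (p : Pot E) {x : E} (hx : ‖x‖ ≤ p.C) : |p.W x| ≤ p.L * (‖x‖ * ‖x‖) := by
  have := p.quad 0 x (by simpa using p.C_pos.le) hx
  simpa [p.G_zero, p.W_zero, sq] using this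

theorem Pot.continuous_W (p : Pot E) : Continuous p.W :=
  continuous_iff_continuousAt.2 fun x => (p.grad x).continuousAt

/-- Trapezoidal expansion of the potential. -/
theorem Pot.trapezoid (p : Pot E) {x y : E} (hx : ‖x‖ ≤ p.C) (hy : ‖y‖ ≤ p.C) :
    |p.W y - p.W x - ⟪y - x, (2:ℝ)⁻¹ • (p.G x + p.G y)⟫| ≤ 2 * p.L * ‖y - x‖ ^ 2 := by
  have h1 := abs_le.1 (p.quad x y hx hy)
  have h2 := abs_le.1 ((abs_real_inner_le_norm (y - x) (p.G y - p.G x)).trans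
    (mul_le_mul_of_nonneg_left (p.lip y x hy hx) (norm_nonneg _)))
  have e : ⟪y - x, (2:ℝ)⁻¹ • (p.G x + p.G y)⟫ = ⟪y - x, p.G x⟫ + ⟪y - x, p.G y - p.G x⟫ / 2 := by
    rw [real_inner_smul_right, inner_add_right, inner_sub_right]; ring
  rw [e, abs_le]
  have := p.L_pos
  constructor <;> nlinarith [sq_nonneg ‖y - x‖]

/-- Solutions in a travelling frame, with named partial derivatives. -/
structure FrameSol (p : Pot E) (c : ℝ) (v P Z Y : ℝ → ℝ → E) : Prop where
  bv : ∀ ξ s, ‖v ξ s‖ ≤ p.C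
  dv : ∀ ξ s, HasDerivAt (fun x => v x s) (P ξ s) ξ
  dP : ∀ ξ s, HasDerivAt (fun x => P x s) (Z ξ s) ξ
  ds : ∀ ξ s, HasDerivAt (fun σ => v ξ σ) (Y ξ s) s
  pde : ∀ ξ s, Y ξ s = Z ξ s + c • P ξ s - p.G (v ξ s)
  cZ : ∀ s, Continuous fun ξ => Z ξ s
  cY : ∀ s, Continuous fun ξ => Y ξ s
  cYs : ∀ ξ, Continuous fun s => Y ξ s

/-- Energy in a travelling frame. -/
def frameEnergy (p : Pot E) (c : ℝ) (v P : ℝ → ℝ → E) (s : ℝ) : ℝ :=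
  ∫ ξ, Real.exp (c * ξ) * (‖P ξ s‖ ^ 2 / 2 + p.W (v ξ s))

/-- Dissipation in a travelling frame. -/
def frameDissipation (c : ℝ) (Y : ℝ → ℝ → E) (s : ℝ) : ℝ := ∫ ξ, Real.exp (c * ξ) * ⟪Y ξ s, Y ξ s⟫

namespace FrameSol
variable {p : Pot E} {c κ β B s : ℝ} {v P Z Y : ℝ → ℝ → E}

theorem cv (S : FrameSol p c v P Z Y) (s : ℝ) : Continuous fun ξ => v ξ s :=
  continuous_iff_continuousAt.2 fun ξ => (S.dv ξ s).continuousAt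

theorem cP (S : FrameSol p c v P Z Y) (s : ℝ) : Continuous fun ξ => P ξ s :=
  continuous_iff_continuousAt.2 fun ξ => (S.dP ξ s).continuousAt

theorem cG (S : FrameSol p c v P Z Y) (s : ℝ) : Continuous fun ξ => p.G (v ξ s) := by
  have : (fun ξ => p.G (v ξ s)) = fun ξ => Z ξ s + c • P ξ s - Y ξ s := by
    funext ξ; rw [S.pde]; abel
  rw [this]
  exact ((S.cZ s).add ((S.cP s).const_smul c)).sub (S.cY s)

/-- Pointwise bound of the energy density. -/
theorem density_le (S : FrameSol p c v P Z Y) (hv : WeightedLE c κ β B fun ξ => v ξ s)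
    (hP : WeightedLE c κ β B fun ξ => P ξ s) (ξ : ℝ) :
    ‖Real.exp (c * ξ) * (‖P ξ s‖ ^ 2 / 2 + p.W (v ξ s))‖ ≤
      (1 + p.L) * (B * B) * Real.exp (-κ * |ξ - β|) := by
  have h1 := hv.norm_mul_norm_le hv ξ
  have h2 := hP.norm_mul_norm_le hP ξ
  have h3 := p.abs_W_le (S.bv ξ s)
  have he := Real.exp_pos (c * ξ)
  have hL := p.L_pos
  rw [norm_mul, Real.norm_eq_abs, abs_of_pos he, Real.norm_eq_abs]
  have h4 : |‖P ξ s‖ ^ 2 / 2 + p.W (v ξ s)| ≤ ‖P ξ s‖ * ‖P ξ s‖ + p.L * (‖v ξ s‖ * ‖v ξ s‖) := by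
    refine (abs_add_le _ _).trans (add_le_add ?_ h3)
    rw [abs_of_nonneg (by positivity)]; nlinarith [sq_nonneg ‖P ξ s‖]
  calc _ ≤ Real.exp (c * ξ) * (‖P ξ s‖ * ‖P ξ s‖ + p.L * (‖v ξ s‖ * ‖v ξ s‖)) :=
        mul_le_mul_of_nonneg_left h4 he.le
    _ = Real.exp (c * ξ) * (‖P ξ s‖ * ‖P ξ s‖) + p.L * (Real.exp (c * ξ) * (‖v ξ s‖ * ‖v ξ s‖)) := by
        ring
    _ ≤ B * B * Real.exp (-κ * |ξ - β|) + p.L * (B * B * Real.exp (-κ * |ξ - β|)) :=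
        add_le_add h2 (mul_le_mul_of_nonneg_left h1 hL.le)
    _ = _ := by ring

theorem continuous_density (S : FrameSol p c v P Z Y) (s : ℝ) :
    Continuous fun ξ => Real.exp (c * ξ) * (‖P ξ s‖ ^ 2 / 2 + p.W (v ξ s)) := by
  have := S.cP s
  have := p.continuous_W.comp (S.cv s)
  exact (by fun_prop : Continuous fun ξ => Real.exp (c * ξ)).mul
    ((((S.cP s).norm.pow 2).div_const 2).add (p.continuous_W.comp (S.cv s)))

theorem integrable_density (S : FrameSol p c v P Z Y) (hκ : 0 < κ)
    (hv : WeightedLE c κ β B fun ξ => v ξ s) (hP : WeightedLE c κ β B fun ξ => P ξ s) :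
    Integrable fun ξ => Real.exp (c * ξ) * (‖P ξ s‖ ^ 2 / 2 + p.W (v ξ s)) :=
  Integrable.mono' ((integrable_exp_neg_mul_abs_sub hκ β).const_mul _)
    (S.continuous_density s).aestronglyMeasurable (Eventually.of_forall (S.density_le hv hP))

theorem abs_energy_le (S : FrameSol p c v P Z Y) (hκ : 0 < κ)
    (hv : WeightedLE c κ β B fun ξ => v ξ s) (hP : WeightedLE c κ β B fun ξ => P ξ s) :
    |frameEnergy p c v P s| ≤ (1 + p.L) * (B * B) * ∫ ξ, Real.exp (-κ * |ξ|) := by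
  have h := norm_integral_le_of_norm_le ((integrable_exp_neg_mul_abs_sub hκ β).const_mul _)
    (Eventually.of_forall (S.density_le hv hP))
  rwa [integral_const_mul, integral_sub_right_eq_self (fun ξ => Real.exp (-κ * |ξ|)) β] at h

/-- Finite variation of the energy. -/
theorem energy_sub (S : FrameSol p c v P Z Y) (hκ : 0 < κ) {s s' : ℝ}
    (hv : WeightedLE c κ β B fun ξ => v ξ s) (hP : WeightedLE c κ β B fun ξ => P ξ s)
    (hZ : WeightedLE c κ β B fun ξ => Z ξ s)
    (hv' : WeightedLE c κ β B fun ξ => v ξ s') (hP' : WeightedLE c κ β B fun ξ => P ξ s')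
    (hZ' : WeightedLE c κ β B fun ξ => Z ξ s') :
    frameEnergy p c v P s' - frameEnergy p c v P s = ∫ ξ, Real.exp (c * ξ) *
      (p.W (v ξ s') - p.W (v ξ s) - ⟪v ξ s' - v ξ s, (2:ℝ)⁻¹ • (p.G (v ξ s) + p.G (v ξ s'))⟫
        - ⟪v ξ s' - v ξ s, (2:ℝ)⁻¹ • (Y ξ s + Y ξ s')⟫) := by
  have wq := hP'.sub hP
  have wp := hv'.sub hv
  have wR := (hP.add hP').smul (2:ℝ)⁻¹
  have wZ := (hZ.add hZ').smul (2:ℝ)⁻¹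
  have i1 := wp.integrable_inner hκ wR ((S.cv s').sub (S.cv s)) (((S.cP s).add (S.cP s')).const_smul _)
  have i2 := wq.integrable_inner hκ wR ((S.cP s').sub (S.cP s)) (((S.cP s).add (S.cP s')).const_smul _)
  have i3 := wp.integrable_inner hκ wZ ((S.cv s').sub (S.cv s)) (((S.cZ s).add (S.cZ s')).const_smul _)
  have parts : ∫ ξ, (c * (Real.exp (c * ξ) * ⟪v ξ s' - v ξ s, (2:ℝ)⁻¹ • (P ξ s + P ξ s')⟫) +
      (Real.exp (c * ξ) * ⟪P ξ s' - P ξ s, (2:ℝ)⁻¹ • (P ξ s + P ξ s')⟫ +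
      Real.exp (c * ξ) * ⟪v ξ s' - v ξ s, (2:ℝ)⁻¹ • (Z ξ s + Z ξ s')⟫)) = 0 := by
    refine integral_eq_zero_of_hasDerivAt_of_integrable (f := fun ξ => Real.exp (c * ξ) *
      ⟪v ξ s' - v ξ s, (2:ℝ)⁻¹ • (P ξ s + P ξ s')⟫) (fun ξ => ?_) ((i1.const_mul c).add (i2.add i3)) i1
    have d1 : HasDerivAt (fun ξ => Real.exp (c * ξ)) (Real.exp (c * ξ) * c) ξ :=
      ((hasDerivAt_id ξ).const_mul c).exp.congr_deriv (by simp only [id, mul_one])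
    have d2 := ((S.dv ξ s').sub (S.dv ξ s)).inner ℝ
      (((S.dP ξ s).add (S.dP ξ s')).const_smul (2:ℝ)⁻¹)
    exact (d1.mul d2).congr_deriv (by simp only [Pi.sub_apply, Pi.add_apply, Pi.smul_apply]; ring)
  have e0 := S.integrable_density hκ hv hP
  have e1 := S.integrable_density hκ hv' hP'
  rw [frameEnergy, frameEnergy, ← integral_sub e1 e0, ← sub_zero (∫ ξ, _), ← parts]
  refine (integral_sub (e1.sub e0) ((i1.const_mul c).add (i2.add i3))).symm.trans ?_
  refine integral_congr_ae (Eventually.of_forall fun ξ => ?_)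
  simp only [Pi.sub_apply, Pi.add_apply, S.pde, real_inner_smul_right, inner_add_right, inner_sub_left,
    inner_sub_right, ← real_inner_self_eq_norm_sq]
  rw [real_inner_comm (P ξ s) (P ξ s')]
  ring

/-- Differentiability of the energy. -/
theorem hasDerivAt_energy (S : FrameSol p c v P Z Y) (hκ : 0 < κ) {I : Set ℝ} (hI : I ∈ 𝓝 s)
    (hIc : Convex ℝ I)
    (h : ∀ σ ∈ I, ∀ X ∈ ({v, P, Z, Y} : Set (ℝ → ℝ → E)), WeightedLE c κ β B fun ξ => X ξ σ) :
    HasDerivAt (frameEnergy p c v P) (-frameDissipation c Y s) s := by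
  have hs : s ∈ I := mem_of_mem_nhds hI
  have hv : ∀ σ ∈ I, WeightedLE c κ β B fun ξ => v ξ σ := fun σ hσ => h σ hσ v (by simp)
  have hP : ∀ σ ∈ I, WeightedLE c κ β B fun ξ => P ξ σ := fun σ hσ => h σ hσ P (by simp)
  have hZ : ∀ σ ∈ I, WeightedLE c κ β B fun ξ => Z ξ σ := fun σ hσ => h σ hσ Z (by simp)
  have hY : ∀ σ ∈ I, WeightedLE c κ β B fun ξ => Y ξ σ := fun σ hσ => h σ hσ Y (by simp)
  have hL := p.L_pos
  have hB := (hv s hs).nonneg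
  rw [hasDerivAt_iff_tendsto_slope]
  set R : ℝ → ℝ → ℝ := fun σ ξ => p.W (v ξ σ) - p.W (v ξ s) -
    ⟪v ξ σ - v ξ s, (2:ℝ)⁻¹ • (p.G (v ξ s) + p.G (v ξ σ))⟫ with hR
  have hslope : ∀ᶠ σ in 𝓝[≠] s, (∫ ξ, Real.exp (c * ξ) * ((σ - s)⁻¹ * R σ ξ -
      ⟪(σ - s)⁻¹ • (v ξ σ - v ξ s), (2:ℝ)⁻¹ • (Y ξ s + Y ξ σ)⟫)) =
      slope (frameEnergy p c v P) s σ := by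
    filter_upwards [mem_nhdsWithin_of_mem_nhds hI] with σ hσ
    rw [slope_def_field, div_eq_inv_mul, S.energy_sub hκ (hv s hs) (hP s hs) (hZ s hs) (hv σ hσ)
      (hP σ hσ) (hZ σ hσ), ← integral_const_mul]
    refine integral_congr_ae (Eventually.of_forall fun ξ => ?_)
    simp only [hR, real_inner_smul_left]
    ring
  refine Tendsto.congr' hslope ?_
  rw [frameDissipation, ← integral_neg]
  refine tendsto_integral_filter_of_dominated_convergence
    (fun ξ => (B * B + 4 * p.L * (B * B)) * Real.exp (-κ * |ξ - β|)) ?_ ?_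
    ((integrable_exp_neg_mul_abs_sub hκ β).const_mul _) ?_
  · refine Eventually.of_forall fun σ => Continuous.aestronglyMeasurable ?_
    have c1 := S.cv s
    have c2 := S.cv σ
    have c3 := S.cG s
    have c4 := S.cG σ
    have c5 := S.cY s
    have c6 := S.cY σ
    have c7 := p.continuous_W.comp c1
    have c8 := p.continuous_W.comp c2
    simp only [Function.comp_def] at c7 c8
    simp only [hR]
    fun_prop
  · filter_upwards [mem_nhdsWithin_of_mem_nhds hI, self_mem_nhdsWithin] with σ hσ hne
    have hne : σ - s ≠ 0 := sub_ne_zero.2 hne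
    refine Eventually.of_forall fun ξ => ?_
    set w := Real.exp (-(c * ξ + κ * |ξ - β|) / 2) with hw
    have hw0 : 0 < w := Real.exp_pos _
    have q1 : ‖v ξ σ - v ξ s‖ ≤ B * w * |σ - s| := by
      refine norm_sub_le_of_deriv_le (f := fun z => v ξ z) (fun z _ => S.ds ξ z) fun z hz => ?_
      exact hY z (hIc.ordConnected.uIcc_subset hs hσ hz) ξ
    have hi : |(σ - s)⁻¹| * |σ - s| = 1 := by rw [← abs_mul, inv_mul_cancel₀ hne, abs_one]
    have q2 : ‖(σ - s)⁻¹ • (v ξ σ - v ξ s)‖ ≤ B * w := by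
      rw [norm_smul, Real.norm_eq_abs]
      calc _ ≤ |(σ - s)⁻¹| * (B * w * |σ - s|) := mul_le_mul_of_nonneg_left q1 (abs_nonneg _)
        _ = B * w * (|(σ - s)⁻¹| * |σ - s|) := by ring
        _ = _ := by rw [hi, mul_one]
    have q3 : ‖v ξ σ - v ξ s‖ ≤ 2 * (B * w) := by
      have := (hv σ hσ).sub (hv s hs) ξ
      simp only at this; linarith
    have q4 : ‖(2:ℝ)⁻¹ • (Y ξ s + Y ξ σ)‖ ≤ B * w := by
      have := ((hY s hs).add (hY σ hσ)).smul (2:ℝ)⁻¹ ξ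
      refine this.trans (le_of_eq ?_)
      rw [abs_of_pos (by norm_num)]; ring
    have q5 : |(σ - s)⁻¹ * R σ ξ| ≤ 4 * p.L * ((B * w) * (B * w)) := by
      rw [abs_mul]
      have := p.trapezoid (S.bv ξ s) (S.bv ξ σ)
      calc _ ≤ |(σ - s)⁻¹| * (2 * p.L * ‖v ξ σ - v ξ s‖ ^ 2) :=
            mul_le_mul_of_nonneg_left this (abs_nonneg _)
        _ = 2 * p.L * (‖(σ - s)⁻¹ • (v ξ σ - v ξ s)‖ * ‖v ξ σ - v ξ s‖) := by
            rw [norm_smul, Real.norm_eq_abs]; ring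
        _ ≤ 2 * p.L * ((B * w) * (2 * (B * w))) := by gcongr
        _ = _ := by ring
    have q6 := (abs_real_inner_le_norm ((σ - s)⁻¹ • (v ξ σ - v ξ s)) ((2:ℝ)⁻¹ • (Y ξ s + Y ξ σ))).trans
      (mul_le_mul q2 q4 (norm_nonneg _) (by positivity))
    have e : Real.exp (-κ * |ξ - β|) = Real.exp (c * ξ) * (w * w) := by
      rw [hw, ← Real.exp_add, ← Real.exp_add]; congr 1; ring
    rw [norm_mul, Real.norm_eq_abs, abs_of_pos (Real.exp_pos _), Real.norm_eq_abs, e]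
    calc _ ≤ Real.exp (c * ξ) * (4 * p.L * ((B * w) * (B * w)) + (B * w) * (B * w)) :=
          mul_le_mul_of_nonneg_left ((abs_sub _ _).trans (add_le_add q5 q6)) (Real.exp_pos _).le
      _ = _ := by ring
  · refine Eventually.of_forall fun ξ => ?_
    have t1 : Tendsto (fun σ => (σ - s)⁻¹ • (v ξ σ - v ξ s)) (𝓝[≠] s) (𝓝 (Y ξ s)) :=
      hasDerivAt_iff_tendsto_slope.1 (S.ds ξ s)
    have t2 : Tendsto (fun σ => v ξ σ - v ξ s) (𝓝[≠] s) (𝓝 0) := by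
      have := (S.ds ξ s).continuousAt.tendsto.sub_const (v ξ s)
      rw [sub_self] at this
      exact this.mono_left nhdsWithin_le_nhds
    have t3 : Tendsto (fun σ => Y ξ σ) (𝓝[≠] s) (𝓝 (Y ξ s)) :=
      ((S.cYs ξ).tendsto s).mono_left nhdsWithin_le_nhds
    have t4 : Tendsto (fun σ => (σ - s)⁻¹ * R σ ξ) (𝓝[≠] s) (𝓝 0) := by
      refine squeeze_zero_norm (a := fun σ => 2 * p.L *
        (‖(σ - s)⁻¹ • (v ξ σ - v ξ s)‖ * ‖v ξ σ - v ξ s‖)) (fun σ => ?_) ?_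
      · have := p.trapezoid (S.bv ξ s) (S.bv ξ σ)
        rw [Real.norm_eq_abs, abs_mul]
        calc _ ≤ |(σ - s)⁻¹| * (2 * p.L * ‖v ξ σ - v ξ s‖ ^ 2) :=
              mul_le_mul_of_nonneg_left this (abs_nonneg _)
          _ = _ := by rw [norm_smul, Real.norm_eq_abs]; ring
      · simpa using (t1.norm.mul t2.norm).const_mul (2 * p.L)
    have t5 := t1.inner ((tendsto_const_nhds (x := Y ξ s)).add t3 |>.const_smul (2:ℝ)⁻¹) (𝕜 := ℝ)
    have := (t4.sub t5).const_mul (Real.exp (c * ξ))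
    refine this.trans (le_of_eq ?_)
    congr 1
    rw [← two_smul ℝ (Y ξ s), smul_smul]
    norm_num

end FrameSol

end

section

variable {E : Type*} [NormedAddCommGroup E] [InnerProductSpace ℝ E]

theorem DecaysAhead.weightedLE {A ν c κ s : ℝ} {b : ℝ → ℝ} {X : ℝ → ℝ → E}
    (h : DecaysAhead A ν b X) (hA : 0 ≤ A) (hκ : κ ≤ c) (hν : c + κ ≤ 2 * ν) :
    WeightedLE c κ (b s - c * s) (A * Real.exp (c * (b s - c * s) / 2))
      (fun ξ => X (ξ + c * s) s) := by
  intro ξ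
  rw [mul_assoc, ← Real.exp_add]
  obtain ⟨h1, h2⟩ := h (ξ + c * s) s
  rcases le_total ξ (b s - c * s) with hx | hx
  · refine h1.trans (le_mul_of_one_le_right hA (Real.one_le_exp ?_))
    rw [abs_of_nonpos (sub_nonpos.2 hx)]
    nlinarith
  · refine h2.trans (mul_le_mul_of_nonneg_left (Real.exp_le_exp.2 ?_) hA)
    rw [abs_of_nonneg (sub_nonneg.2 hx)]
    nlinarith

theorem WeightedLE.recenter {c κ β B : ℝ} {X : ℝ → E} (h : WeightedLE c κ β B X) (hκ : 0 ≤ κ) :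
    WeightedLE c κ 0 (B * Real.exp (κ * |β| / 2)) X := fun ξ => by
  refine (h ξ).trans ?_
  rw [mul_assoc, ← Real.exp_add]
  refine mul_le_mul_of_nonneg_left (Real.exp_le_exp.2 ?_) h.nonneg
  have := abs_sub_abs_le_abs_sub ξ β
  rw [sub_zero]
  nlinarith

namespace FrameSol
variable {p : Pot E} {c κ β B s : ℝ} {v P Z Y : ℝ → ℝ → E}

theorem dissipation_ge (S : FrameSol p c v P Z Y) (hκ : 0 < κ) (hc : 0 ≤ c)
    (hY : WeightedLE c κ β B fun ξ => Y ξ s) {η ξ₁ ρ : ℝ} (hη : 0 ≤ η) (hρ : 0 ≤ ρ)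
    (h : ∀ ξ ∈ Icc ξ₁ (ξ₁ + ρ), η ≤ ‖Y ξ s‖) :
    ρ * (Real.exp (c * ξ₁) * η ^ 2) ≤ frameDissipation c Y s := by
  have hi := hY.integrable_inner hκ hY (S.cY s) (S.cY s)
  have hnn : ∀ ξ, 0 ≤ Real.exp (c * ξ) * ⟪Y ξ s, Y ξ s⟫ := fun ξ =>
    mul_nonneg (Real.exp_pos _).le real_inner_self_nonneg
  calc ρ * (Real.exp (c * ξ₁) * η ^ 2) = ∫ ξ in Icc ξ₁ (ξ₁ + ρ), Real.exp (c * ξ₁) * η ^ 2 := by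
        rw [setIntegral_const, Real.volume_real_Icc, smul_eq_mul, add_sub_cancel_left,
          max_eq_left hρ]
    _ ≤ ∫ ξ in Icc ξ₁ (ξ₁ + ρ), Real.exp (c * ξ) * ⟪Y ξ s, Y ξ s⟫ := by
        refine setIntegral_mono_on continuousOn_const.integrableOn_Icc hi.integrableOn measurableSet_Icc
          fun ξ hξ => ?_
        rw [real_inner_self_eq_norm_sq]
        have := h ξ hξ
        have := hξ.1
        gcongr
    _ ≤ _ := setIntegral_le_integral hi (Eventually.of_forall hnn)

theorem eq_zero_of_dissipation (S : FrameSol p c v P Z Y) (hκ : 0 < κ)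
    (hY : WeightedLE c κ β B fun ξ => Y ξ s) (h : frameDissipation c Y s = 0) (ξ : ℝ) :
    Y ξ s = 0 := by
  have hi := hY.integrable_inner hκ hY (S.cY s) (S.cY s)
  have hnn : 0 ≤ fun ξ => Real.exp (c * ξ) * ⟪Y ξ s, Y ξ s⟫ := fun ξ =>
    mul_nonneg (Real.exp_pos _).le real_inner_self_nonneg
  have h0 := (integral_eq_zero_iff_of_nonneg hnn hi).1 h
  have hcont : Continuous fun ξ => Real.exp (c * ξ) * ⟪Y ξ s, Y ξ s⟫ := by
    have := S.cY s
    fun_prop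
  have := congrFun ((hcont.ae_eq_iff_eq volume continuous_zero).1 h0) ξ
  simpa [(Real.exp_pos (c * ξ)).ne'] using this

end FrameSol

namespace EntireSol
variable {p : Pot E} {K : ℝ} {U P Z W : ℝ → ℝ → E}

theorem frame (S : EntireSol p K U P Z W) (c : ℝ) :
    FrameSol p c (fun ξ s => U (ξ + c * s) s) (fun ξ s => P (ξ + c * s) s)
      (fun ξ s => Z (ξ + c * s) s) (fun ξ s => W (ξ + c * s) s + c • P (ξ + c * s) s) where
  bv _ _ := S.bU _ _
  dv ξ s := (S.dU (ξ + c * s) s).comp_add_const ξ (c * s)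
  dP ξ s := (S.dP (ξ + c * s) s).comp_add_const ξ (c * s)
  ds ξ s := S.dframe c ξ s
  pde ξ s := by rw [S.pde]; abel
  cZ s := S.continuous_Z.comp (f := fun ξ : ℝ => (ξ + c * s, s)) (by fun_prop)
  cY s := (S.continuous_W.comp (f := fun ξ : ℝ => (ξ + c * s, s)) (by fun_prop)).add
    ((S.continuous_P.comp (f := fun ξ : ℝ => (ξ + c * s, s)) (by fun_prop)).const_smul c)
  cYs ξ := (S.continuous_W.comp (f := fun s : ℝ => (ξ + c * s, s)) (by fun_prop)).add
    ((S.continuous_P.comp (f := fun s : ℝ => (ξ + c * s, s)) (by fun_prop)).const_smul c)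

/-- Admissible width for the perturbation of the speed and for the decay rate. -/
def gap (p : Pot E) (c : ℝ) : ℝ := min (c / 4) (p.lam / (6 * c))

theorem gap_pos (p : Pot E) {c : ℝ} (hc : 0 < c) : 0 < gap p c :=
  lt_min (by linarith) (div_pos p.lam_pos (by linarith))

/-- Weighted bounds, in a frame travelling at a speed close to `c₀`. -/
def FrameBounds (p : Pot E) (c₀ c η k A : ℝ) (U P Z W : ℝ → ℝ → E) : Prop :=
  ∀ s, ∀ X ∈ ({fun ξ s => U (ξ + c * s) s, fun ξ s => P (ξ + c * s) s,
      fun ξ s => Z (ξ + c * s) s, fun ξ s => W (ξ + c * s) s + c • P (ξ + c * s) s} :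
      Set (ℝ → ℝ → E)),
    WeightedLE c (gap p c₀) (c₀ * s + η * |s| + k - c * s)
      (A * Real.exp (c * (c₀ * s + η * |s| + k - c * s) / 2)) (fun ξ => X ξ s)

theorem exists_frameBounds (S : EntireSol p K U P Z W) {c₀ c η k : ℝ} (hc₀ : 0 < c₀)
    (hc : |c - c₀| ≤ gap p c₀) (hη : 0 ≤ η) (hη' : η ≤ gap p c₀) (h : SmallAhead p U c₀ η k) :
    ∃ A, 0 ≤ A ∧ FrameBounds p c₀ c η k A U P Z W := by
  set κ := gap p c₀ with hκ
  have hκ0 : 0 < κ := gap_pos p hc₀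
  have k1 : κ ≤ c₀ / 4 := min_le_left _ _
  have k2 : κ * (6 * c₀) ≤ p.lam := (le_div_iff₀ (by linarith)).1 (min_le_right _ _)
  obtain ⟨c1, c2⟩ := abs_le.1 hc
  obtain ⟨A, hA, hX⟩ := S.exists_decaysAhead (μ := c + κ) h hη (by linarith) (by linarith)
    (by nlinarith)
  have w : ∀ X ∈ ({U, P, Z, W} : Set (ℝ → ℝ → E)), ∀ s, _ := fun X hX' s =>
    (hX X hX').weightedLE (s := s) (c := c) (κ := κ) hA (by linarith) (by linarith)
  refine ⟨(1 + |c|) * A, by positivity, ?_⟩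
  have hAle : A ≤ (1 + |c|) * A := by nlinarith [abs_nonneg c]
  rintro s X (rfl | rfl | rfl | rfl)
  · exact (w U (by simp) s).mono (mul_le_mul_of_nonneg_right hAle (Real.exp_pos _).le)
  · exact (w P (by simp) s).mono (mul_le_mul_of_nonneg_right hAle (Real.exp_pos _).le)
  · exact (w Z (by simp) s).mono (mul_le_mul_of_nonneg_right hAle (Real.exp_pos _).le)
  · exact ((w W (by simp) s).add ((w P (by simp) s).smul c)).mono (le_of_eq (by ring))

/-- Energy of an entire solution in a frame travelling at speed `c`. -/
def energy (p : Pot E) (c : ℝ) (U P : ℝ → ℝ → E) : ℝ → ℝ :=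
  frameEnergy p c (fun ξ s => U (ξ + c * s) s) (fun ξ s => P (ξ + c * s) s)

/-- Dissipation of an entire solution in a frame travelling at speed `c`. -/
def dissipation (c : ℝ) (P W : ℝ → ℝ → E) : ℝ → ℝ :=
  frameDissipation c (fun ξ s => W (ξ + c * s) s + c • P (ξ + c * s) s)

variable {c₀ c η k A : ℝ}

theorem hasDerivAt_energy (S : EntireSol p K U P Z W) (hc₀ : 0 < c₀) (hA : 0 ≤ A)
    (B : FrameBounds p c₀ c η k A U P Z W) (s : ℝ) :
    HasDerivAt (energy p c U P) (-dissipation c P W s) s := by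
  have hκ := gap_pos p hc₀
  set β : ℝ → ℝ := fun s => c₀ * s + η * |s| + k - c * s with hβ
  have hcont : Continuous fun s => A * Real.exp (c * β s / 2) * Real.exp (gap p c₀ * |β s| / 2) := by
    simp only [hβ]; fun_prop
  obtain ⟨M, hM⟩ := (isCompact_Icc (a := s - 1) (b := s + 1)).bddAbove_image hcont.continuousOn
  refine (S.frame c).hasDerivAt_energy hκ (I := Icc (s - 1) (s + 1)) (β := 0) (B := M)
    (Icc_mem_nhds (by linarith) (by linarith)) (convex_Icc _ _) fun σ hσ X hX => ?_
  exact ((B σ X hX).recenter hκ.le).mono (hM (mem_image_of_mem _ hσ))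

theorem dissipation_nonneg (c : ℝ) (P W : ℝ → ℝ → E) (s : ℝ) : 0 ≤ dissipation c P W s :=
  integral_nonneg fun ξ => mul_nonneg (Real.exp_pos _).le real_inner_self_nonneg

theorem antitone_energy (S : EntireSol p K U P Z W) (hc₀ : 0 < c₀) (hA : 0 ≤ A)
    (B : FrameBounds p c₀ c η k A U P Z W) : Antitone (energy p c U P) :=
  antitone_of_hasDerivAt_nonpos (S.hasDerivAt_energy hc₀ hA B) fun s =>
    neg_nonpos.2 (dissipation_nonneg c P W s)

theorem abs_energy_le (S : EntireSol p K U P Z W) (hc₀ : 0 < c₀)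
    (B : FrameBounds p c₀ c η k A U P Z W) (s : ℝ) :
    |energy p c U P s| ≤ (1 + p.L) * (A * A) * (∫ ξ, Real.exp (-gap p c₀ * |ξ|)) *
      Real.exp (c * (c₀ * s + η * |s| + k - c * s)) := by
  refine ((S.frame c).abs_energy_le (gap_pos p hc₀) 
    (B s (fun ξ s => U (ξ + c * s) s) (by simp)) (B s (fun ξ s => P (ξ + c * s) s) (by simp))).trans
    (le_of_eq ?_)
  have : Real.exp (c * (c₀ * s + η * |s| + k - c * s)) =
      Real.exp (c * (c₀ * s + η * |s| + k - c * s) / 2) *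
      Real.exp (c * (c₀ * s + η * |s| + k - c * s) / 2) := by
    rw [← Real.exp_add]; congr 1; ring
  rw [this]; ring

theorem frame_eq_zero (S : EntireSol p K U P Z W) (hc₀ : 0 < c₀)
    (B : FrameBounds p c₀ c η k A U P Z W) {s : ℝ} (h : dissipation c P W s = 0) (ξ : ℝ) :
    W ξ s + c • P ξ s = 0 := by
  simpa using (S.frame c).eq_zero_of_dissipation (gap_pos p hc₀)
    (B s (fun ξ s => W (ξ + c * s) s + c • P (ξ + c * s) s) (by simp)) h (ξ - c * s)

end EntireSol

end

section

variable {E : Type*} [NormedAddCommGroup E] [InnerProductSpace ℝ E]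

namespace EntireSol
variable {p : Pot E} {K : ℝ} {U P Z W : ℝ → ℝ → E} {c A : ℝ}

/-- An entire solution which is stationary in the frame travelling at speed `c`. -/
def IsWave (c : ℝ) (P W : ℝ → ℝ → E) : Prop := ∀ ξ s, W ξ s + c • P ξ s = 0

theorem FrameBounds.weightedLE (B : FrameBounds p c c 0 0 A U P Z W) (s : ℝ) {X : ℝ → ℝ → E}
    (hX : X ∈ ({fun ξ s => U (ξ + c * s) s, fun ξ s => P (ξ + c * s) s,
      fun ξ s => Z (ξ + c * s) s, fun ξ s => W (ξ + c * s) s + c • P (ξ + c * s) s} :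
      Set (ℝ → ℝ → E))) :
    WeightedLE c (gap p c) 0 A (fun ξ => X ξ s) := by
  simpa using B s X hX

theorem norm_frame_sub_le (S : EntireSol p K U P Z W) (hc : 0 ≤ c) (x t a k : ℝ) :
    ‖(W (x + a) (t + k) + c • P (x + a) (t + k)) - (W x t + c • P x t)‖ ≤
      K * |a| + K * Real.sqrt |k| + c * (K * |a| + K * |k|) := by
  have h1 := S.W_x x t a
  have h2 := S.W_t (x + a) t k
  have h3 := S.P_lip_x x t a
  have h4 := S.P_t (x + a) t k
  have e : (W (x + a) (t + k) + c • P (x + a) (t + k)) - (W x t + c • P x t) =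
      ((W (x + a) t - W x t) + (W (x + a) (t + k) - W (x + a) t)) +
        c • ((P (x + a) t - P x t) + (P (x + a) (t + k) - P (x + a) t)) := by module
  rw [e]
  refine (norm_add_le _ _).trans (add_le_add ((norm_add_le _ _).trans (add_le_add h1 h2)) ?_)
  rw [norm_smul, Real.norm_of_nonneg hc]
  exact mul_le_mul_of_nonneg_left ((norm_add_le _ _).trans (add_le_add h3 h4)) hc

/-- A lower bound for the decrease of the energy. -/
theorem energy_drop (S : EntireSol p K U P Z W) (hc : 0 < c) (hA : 0 ≤ A)
    (B : FrameBounds p c c 0 0 A U P Z W) {η ρ : ℝ} (hη : 0 ≤ η) (hρ : 0 < ρ)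
    (hω : K * ((1 + c) * ρ) + K * Real.sqrt ρ + c * (K * ((1 + c) * ρ) + K * ρ) ≤ η)
    {ξ s : ℝ} (h : 2 * η ≤ ‖W (ξ + c * s) s + c • P (ξ + c * s) s‖) :
    energy p c U P (s + ρ) ≤ energy p c U P s - ρ * (Real.exp (c * ξ) * η ^ 2) * ρ := by
  have hK := S.K_nonneg
  have hd : ∀ σ ∈ Ioo s (s + ρ), ρ * (Real.exp (c * ξ) * η ^ 2) ≤ dissipation c P W σ := by
    intro σ hσ
    refine (S.frame c).dissipation_ge (gap_pos p hc) hc.le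
      (B.weightedLE σ (X := fun ξ s => W (ξ + c * s) s + c • P (ξ + c * s) s) (by simp))
      hη hρ.le fun x hx => ?_
    have ha : |x - ξ + c * (σ - s)| ≤ (1 + c) * ρ := by
      rw [abs_of_nonneg (by nlinarith [hx.1, hσ.1])]
      nlinarith [hx.2, hσ.2]
    have hk : |σ - s| ≤ ρ := by rw [abs_of_nonneg] <;> linarith [hσ.1, hσ.2]
    have hn := S.norm_frame_sub_le hc.le (ξ + c * s) s (x - ξ + c * (σ - s)) (σ - s)
    have e : ξ + c * s + (x - ξ + c * (σ - s)) = x + c * σ := by ring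
    rw [e, add_sub_cancel] at hn
    have h5 : K * |x - ξ + c * (σ - s)| + K * Real.sqrt |σ - s| +
        c * (K * |x - ξ + c * (σ - s)| + K * |σ - s|) ≤ η := by
      refine le_trans ?_ hω
      gcongr
    have h6 := norm_sub_norm_le (W (ξ + c * s) s + c • P (ξ + c * s) s)
      (W (x + c * σ) σ + c • P (x + c * σ) σ)
    rw [norm_sub_rev] at h6
    linarith
  have hder := S.hasDerivAt_energy hc hA B
  obtain ⟨σ, hσ, he⟩ := exists_hasDerivAt_eq_slope (energy p c U P)
    (fun s => -dissipation c P W s) (lt_add_of_pos_right s hρ)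
    (fun x _ => (hder x).continuousAt.continuousWithinAt) fun x _ => hder x
  have h7 := hd σ hσ
  rw [add_sub_cancel_left, eq_div_iff hρ.ne'] at he
  nlinarith

/-- Limits of translates in the travelling frame are waves if the energy converges. -/
theorem limit_isWave (S : EntireSol p K U P Z W) (hc : 0 < c) (hA : 0 ≤ A)
    (B : FrameBounds p c c 0 0 A U P Z W) {F : Filter ℝ} [F.NeBot] {e : ℝ}
    (he : ∀ a, Tendsto (fun i => energy p c U P (i + a)) F (𝓝 e)) {P' W' : ℝ → ℝ → E}
    (hP : ∀ ξ s, Tendsto (fun i => P (c * i + ξ) (i + s)) F (𝓝 (P' ξ s)))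
    (hW : ∀ ξ s, Tendsto (fun i => W (c * i + ξ) (i + s)) F (𝓝 (W' ξ s))) : IsWave c P' W' := by
  intro ξ s
  by_contra hne
  set η := ‖W' ξ s + c • P' ξ s‖ / 3 with hηd
  have hη : 0 < η := by have := norm_pos_iff.2 hne; positivity
  have hω : Tendsto (fun ρ : ℝ =>
      K * ((1 + c) * ρ) + K * Real.sqrt ρ + c * (K * ((1 + c) * ρ) + K * ρ)) (𝓝[>] 0) (𝓝 0) := by
    have : Continuous fun ρ : ℝ =>
      K * ((1 + c) * ρ) + K * Real.sqrt ρ + c * (K * ((1 + c) * ρ) + K * ρ) := by fun_prop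
    have h := (this.tendsto 0).mono_left (nhdsWithin_le_nhds (s := Ioi 0))
    simpa using h
  obtain ⟨ρ, hρω, hρ⟩ := ((hω.eventually (gt_mem_nhds hη)).and self_mem_nhdsWithin).exists
  have hρ : 0 < ρ := hρ
  have hlim := ((hW ξ s).add ((hP ξ s).const_smul c)).norm
  have hev : ∀ᶠ i in F, 2 * η ≤ ‖W (c * i + ξ) (i + s) + c • P (c * i + ξ) (i + s)‖ :=
    (hlim.eventually (lt_mem_nhds (by linarith : 2 * η < ‖W' ξ s + c • P' ξ s‖))).mono
      fun i h => h.le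
  have hdrop : ∀ᶠ i in F, energy p c U P (i + (s + ρ)) ≤ energy p c U P (i + s) -
      ρ * (Real.exp (c * (ξ - c * s)) * η ^ 2) * ρ := hev.mono fun i hi => by
    rw [← add_assoc]
    refine S.energy_drop hc hA B hη.le hρ hρω.le (ξ := ξ - c * s) (s := i + s) ?_
    rwa [show ξ - c * s + c * (i + s) = c * i + ξ by ring]
  have h8 := le_of_tendsto_of_tendsto (he (s + ρ)) ((he s).sub_const _) hdrop
  have : 0 < ρ * (Real.exp (c * (ξ - c * s)) * η ^ 2) * ρ := by positivity
  linarith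

theorem tendsto_energy_zero (S : EntireSol p K U P Z W) (hc : 0 < c)
    (B : FrameBounds p c c 0 0 A U P Z W) {l : Filter ℝ} [l.IsCountablyGenerated]
    (hU : ∀ ξ, Tendsto (fun s => U (ξ + c * s) s) l (𝓝 0))
    (hP : ∀ ξ, Tendsto (fun s => P (ξ + c * s) s) l (𝓝 0)) :
    Tendsto (energy p c U P) l (𝓝 0) := by
  have h0 : (∫ _ : ℝ, (0:ℝ)) = 0 := by simp
  rw [← h0]
  refine tendsto_integral_filter_of_dominated_convergence
    (fun ξ => (1 + p.L) * (A * A) * Real.exp (-gap p c * |ξ - 0|))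
    (Eventually.of_forall fun s => ((S.frame c).continuous_density s).aestronglyMeasurable)
    (Eventually.of_forall fun s => Eventually.of_forall ((S.frame c).density_le
      (B.weightedLE s (X := fun ξ s => U (ξ + c * s) s) (by simp))
      (B.weightedLE s (X := fun ξ s => P (ξ + c * s) s) (by simp))))
    ((integrable_exp_neg_mul_abs_sub (gap_pos p hc) 0).const_mul _)
    (Eventually.of_forall fun ξ => ?_)
  have h := (((hP ξ).norm.pow 2).div_const 2).add
    (((p.continuous_W.tendsto 0).comp (hU ξ)))
  simpa [p.W_zero] using h.const_mul (Real.exp (c * ξ))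

/-- A solution small ahead of a point travelling at speed `c` generates a wave. -/
theorem exists_isWave [ProperSpace E] (S : EntireSol p K U P Z W) (hc : 0 < c)
    (h : SmallAhead p U c 0 0) (hne : ∃ ξ s, U ξ s ≠ 0) :
    ∃ U' P' Z' W' : ℝ → ℝ → E, EntireSol p K U' P' Z' W' ∧ SmallAhead p U' c 0 0 ∧
      (∃ ξ s, U' ξ s ≠ 0) ∧ IsWave c P' W' := by
  obtain ⟨A, hA, B⟩ := S.exists_frameBounds hc (c := c) (by simpa using (gap_pos p hc).le) le_rfl
    (gap_pos p hc).le h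
  have hanti := S.antitone_energy hc hA B
  have hbd : ∃ M, ∀ s, |energy p c U P s| ≤ M := ⟨_, fun s => by
    simpa using S.abs_energy_le hc B s⟩
  obtain ⟨M, hM⟩ := hbd
  by_contra hno
  have key : ∀ (l : Filter ℝ) (e : ℝ), (∀ a, Tendsto (fun i => energy p c U P (i + a)) l (𝓝 e)) →
      (∀ ξ, Tendsto (fun s => U (ξ + c * s) s) l (𝓝 0)) ∧
        ∀ ξ, Tendsto (fun s => P (ξ + c * s) s) l (𝓝 0) := by
    intro l e he
    have hF : ∀ F : Ultrafilter ℝ, (F : Filter ℝ) ≤ l → ∀ ξ,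
        Tendsto (fun s => U (ξ + c * s) s) F (𝓝 0) ∧
          Tendsto (fun s => P (ξ + c * s) s) F (𝓝 0) := by
      intro F hF ξ
      obtain ⟨U', P', Z', W', S', hU, hP, hW⟩ :=
        (S.asymp_shift (F : Filter ℝ) (fun i => c * i) (fun i => i)).exists_limit
      have hz : ∀ ξ s, U' ξ s = 0 := by
        by_contra hz
        push Not at hz
        refine hno ⟨U', P', Z', W', S', fun s ξ hξ => ?_, hz,
          S.limit_isWave hc hA B (fun a => (he a).mono_left hF) hP hW⟩
        exact le_of_tendsto (hU ξ s).norm (Eventually.of_forall fun i => h _ _ (by linarith))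
      have hz' : P' ξ 0 = 0 := (S'.dU ξ 0).unique (by
        rw [show (fun x => U' x 0) = fun _ => 0 from funext fun x => hz x 0]
        exact hasDerivAt_const _ _)
      have h1 := hU ξ 0
      have h2 := hP ξ 0
      rw [hz] at h1
      rw [hz'] at h2
      simp only [add_zero] at h1 h2
      simp only [add_comm ξ]
      exact ⟨h1, h2⟩
    exact ⟨fun ξ => tendsto_iff_ultrafilter _ _ _ |>.2 fun F hl => (hF F hl ξ).1,
      fun ξ => tendsto_iff_ultrafilter _ _ _ |>.2 fun F hl => (hF F hl ξ).2⟩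
  have hbot := tendsto_atBot_ciSup hanti ⟨M, by rintro _ ⟨s, rfl⟩; exact (abs_le.1 (hM s)).2⟩
  have htop := tendsto_atTop_ciInf hanti ⟨-M, by rintro _ ⟨s, rfl⟩; exact (abs_le.1 (hM s)).1⟩
  have kb := key atBot _ fun a => hbot.comp (tendsto_atBot_add_const_right _ a tendsto_id)
  have kt := key atTop _ fun a => htop.comp (tendsto_atTop_add_const_right _ a tendsto_id)
  have zb := S.tendsto_energy_zero hc B kb.1 kb.2
  have zt := S.tendsto_energy_zero hc B kt.1 kt.2
  have hz : ∀ s, energy p c U P s = 0 := fun s =>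
    le_antisymm (hanti.ge_of_tendsto zb s) (hanti.le_of_tendsto zt s)
  have hd : ∀ s, dissipation c P W s = 0 := fun s => by
    have h1 := S.hasDerivAt_energy hc hA B s
    rw [show energy p c U P = fun _ => 0 from funext hz] at h1
    exact neg_eq_zero.1 (h1.unique (hasDerivAt_const _ _))
  exact hno ⟨U, P, Z, W, S, h, hne, fun ξ s => S.frame_eq_zero hc B (hd s) ξ⟩

end EntireSol

end

section

variable {E : Type*} [NormedAddCommGroup E] [InnerProductSpace ℝ E]

namespace EntireSol
variable {p : Pot E} {K : ℝ} {U P Z W : ℝ → ℝ → E} {c : ℝ}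

theorem tendsto_energy_zero_of_exponent (S : EntireSol p K U P Z W) {c₀ η k A : ℝ} (hc₀ : 0 < c₀)
    (B : FrameBounds p c₀ c η k A U P Z W) {l : Filter ℝ}
    (hl : Tendsto (fun s => c * (c₀ * s + η * |s| + k - c * s)) l atBot) :
    Tendsto (energy p c U P) l (𝓝 0) := by
  refine squeeze_zero_norm (fun s => S.abs_energy_le hc₀ B s) ?_
  simpa using (Real.tendsto_exp_atBot.comp hl).const_mul
    ((1 + p.L) * (A * A) * (∫ ξ, Real.exp (-gap p c₀ * |ξ|)))

theorem energy_nonpos (S : EntireSol p K U P Z W) {c₀ : ℝ} (hc₀ : 0 < c₀)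
    (h : ∀ η > 0, ∃ k, SmallAhead p U c₀ η k) (hc : c < c₀) (hc' : c₀ - c ≤ gap p c₀) (s : ℝ) :
    energy p c U P s ≤ 0 := by
  have hc0 : 0 < c := by
    have : gap p c₀ ≤ c₀ / 4 := min_le_left _ _
    linarith
  obtain ⟨k, hk⟩ := h ((c₀ - c) / 2) (by linarith)
  obtain ⟨A, hA, B⟩ := S.exists_frameBounds hc₀ (c := c)
    (by rw [abs_sub_comm, abs_of_pos (by linarith)]; exact hc') (by linarith) (by linarith) hk
  refine (S.antitone_energy hc₀ hA B).ge_of_tendsto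
    (S.tendsto_energy_zero_of_exponent hc₀ B ?_) s
  have h1 : Tendsto (fun s : ℝ => c * k + (c * (c₀ - c) / 2) * s) atBot atBot :=
    tendsto_atBot_add_const_left _ _ (tendsto_id.const_mul_atBot (by nlinarith))
  refine h1.congr' ?_
  filter_upwards [eventually_le_atBot 0] with s hs
  rw [abs_of_nonpos hs]; ring

theorem energy_nonneg (S : EntireSol p K U P Z W) {c₀ : ℝ} (hc₀ : 0 < c₀)
    (h : ∀ η > 0, ∃ k, SmallAhead p U c₀ η k) (hc : c₀ < c) (hc' : c - c₀ ≤ gap p c₀) (s : ℝ) :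
    0 ≤ energy p c U P s := by
  obtain ⟨k, hk⟩ := h ((c - c₀) / 2) (by linarith)
  obtain ⟨A, hA, B⟩ := S.exists_frameBounds hc₀ (c := c)
    (by rw [abs_of_pos (by linarith)]; exact hc') (by linarith) (by linarith) hk
  refine (S.antitone_energy hc₀ hA B).le_of_tendsto
    (S.tendsto_energy_zero_of_exponent hc₀ B ?_) s
  have h1 : Tendsto (fun s : ℝ => c * k + (-(c * (c - c₀) / 2)) * s) atTop atBot :=
    tendsto_atBot_add_const_left _ _ (tendsto_id.const_mul_atTop_of_neg (by nlinarith))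
  refine h1.congr' ?_
  filter_upwards [eventually_ge_atTop 0] with s hs
  rw [abs_of_nonneg hs]; ring

/-- Energy at speed `c`, written in a frame travelling at another speed `c₀`. -/
theorem energy_eq_exp_mul (p : Pot E) (c c₀ : ℝ) (U P : ℝ → ℝ → E) (s : ℝ) :
    energy p c U P s = Real.exp (-(c * ((c - c₀) * s))) *
      ∫ ξ, Real.exp (c * ξ) * (‖P (ξ + c₀ * s) s‖ ^ 2 / 2 + p.W (U (ξ + c₀ * s) s)) := by
  rw [← integral_const_mul, ← integral_add_right_eq_self _ ((c - c₀) * s)]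
  refine integral_congr_ae (Eventually.of_forall fun ξ => ?_)
  simp only
  rw [← mul_assoc, ← Real.exp_add, show ξ + (c - c₀) * s + c₀ * s = ξ + c * s by ring]
  congr 2
  ring

theorem energy_eq_zero (S : EntireSol p K U P Z W) (hc : 0 < c)
    (h : ∀ η > 0, ∃ k, SmallAhead p U c η k) (s : ℝ) : energy p c U P s = 0 := by
  set g := gap p c with hg
  have hg0 : 0 < g := gap_pos p hc
  obtain ⟨k, hk⟩ := h g hg0
  obtain ⟨A, hA, B⟩ := S.exists_frameBounds hc (c := c) (by simpa using hg0.le) hg0.le le_rfl hk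
  have hU := (B s (fun ξ s => U (ξ + c * s) s) (by simp)).recenter hg0.le
  have hP := (B s (fun ξ s => P (ξ + c * s) s) (by simp)).recenter hg0.le
  set J : ℝ → ℝ := fun c' => ∫ ξ, Real.exp (c' * ξ) *
    (‖P (ξ + c * s) s‖ ^ 2 / 2 + p.W (U (ξ + c * s) s)) with hJ
  have hJc : energy p c U P s = J c := rfl
  have hcont : Tendsto J (𝓝 c) (𝓝 (J c)) := by
    set M := (1 + p.L) * ((A * Real.exp (c * (c * s + g * |s| + k - c * s) / 2) *
      Real.exp (g * |c * s + g * |s| + k - c * s| / 2)) *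
      (A * Real.exp (c * (c * s + g * |s| + k - c * s) / 2) *
      Real.exp (g * |c * s + g * |s| + k - c * s| / 2))) with hM
    have hcd := (S.frame c).continuous_density s
    refine tendsto_integral_filter_of_dominated_convergence
      (fun ξ => M * Real.exp (-(g / 2) * |ξ - 0|)) ?_ ?_
      ((integrable_exp_neg_mul_abs_sub (by linarith) 0).const_mul _) ?_
    · refine Eventually.of_forall fun c' => ?_
      have : (fun ξ => Real.exp (c' * ξ) * (‖P (ξ + c * s) s‖ ^ 2 / 2 + p.W (U (ξ + c * s) s))) =
          fun ξ => Real.exp ((c' - c) * ξ) * (Real.exp (c * ξ) *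
            (‖P (ξ + c * s) s‖ ^ 2 / 2 + p.W (U (ξ + c * s) s))) := by
        funext ξ
        rw [← mul_assoc, ← Real.exp_add]
        congr 2
        ring
      rw [this]
      exact ((by fun_prop : Continuous fun ξ => Real.exp ((c' - c) * ξ)).mul hcd).aestronglyMeasurable
    · filter_upwards [Metric.ball_mem_nhds c (half_pos hg0)] with c' hc'
      rw [Metric.mem_ball, Real.dist_eq] at hc'
      refine Eventually.of_forall fun ξ => ?_
      have hd := (S.frame c).density_le hU hP ξ
      have e : Real.exp (c' * ξ) * (‖P (ξ + c * s) s‖ ^ 2 / 2 + p.W (U (ξ + c * s) s)) =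
          Real.exp ((c' - c) * ξ) * (Real.exp (c * ξ) *
            (‖P (ξ + c * s) s‖ ^ 2 / 2 + p.W (U (ξ + c * s) s))) := by
        rw [← mul_assoc, ← Real.exp_add]
        congr 2
        ring
      rw [e, norm_mul, Real.norm_of_nonneg (Real.exp_pos _).le]
      refine (mul_le_mul_of_nonneg_left hd (Real.exp_pos _).le).trans ?_
      rw [← hM, mul_left_comm, ← Real.exp_add]
      have hM0 : 0 ≤ M := by have := p.L_pos; positivity
      refine mul_le_mul_of_nonneg_left (Real.exp_le_exp.2 ?_) hM0
      rw [sub_zero]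
      have := (le_abs_self ((c' - c) * ξ)).trans_eq (abs_mul _ _)
      nlinarith [abs_nonneg ξ]
    · exact Eventually.of_forall fun ξ => Continuous.tendsto' (by fun_prop) _ _ rfl
  have hJe : ∀ c', energy p c' U P s = Real.exp (-(c' * ((c' - c) * s))) * J c' := fun c' =>
    energy_eq_exp_mul p c' c U P s
  rw [hJc]
  refine le_antisymm ?_ ?_
  · refine le_of_tendsto (hcont.mono_left nhdsWithin_le_nhds : Tendsto J (𝓝[<] c) _) ?_
    filter_upwards [Ioo_mem_nhdsLT (show c - g < c by linarith)] with c' hc'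
    have := S.energy_nonpos hc h hc'.2 (by linarith [hc'.1]) s
    rw [hJe] at this
    exact (mul_nonpos_iff_pos_imp_nonpos.1 this).1 (Real.exp_pos _)
  · refine ge_of_tendsto (hcont.mono_left nhdsWithin_le_nhds : Tendsto J (𝓝[>] c) _) ?_
    filter_upwards [Ioo_mem_nhdsGT (show c < c + g by linarith)] with c' hc'
    have := S.energy_nonneg hc h hc'.1 (by linarith [hc'.2]) s
    rw [hJe] at this
    exact (mul_nonneg_iff_of_pos_left (Real.exp_pos _)).1 this

/-- A solution whose invasion point travels at the mean speed `c` is a wave. -/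
theorem isWave_of_smallAhead (S : EntireSol p K U P Z W) (hc : 0 < c)
    (h : ∀ η > 0, ∃ k, SmallAhead p U c η k) : IsWave c P W := by
  obtain ⟨k, hk⟩ := h (gap p c) (gap_pos p hc)
  obtain ⟨A, hA, B⟩ := S.exists_frameBounds hc (c := c) (by simpa using (gap_pos p hc).le)
    (gap_pos p hc).le le_rfl hk
  intro ξ s
  have h1 := S.hasDerivAt_energy hc hA B s
  rw [show energy p c U P = fun _ => 0 from funext (S.energy_eq_zero hc h)] at h1
  exact S.frame_eq_zero hc B (neg_eq_zero.1 (h1.unique (hasDerivAt_const _ _))) ξ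

end EntireSol

end

section

variable {E : Type*} [NormedAddCommGroup E] [InnerProductSpace ℝ E]

/-- A map whose images along a filter are connected and relatively compact converges, provided its
cluster points lie in a totally disconnected set. -/
theorem exists_tendsto_of_isTotallyDisconnected {α X : Type*} [TopologicalSpace X] [T2Space X]
    {l : Filter α} [l.NeBot] {γ : α → X} {Q T : Set X} (hQ : IsCompact Q) (hγ : ∀ᶠ a in l, γ a ∈ Q)
    (hconn : ∀ s ∈ l, ∃ s' ∈ l, s' ⊆ s ∧ IsPreconnected (γ '' s'))
    (hT : IsTotallyDisconnected T) (hcl : ∀ x, MapClusterPt x l γ → x ∈ T) :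
    ∃ x, Tendsto γ l (𝓝 x) := by
  set Ω : Set X := {x | MapClusterPt x l γ} with hΩ
  have hΩc : IsClosed Ω := isClosed_setOfPred_clusterPt
  have hΩQ : Ω ⊆ Q := fun x hx => hQ.isClosed.mem_of_mapClusterPt hx hγ
  have hsub : ∀ O : Set X, IsOpen O → Ω ⊆ O → ∀ᶠ a in l, γ a ∈ O := by
    intro O hO hΩO
    by_contra hne
    have hf : ∃ᶠ a in l, γ a ∈ Q \ O := by
      have := (not_eventually.1 hne).and_eventually hγ
      exact this.mono fun a ha => ⟨ha.2, ha.1⟩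
    obtain ⟨x, hx, hcx⟩ := (hQ.diff hO).exists_mapClusterPt_of_frequently hf
    exact hx.2 (hΩO hcx)
  have hpre : IsPreconnected Ω := by
    rw [isPreconnected_closed_iff]
    intro A B hA hB hAB ⟨a, haΩ, haA⟩ ⟨b, hbΩ, hbB⟩
    by_contra hne
    have hdisj : Disjoint (Ω ∩ A) (Ω ∩ B) := by
      rw [Set.disjoint_left]
      exact fun x hx hx' => hne ⟨x, hx.1, hx.2, hx'.2⟩
    obtain ⟨OA, OB, hOA, hOB, hAO, hBO, hd⟩ := SeparatedNhds.of_isCompact_isCompact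
      (hQ.of_isClosed_subset (hΩc.inter hA) (inter_subset_left.trans hΩQ))
      (hQ.of_isClosed_subset (hΩc.inter hB) (inter_subset_left.trans hΩQ)) hdisj
    obtain ⟨s, hs, hss, hsc⟩ := hconn _ (hsub (OA ∪ OB) (hOA.union hOB) fun x hx =>
      (hAB hx).imp (fun h => hAO ⟨hx, h⟩) fun h => hBO ⟨hx, h⟩)
    have fA : ∃ᶠ i in l, γ i ∈ OA := haΩ.frequently (hOA.mem_nhds (hAO ⟨haΩ, haA⟩))
    have fB : ∃ᶠ i in l, γ i ∈ OB := hbΩ.frequently (hOB.mem_nhds (hBO ⟨hbΩ, hbB⟩))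
    obtain ⟨i, hi, his⟩ := (fA.and_eventually hs).exists
    obtain ⟨j, hj, hjs⟩ := (fB.and_eventually hs).exists
    have hsub' : γ '' s ⊆ OA ∪ OB := by rintro _ ⟨k, hk, rfl⟩; exact hss hk
    rcases hsc.subset_or_subset hOA hOB hd hsub' with h | h
    · exact Set.disjoint_left.1 hd (h ⟨j, hjs, rfl⟩) hj
    · exact Set.disjoint_left.1 hd hi (h ⟨i, his, rfl⟩)
  have hss : Ω.Subsingleton := hT Ω hcl hpre
  obtain ⟨x, -, hx⟩ := hQ.exists_mapClusterPt_of_frequently hγ.frequently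
  refine ⟨x, tendsto_nhds.2 fun O hO hxO => hsub O hO fun y hy => ?_⟩
  rwa [hss hy hx]

theorem IsPreconnected.image_filter_basis_atTop {X : Type*} [TopologicalSpace X] {γ : ℝ → X} {a : ℝ}
    (hγ : ContinuousOn γ (Ici a)) :
    ∀ s ∈ (atTop : Filter ℝ), ∃ s' ∈ (atTop : Filter ℝ), s' ⊆ s ∧ IsPreconnected (γ '' s') := by
  intro s hs
  obtain ⟨b, hb⟩ := mem_atTop_sets.1 hs
  exact ⟨Ici (max a b), Ici_mem_atTop _, fun x hx => hb x ((le_max_right _ _).trans hx),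
    isPreconnected_Ici.image _ (hγ.mono (Ici_subset_Ici.2 (le_max_left _ _)))⟩

theorem IsPreconnected.image_filter_basis_atBot {X : Type*} [TopologicalSpace X] {γ : ℝ → X}
    (hγ : Continuous γ) :
    ∀ s ∈ (atBot : Filter ℝ), ∃ s' ∈ (atBot : Filter ℝ), s' ⊆ s ∧ IsPreconnected (γ '' s') := by
  intro s hs
  obtain ⟨b, hb⟩ := mem_atBot_sets.1 hs
  exact ⟨Iic b, Iic_mem_atBot _, hb, isPreconnected_Iic.image _ hγ.continuousOn⟩

/-- Profile of a wave travelling at speed `c` and invading the origin. -/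
structure Profile (p : Pot E) (c K : ℝ) (φ ψ : ℝ → E) : Prop where
  bφ : ∀ ξ, ‖φ ξ‖ ≤ p.C
  bψ : ∀ ξ, ‖ψ ξ‖ ≤ K
  dφ : ∀ ξ, HasDerivAt φ (ψ ξ) ξ
  dψ : ∀ ξ, HasDerivAt ψ (p.G (φ ξ) - c • ψ ξ) ξ
  limφ : Tendsto φ atTop (𝓝 0)
  limψ : Tendsto ψ atTop (𝓝 0)

theorem DecaysAhead.tendsto_zero {A ν : ℝ} {b : ℝ → ℝ} {X : ℝ → ℝ → E} (h : DecaysAhead A ν b X)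
    (hν : 0 < ν) (s : ℝ) : Tendsto (fun ξ => X ξ s) atTop (𝓝 0) := by
  refine squeeze_zero_norm (fun ξ => (h ξ s).2) ?_
  have h1 : Tendsto (fun ξ => -ν * (ξ - b s)) atTop atBot :=
    (tendsto_atTop_add_const_right _ (-b s) tendsto_id).const_mul_atTop_of_neg (by linarith)
  simpa using (Real.tendsto_exp_atBot.comp h1).const_mul A

namespace EntireSol
variable {p : Pot E} {K c η k : ℝ} {U P Z W : ℝ → ℝ → E}

theorem tendsto_zero (S : EntireSol p K U P Z W) (hc : 0 < c) (hη : 0 ≤ η) (hηc : η ≤ c)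
    (h : SmallAhead p U c η k) (s : ℝ) :
    Tendsto (fun ξ => U ξ s) atTop (𝓝 0) ∧ Tendsto (fun ξ => P ξ s) atTop (𝓝 0) := by
  obtain ⟨μ, hμ, hμ'⟩ : ∃ μ > 0, μ ^ 2 - (c - η) * μ ≤ p.lam := by
    refine ⟨min 1 p.lam, lt_min one_pos p.lam_pos, ?_⟩
    have h1 := min_le_left 1 p.lam
    have h2 := min_le_right 1 p.lam
    have h3 : 0 < min 1 p.lam := lt_min one_pos p.lam_pos
    nlinarith
  obtain ⟨A, -, hA⟩ := S.exists_decaysAhead h hη hηc hμ.le hμ'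
  exact ⟨(hA U (by simp)).tendsto_zero (half_pos hμ) s, (hA P (by simp)).tendsto_zero (half_pos hμ) s⟩

theorem IsWave.U_eq (h : IsWave c P W) (S : EntireSol p K U P Z W) (ξ s : ℝ) :
    U ξ s = U (ξ - c * s) 0 := by
  have hd : ∀ τ, HasDerivAt (fun τ => U (ξ - c * s + c * τ) τ) 0 τ := fun τ => by
    have := S.dframe c (ξ - c * s) τ
    rwa [h] at this
  have := is_const_of_deriv_eq_zero (fun τ => (hd τ).differentiableAt) (fun τ => (hd τ).deriv) s 0
  simpa using this

theorem IsWave.profile (h : IsWave c P W) (S : EntireSol p K U P Z W) (hc : 0 < c) (hη : 0 ≤ η)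
    (hηc : η ≤ c) (hs : SmallAhead p U c η k) :
    Profile p c K (fun ξ => U ξ 0) (fun ξ => P ξ 0) where
  bφ _ := S.bU _ _
  bψ _ := S.bP _ _
  dφ ξ := S.dU ξ 0
  dψ ξ := (S.dP ξ 0).congr_deriv (by
    have h1 := S.pde ξ 0
    have h2 := h ξ 0
    have h3 : Z ξ 0 = W ξ 0 + p.G (U ξ 0) := by rw [h1]; abel
    rw [h3, eq_neg_of_add_eq_zero_left h2]; abel)
  limφ := (S.tendsto_zero hc hη hηc hs 0).1
  limψ := (S.tendsto_zero hc hη hηc hs 0).2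

end EntireSol

namespace Profile
variable {p : Pot E} {c K : ℝ} {φ ψ : ℝ → E}

theorem zero (p : Pot E) (c : ℝ) (hK : 0 ≤ K) : Profile p c K (fun _ => 0) (fun _ => 0) where
  bφ _ := by simpa using p.C_pos.le
  bψ _ := by simpa using hK
  dφ _ := hasDerivAt_const _ _
  dψ ξ := (hasDerivAt_const ξ (0:E)).congr_deriv (by simp [p.G_zero])
  limφ := tendsto_const_nhds
  limψ := tendsto_const_nhds

theorem cφ (h : Profile p c K φ ψ) : Continuous φ :=
  continuous_iff_continuousAt.2 fun ξ => (h.dφ ξ).continuousAt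

theorem cψ (h : Profile p c K φ ψ) : Continuous ψ :=
  continuous_iff_continuousAt.2 fun ξ => (h.dψ ξ).continuousAt

theorem K_nonneg (h : Profile p c K φ ψ) : 0 ≤ K := (norm_nonneg _).trans (h.bψ 0)

/-- Profiles are determined by their value and derivative at a point. -/
theorem unique (h : Profile p c K φ ψ) {K' : ℝ} {φ' ψ' : ℝ → E} (h' : Profile p c K' φ' ψ')
    (hc : 0 ≤ c) {x : ℝ} (h1 : φ x = φ' x) (h2 : ψ x = ψ' x) (y : ℝ) : φ y = φ' y ∧ ψ y = ψ' y := by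
  set N : ℝ → ℝ := fun ξ => ⟪φ ξ - φ' ξ, φ ξ - φ' ξ⟫ + ⟪ψ ξ - ψ' ξ, ψ ξ - ψ' ξ⟫ with hN
  set N' : ℝ → ℝ := fun ξ => 2 * ⟪φ ξ - φ' ξ, ψ ξ - ψ' ξ⟫ +
    2 * ⟪ψ ξ - ψ' ξ, (p.G (φ ξ) - p.G (φ' ξ)) - c • (ψ ξ - ψ' ξ)⟫ with hN'
  have hd : ∀ ξ, HasDerivAt N (N' ξ) ξ := fun ξ => by
    have d1 := (h.dφ ξ).sub (h'.dφ ξ)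
    have d2 := (h.dψ ξ).sub (h'.dψ ξ)
    refine ((d1.inner ℝ d1).add (d2.inner ℝ d2)).congr_deriv ?_
    have e : p.G (φ ξ) - c • ψ ξ - (p.G (φ' ξ) - c • ψ' ξ) =
      (p.G (φ ξ) - p.G (φ' ξ)) - c • (ψ ξ - ψ' ξ) := by module
    simp only [hN', e, Pi.sub_apply]
    rw [real_inner_comm (φ ξ - φ' ξ) (ψ ξ - ψ' ξ), real_inner_comm (ψ ξ - ψ' ξ) ((p.G (φ ξ) - p.G (φ' ξ)) - c • (ψ ξ - ψ' ξ))]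
    ring
  set M := 1 + p.L + 2 * c with hM
  have hb : ∀ ξ, |N' ξ| ≤ M * N ξ := fun ξ => by
    have hL := p.lip _ _ (h.bφ ξ) (h'.bφ ξ)
    have i1 := abs_real_inner_le_norm (φ ξ - φ' ξ) (ψ ξ - ψ' ξ)
    have i2 := abs_real_inner_le_norm (ψ ξ - ψ' ξ)
      ((p.G (φ ξ) - p.G (φ' ξ)) - c • (ψ ξ - ψ' ξ))
    have i3 : ‖(p.G (φ ξ) - p.G (φ' ξ)) - c • (ψ ξ - ψ' ξ)‖ ≤
        p.L * ‖φ ξ - φ' ξ‖ + c * ‖ψ ξ - ψ' ξ‖ := by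
      refine (norm_sub_le _ _).trans (add_le_add hL ?_)
      rw [norm_smul, Real.norm_of_nonneg hc]
    simp only [hN, hN', real_inner_self_eq_norm_sq]
    set a := ‖φ ξ - φ' ξ‖
    set b := ‖ψ ξ - ψ' ξ‖
    have hb0 : 0 ≤ b := norm_nonneg _
    have i4 := i2.trans (mul_le_mul_of_nonneg_left i3 hb0)
    have hLp := p.L_pos
    have e1 : |2 * ⟪φ ξ - φ' ξ, ψ ξ - ψ' ξ⟫ +
        2 * ⟪ψ ξ - ψ' ξ, (p.G (φ ξ) - p.G (φ' ξ)) - c • (ψ ξ - ψ' ξ)⟫| ≤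
        2 * (a * b) + 2 * (b * (p.L * a + c * b)) := by
      refine (abs_add_le _ _).trans ?_
      rw [abs_mul, abs_mul, abs_two]
      linarith
    refine e1.trans ?_
    rw [hM]
    nlinarith [sq_nonneg (a - b), mul_nonneg hLp.le (sq_nonneg (a - b)), mul_nonneg hc (sq_nonneg a)]
  have hN0 : ∀ ξ, 0 ≤ N ξ := fun ξ => add_nonneg real_inner_self_nonneg real_inner_self_nonneg
  have hx0 : N x = 0 := by simp [hN, h1, h2]
  have hmono : Monotone fun ξ => Real.exp (M * ξ) * N ξ :=
    monotone_of_hasDerivAt_nonneg (fun ξ => (((hasDerivAt_id ξ).const_mul M).exp).mul (hd ξ))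
      fun ξ => by
        have := (abs_le.1 (hb ξ)).1
        have he := Real.exp_pos (M * ξ)
        simp only [id, Pi.zero_apply]
        nlinarith
  have hanti : Antitone fun ξ => Real.exp (-M * ξ) * N ξ :=
    antitone_of_hasDerivAt_nonpos (fun ξ => (((hasDerivAt_id ξ).const_mul (-M)).exp).mul (hd ξ))
      fun ξ => by
        have := (abs_le.1 (hb ξ)).2
        have he := Real.exp_pos (-M * ξ)
        simp only [id, Pi.zero_apply]
        nlinarith
  have hy : N y = 0 := by
    refine le_antisymm ?_ (hN0 y)
    rcases le_total y x with hxy | hxy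
    · have := hmono hxy
      simp only [hx0, mul_zero] at this
      exact (mul_nonpos_iff_pos_imp_nonpos.1 this).1 (Real.exp_pos _)
    · have := hanti hxy
      simp only [hx0, mul_zero] at this
      exact (mul_nonpos_iff_pos_imp_nonpos.1 this).1 (Real.exp_pos _)
  have hz := (add_eq_zero_iff_of_nonneg real_inner_self_nonneg real_inner_self_nonneg).1 hy
  exact ⟨sub_eq_zero.1 (inner_self_eq_zero.1 hz.1), sub_eq_zero.1 (inner_self_eq_zero.1 hz.2)⟩

/-- Monotonicity of the distance to the origin, ahead of the wave. -/
theorem inner_neg (h : Profile p c K φ ψ) (hc : 0 ≤ c) {a : ℝ} (hs : ∀ ξ, a ≤ ξ → ‖φ ξ‖ ≤ p.δ)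
    (hne : φ a ≠ 0) {ξ : ℝ} (hξ : a ≤ ξ) : ⟪φ ξ, ψ ξ⟫ < 0 := by
  by_contra hcon
  push Not at hcon
  set w : ℝ → ℝ := fun x => Real.exp (c * x) * ⟪φ x, ψ x⟫ with hw
  have hdw : ∀ x, HasDerivAt w (Real.exp (c * x) * (‖ψ x‖ ^ 2 + ⟪φ x, p.G (φ x)⟫)) x := fun x => by
    refine ((((hasDerivAt_id x).const_mul c).exp).mul ((h.dφ x).inner ℝ (h.dψ x))).congr_deriv ?_
    simp only [id]
    rw [inner_sub_right, inner_smul_right, real_inner_self_eq_norm_sq]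
    ring
  have hwm : MonotoneOn w (Ici a) := by
    refine monotoneOn_of_hasDerivWithinAt_nonneg (convex_Ici a)
      (fun x _ => (hdw x).continuousAt.continuousWithinAt)
      (fun x _ => (hdw x).hasDerivWithinAt) fun x hx => ?_
    rw [interior_Ici] at hx
    have h1 := p.coer _ (hs x hx.le)
    have h2 := p.lam_pos
    have : 0 ≤ ⟪φ x, p.G (φ x)⟫ := le_trans (by positivity) h1
    positivity
  have hq : ∀ x, HasDerivAt (fun x => ‖φ x‖ ^ 2) (2 * ⟪φ x, ψ x⟫) x := fun x => (h.dφ x).norm_sq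
  have hqm : MonotoneOn (fun x => ‖φ x‖ ^ 2) (Ici ξ) := by
    refine monotoneOn_of_hasDerivWithinAt_nonneg (convex_Ici ξ)
      (fun x _ => (hq x).continuousAt.continuousWithinAt)
      (fun x _ => (hq x).hasDerivWithinAt) fun x hx => ?_
    rw [interior_Ici] at hx
    have h1 : w ξ ≤ w x := hwm hξ (hξ.trans hx.le) hx.le
    have h2 : 0 ≤ w ξ := mul_nonneg (Real.exp_pos _).le hcon
    have h3 := (mul_nonneg_iff_of_pos_left (Real.exp_pos _)).1 (h2.trans h1)
    linarith
  have hz : ∀ x, ξ ≤ x → φ x = 0 := fun x hx => by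
    have hl : Tendsto (fun x => ‖φ x‖ ^ 2) atTop (𝓝 0) := by simpa using h.limφ.norm.pow 2
    have : ‖φ x‖ ^ 2 ≤ 0 := ge_of_tendsto hl (by
      filter_upwards [eventually_ge_atTop x] with y hy
      exact hqm hx (hx.trans hy) hy)
    have : ‖φ x‖ = 0 := pow_eq_zero_iff two_ne_zero |>.1 (le_antisymm this (by positivity))
    exact norm_eq_zero.1 this
  have hψ : ψ (ξ + 1) = 0 := (h.dφ (ξ + 1)).unique
    ((hasDerivAt_const (ξ + 1) (0:E)).congr_of_eventuallyEq (by
      filter_upwards [Ioi_mem_nhds (lt_add_one ξ)] with x hx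
      exact hz x (le_of_lt hx)))
  exact hne (h.unique (zero p c h.K_nonneg) hc (x := ξ + 1) (hz _ (by linarith)) hψ a).1

theorem norm_lt (h : Profile p c K φ ψ) (hc : 0 ≤ c) {a : ℝ} (hs : ∀ ξ, a ≤ ξ → ‖φ ξ‖ ≤ p.δ)
    (hne : φ a ≠ 0) {ξ : ℝ} (hξ : a < ξ) : ‖φ ξ‖ < ‖φ a‖ := by
  have hq : ∀ x, HasDerivAt (fun x => ‖φ x‖ ^ 2) (2 * ⟪φ x, ψ x⟫) x := fun x => (h.dφ x).norm_sq
  have : StrictAntiOn (fun x => ‖φ x‖ ^ 2) (Ici a) := by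
    refine strictAntiOn_of_hasDerivWithinAt_neg (convex_Ici a)
      (fun x _ => (hq x).continuousAt.continuousWithinAt)
      (fun x _ => (hq x).hasDerivWithinAt) fun x hx => ?_
    rw [interior_Ici] at hx
    have := h.inner_neg hc hs hne hx.le
    linarith
  exact lt_of_pow_lt_pow_left₀ 2 (norm_nonneg _) (this self_mem_Ici hξ.le hξ)

end Profile

end

section

variable {E : Type*} [NormedAddCommGroup E] [InnerProductSpace ℝ E]

theorem Pot.G_le (p : Pot E) {x : E} (hx : ‖x‖ ≤ p.C) : ‖p.G x‖ ≤ p.L * ‖x‖ := by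
  simpa [p.G_zero] using p.lip x 0 hx (by simpa using p.C_pos.le)

theorem Pot.tendsto_G (p : Pot E) {α : Type*} {l : Filter α} {f : α → E} {x : E}
    (hf : ∀ᶠ a in l, ‖f a‖ ≤ p.C) (hx : ‖x‖ ≤ p.C) (h : Tendsto f l (𝓝 x)) :
    Tendsto (fun a => p.G (f a)) l (𝓝 (p.G x)) := by
  rw [tendsto_iff_norm_sub_tendsto_zero] at h ⊢
  refine squeeze_zero' (Eventually.of_forall fun _ => norm_nonneg _)
    (hf.mono fun a ha => p.lip _ _ ha hx) ?_
  simpa using h.const_mul p.L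

namespace Profile
variable {p : Pot E} {c K : ℝ} {φ ψ : ℝ → E}

/-- Hamiltonian energy of a profile. -/
def hamiltonian (p : Pot E) (φ ψ : ℝ → E) (ξ : ℝ) : ℝ := ‖ψ ξ‖ ^ 2 / 2 - p.W (φ ξ)

theorem hasDerivAt_hamiltonian (h : Profile p c K φ ψ) (ξ : ℝ) :
    HasDerivAt (hamiltonian p φ ψ) (-(c * ‖ψ ξ‖ ^ 2)) ξ := by
  have h1 := (p.grad (φ ξ)).comp_hasDerivAt ξ (h.dφ ξ)
  refine (((h.dψ ξ).norm_sq.div_const 2).sub h1).congr_deriv ?_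
  rw [innerSL_apply_apply, inner_sub_right, inner_smul_right, real_inner_self_eq_norm_sq,
    real_inner_comm (p.G (φ ξ))]
  ring

theorem antitone_hamiltonian (h : Profile p c K φ ψ) (hc : 0 ≤ c) :
    Antitone (hamiltonian p φ ψ) :=
  antitone_of_hasDerivAt_nonpos h.hasDerivAt_hamiltonian fun ξ => by
    simp only [Pi.zero_apply]
    nlinarith [mul_nonneg hc (sq_nonneg ‖ψ ξ‖)]

theorem tendsto_hamiltonian_atTop (h : Profile p c K φ ψ) :
    Tendsto (hamiltonian p φ ψ) atTop (𝓝 0) := by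
  unfold hamiltonian
  have := ((h.limψ.norm.pow 2).div_const 2).sub ((p.continuous_W.tendsto 0).comp h.limφ)
  simpa [p.W_zero] using this

theorem hamiltonian_nonneg (h : Profile p c K φ ψ) (hc : 0 ≤ c) (ξ : ℝ) :
    0 ≤ hamiltonian p φ ψ ξ := (h.antitone_hamiltonian hc).le_of_tendsto h.tendsto_hamiltonian_atTop ξ

theorem hamiltonian_le (h : Profile p c K φ ψ) (ξ : ℝ) :
    hamiltonian p φ ψ ξ ≤ K ^ 2 / 2 + p.L * p.C ^ 2 := by
  have h1 := (abs_le.1 (p.abs_W_le (h.bφ ξ))).1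
  have h2 := h.bψ ξ
  have h3 := h.bφ ξ
  have h4 : ‖ψ ξ‖ ^ 2 ≤ K ^ 2 := by gcongr
  have h5 : p.L * ‖φ ξ‖ ^ 2 ≤ p.L * p.C ^ 2 := by have := p.L_pos; gcongr
  unfold hamiltonian
  nlinarith

theorem exists_tendsto_hamiltonian_atBot (h : Profile p c K φ ψ) (hc : 0 ≤ c) :
    ∃ e, Tendsto (hamiltonian p φ ψ) atBot (𝓝 e) :=
  ⟨_, tendsto_atBot_ciSup (h.antitone_hamiltonian hc) ⟨_, by
    rintro _ ⟨s, rfl⟩; exact h.hamiltonian_le s⟩⟩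

theorem norm_dψ_le (h : Profile p c K φ ψ) (hc : 0 ≤ c) (ξ : ℝ) :
    ‖p.G (φ ξ) - c • ψ ξ‖ ≤ p.L * p.C + c * K := by
  refine (norm_sub_le _ _).trans (add_le_add ?_ ?_)
  · exact (p.G_le (h.bφ ξ)).trans (mul_le_mul_of_nonneg_left (h.bφ ξ) p.L_pos.le)
  · rw [norm_smul, Real.norm_of_nonneg hc]
    exact mul_le_mul_of_nonneg_left (h.bψ ξ) hc

theorem tendsto_ψ_atBot (h : Profile p c K φ ψ) (hc : 0 < c) : Tendsto ψ atBot (𝓝 0) := by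
  obtain ⟨e, he⟩ := h.exists_tendsto_hamiltonian_atBot hc.le
  set M := p.L * p.C + c * K with hM
  have hM0 : 0 ≤ M := (norm_nonneg _).trans (h.norm_dψ_le hc.le 0)
  by_contra hcon
  rw [Metric.tendsto_nhds] at hcon
  push Not at hcon
  obtain ⟨ε, hε, hf⟩ := hcon
  set ρ := ε / 2 / (M + 1) with hρ
  have hρ0 : 0 < ρ := by positivity
  have hMρ : M * ρ ≤ ε / 2 := by
    have : (M + 1) * ρ = ε / 2 := by rw [hρ]; field_simp
    linarith
  have hdrop : ∃ᶠ ξ in atBot, hamiltonian p φ ψ (ξ + ρ) ≤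
      hamiltonian p φ ψ ξ - c * (ε / 2) ^ 2 * ρ := by
    refine hf.mono fun ξ hξ => ?_
    rw [dist_zero_right] at hξ
    obtain ⟨σ, hσ, he⟩ := exists_hasDerivAt_eq_slope (hamiltonian p φ ψ)
      (fun s => -(c * ‖ψ s‖ ^ 2)) (lt_add_of_pos_right ξ hρ0)
      (fun x _ => (h.hasDerivAt_hamiltonian x).continuousAt.continuousWithinAt)
      fun x _ => h.hasDerivAt_hamiltonian x
    have hl := norm_sub_le_of_deriv_le (x := ξ) (y := σ) (fun z _ => h.dψ z)
      (fun z _ => h.norm_dψ_le hc.le z)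
    have h1 : |σ - ξ| ≤ ρ := by rw [abs_of_nonneg] <;> linarith [hσ.1, hσ.2]
    have h2 : M * |σ - ξ| ≤ M * ρ := by gcongr
    have h3 := norm_sub_norm_le (ψ ξ) (ψ σ)
    rw [norm_sub_rev] at h3
    have h4 : ε / 2 ≤ ‖ψ σ‖ := by linarith
    have h5 : (ε / 2) ^ 2 ≤ ‖ψ σ‖ ^ 2 := by gcongr
    rw [add_sub_cancel_left, eq_div_iff hρ0.ne'] at he
    nlinarith [mul_le_mul_of_nonneg_left h5 (mul_pos hc hρ0).le]
  have hc1 := he.comp (tendsto_atBot_add_const_right _ ρ tendsto_id)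
  have hc2 := he.sub_const (c * (ε / 2) ^ 2 * ρ)
  have hlt : e - c * (ε / 2) ^ 2 * ρ < e := by
    have : 0 < c * (ε / 2) ^ 2 * ρ := by positivity
    linarith
  obtain ⟨ξ, h1, h2⟩ := (hdrop.and_eventually (hc2.eventually_lt hc1 hlt)).exists
  exact absurd h1 (not_le.2 h2)

theorem G_eq_zero_of_tendsto (h : Profile p c K φ ψ) (hc : 0 < c) {F : Filter ℝ} [F.NeBot]
    (hF : F ≤ atBot) {x : E} (hx : Tendsto φ F (𝓝 x)) : ‖x‖ ≤ p.C ∧ p.G x = 0 := by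
  have hxC : ‖x‖ ≤ p.C := le_of_tendsto hx.norm (Eventually.of_forall h.bφ)
  refine ⟨hxC, ?_⟩
  have hK := h.K_nonneg
  have hL := p.L_pos
  have hψ := h.tendsto_ψ_atBot hc
  set M := p.L * p.C + c * K with hM
  have hM0 : 0 ≤ M := (norm_nonneg _).trans (h.norm_dψ_le hc.le 0)
  set N := p.L * K + c * M with hN
  have hN0 : 0 ≤ N := by positivity
  have hG := p.tendsto_G (Eventually.of_forall h.bφ) hxC hx
  have hle : ∀ a > 0, ‖p.G x‖ ≤ N * a := by
    intro a ha
    have ht : ∀ ξ, ‖ψ (ξ + a) - ψ ξ - (ξ + a - ξ) • (p.G (φ ξ) - c • ψ ξ)‖ ≤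
        N * a * |ξ + a - ξ| := fun ξ => by
      refine norm_taylor_le (fun z _ => h.dψ z) fun z hz => ?_
      have hza : |z - ξ| ≤ a := by
        have := abs_sub_le_of_mem_uIcc hz
        rwa [add_sub_cancel_left, abs_of_pos ha] at this
      have e : p.G (φ z) - c • ψ z - (p.G (φ ξ) - c • ψ ξ) =
        (p.G (φ z) - p.G (φ ξ)) - c • (ψ z - ψ ξ) := by module
      have h1 := norm_sub_le_of_deriv_le (x := ξ) (y := z) (fun z _ => h.dφ z) (fun z _ => h.bψ z)
      have h2 := norm_sub_le_of_deriv_le (x := ξ) (y := z) (fun z _ => h.dψ z)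
        (fun z _ => h.norm_dψ_le hc.le z)
      rw [e]
      calc _ ≤ p.L * (K * a) + c * (M * a) := by
            refine (norm_sub_le _ _).trans (add_le_add ?_ ?_)
            · refine (p.lip _ _ (h.bφ z) (h.bφ ξ)).trans (mul_le_mul_of_nonneg_left ?_ hL.le)
              exact h1.trans (mul_le_mul_of_nonneg_left hza hK)
            · rw [norm_smul, Real.norm_of_nonneg hc.le]
              exact mul_le_mul_of_nonneg_left (h2.trans (mul_le_mul_of_nonneg_left hza hM0)) hc.le
        _ = _ := by rw [hN]; ring
    have hlim : Tendsto (fun ξ => ‖ψ (ξ + a) - ψ ξ - a • (p.G (φ ξ) - c • ψ ξ)‖) F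
        (𝓝 ‖(0:E) - 0 - a • (p.G x - c • (0:E))‖) :=
      ((((hψ.comp (tendsto_atBot_add_const_right _ a tendsto_id)).mono_left hF).sub
        (hψ.mono_left hF)).sub ((hG.sub ((hψ.mono_left hF).const_smul c)).const_smul a)).norm
    have hb : ‖(0:E) - 0 - a • (p.G x - c • (0:E))‖ ≤ N * a * a :=
      le_of_tendsto hlim (Eventually.of_forall fun ξ => by
        have := ht ξ
        rwa [add_sub_cancel_left, abs_of_pos ha] at this)
    simp only [sub_zero, zero_sub, smul_zero, norm_neg, norm_smul, Real.norm_of_nonneg ha.le] at hb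
    nlinarith
  have h0 : ‖p.G x‖ ≤ 0 := by
    have ht : Tendsto (fun a : ℝ => N * a) (𝓝[>] 0) (𝓝 0) := by
      have : Continuous fun a : ℝ => N * a := by fun_prop
      simpa using (this.tendsto 0).mono_left (nhdsWithin_le_nhds (s := Ioi 0))
    exact ge_of_tendsto ht (by filter_upwards [self_mem_nhdsWithin] with a ha using hle a ha)
  exact norm_le_zero_iff.1 h0

/-- Behind the wave, the profile converges to a critical point of lower potential. -/
theorem exists_limit_atBot [ProperSpace E] (h : Profile p c K φ ψ) (hc : 0 < c)
    (hcrit : IsTotallyDisconnected {x | ‖x‖ ≤ p.C ∧ p.G x = 0}) (hne : ∃ ξ, φ ξ ≠ 0) :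
    ∃ x, p.G x = 0 ∧ Tendsto φ atBot (𝓝 x) ∧ p.W x < 0 := by
  obtain ⟨x, hx⟩ := exists_tendsto_of_isTotallyDisconnected
    (isCompact_closedBall (0:E) p.C) (Eventually.of_forall fun ξ => by simpa using h.bφ ξ)
    (IsPreconnected.image_filter_basis_atBot h.cφ) hcrit fun x hx => by
      obtain ⟨F, hF, hFx⟩ := mapClusterPt_iff_ultrafilter.1 hx
      exact h.G_eq_zero_of_tendsto hc hF hFx
  refine ⟨x, (h.G_eq_zero_of_tendsto hc le_rfl hx).2, hx, ?_⟩
  have hl : Tendsto (hamiltonian p φ ψ) atBot (𝓝 (-p.W x)) := by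
    unfold hamiltonian
    have := (((h.tendsto_ψ_atBot hc).norm.pow 2).div_const 2).sub
      ((p.continuous_W.tendsto x).comp hx)
    simpa using this
  have hanti := h.antitone_hamiltonian hc.le
  by_contra hW
  push Not at hW
  have hz : ∀ ξ, hamiltonian p φ ψ ξ = 0 := fun ξ => le_antisymm
    ((hanti.ge_of_tendsto hl ξ).trans (by linarith)) (h.hamiltonian_nonneg hc.le ξ)
  have hψ : ∀ ξ, ψ ξ = 0 := fun ξ => by
    have h1 := h.hasDerivAt_hamiltonian ξ
    rw [show hamiltonian p φ ψ = fun _ => 0 from funext hz] at h1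
    have h2 := h1.unique (hasDerivAt_const _ _)
    have h3 : ‖ψ ξ‖ ^ 2 = 0 := by
      rcases mul_eq_zero.1 (neg_eq_zero.1 h2) with h | h
      · exact absurd h hc.ne'
      · exact h
    exact norm_eq_zero.1 (pow_eq_zero_iff two_ne_zero |>.1 h3)
  obtain ⟨ξ, hξ⟩ := hne
  have hconst : ∀ y, φ y = φ ξ := fun y => is_const_of_deriv_eq_zero
    (fun τ => (h.dφ τ).differentiableAt) (fun τ => by rw [(h.dφ τ).deriv, hψ]) y ξ
  have : Tendsto φ atTop (𝓝 (φ ξ)) := by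
    rw [show φ = fun _ => φ ξ from funext hconst]; exact tendsto_const_nhds
  exact hξ (tendsto_nhds_unique this h.limφ)

end Profile

end

section

variable {E : Type*} [NormedAddCommGroup E] [InnerProductSpace ℝ E]

theorem RadSol.tendsto_comp {p : Pot E} {κ K : ℝ} {u ur urr ut : ℝ → ℝ → E}
    (S : RadSol p κ K u ur urr ut) {ι : Type*} {F : Filter ι} {r t : ι → ℝ}
    (hr : Tendsto r F atTop) (ht : Tendsto t F atTop) {a b : ι → ℝ} {a₀ b₀ : ℝ} {x : E}
    (ha : Tendsto a F (𝓝 a₀)) (hb : Tendsto b F (𝓝 b₀))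
    (h : Tendsto (fun i => u (r i + a₀) (t i + b₀)) F (𝓝 x)) :
    Tendsto (fun i => u (r i + a i) (t i + b i)) F (𝓝 x) := by
  have hK := S.K_nonneg
  have key : Tendsto (fun i => u (r i + a i) (t i + b i) - u (r i + a₀) (t i + b₀)) F (𝓝 0) := by
    have h1 : Tendsto (fun i => K * |a i - a₀| + K * |b i - b₀|) F (𝓝 0) := by
      have := ((ha.sub_const a₀).abs.const_mul K).add ((hb.sub_const b₀).abs.const_mul K)
      simpa using this
    refine squeeze_zero_norm' ?_ h1
    filter_upwards [(tendsto_atTop_add_right_of_le' _ (a₀ - 1) hr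
        ((ha.eventually (lt_mem_nhds (sub_one_lt a₀))).mono fun _ h => h.le)).eventually_ge_atTop 0,
      (tendsto_atTop_add_const_right _ a₀ hr).eventually_ge_atTop 0,
      (tendsto_atTop_add_right_of_le' _ (b₀ - 1) ht
        ((hb.eventually (lt_mem_nhds (sub_one_lt b₀))).mono fun _ h => h.le)).eventually_gt_atTop 0,
      (tendsto_atTop_add_const_right _ b₀ ht).eventually_gt_atTop 0] with i i1 i2 i3 i4
    have j1 := S.lip_r i2 i1 i3
    have j2 := S.lip_t i2 i4 i3
    rw [add_sub_add_left_eq_sub] at j1 j2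
    have e : u (r i + a i) (t i + b i) - u (r i + a₀) (t i + b₀) =
      (u (r i + a i) (t i + b i) - u (r i + a₀) (t i + b i)) +
        (u (r i + a₀) (t i + b i) - u (r i + a₀) (t i + b₀)) := by abel
    rw [e]
    exact (norm_add_le _ _).trans (add_le_add j1 j2)
  simpa using key.add h

/-- A radial solution together with its escape point `f` and a point `R` around which the solution
is close to the origin. -/
structure Escape (p : Pot E) (κ K : ℝ) (u ur urr ut : ℝ → ℝ → E) (R f : ℝ → ℝ) (T₀ b c : ℝ) :
    Prop where
  sol : RadSol p κ K u ur urr ut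
  T_ge : 2 ≤ T₀
  f_nonneg : ∀ t, 0 ≤ f t
  f_le : ∀ t, T₀ ≤ t → f t ≤ R t
  small : ∀ t, T₀ ≤ t → ∀ r, f t < r → r ≤ R t → ‖u r t‖ < p.δ
  attained : ∀ t, T₀ ≤ t → 0 < f t → ‖u (f t) t‖ = p.δ
  b_nonneg : 0 ≤ b
  R_lip : ∀ t, T₀ ≤ t → ∀ t', T₀ ≤ t' → |R t' - R t| ≤ b * |t' - t|
  R_top : Tendsto R atTop atTop
  nearR : ∀ L ε, 0 < ε → ∀ᶠ t in atTop, ∀ r, |r - R t| ≤ L → ‖u r t‖ ≤ ε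
  c_pos : 0 < c
  freq : ∀ a < c, ∃ᶠ t in atTop, a * t < f t
  even : ∀ a > c, ∀ᶠ t in atTop, f t < a * t

namespace Escape
variable {p : Pot E} {κ K : ℝ} {u ur urr ut : ℝ → ℝ → E} {R f : ℝ → ℝ} {T₀ b c : ℝ}

theorem tendsto_gap (S : Escape p κ K u ur urr ut R f T₀ b c) :
    Tendsto (fun t => R t - f t) atTop atTop := by
  refine tendsto_atTop.2 fun L => ?_
  filter_upwards [S.nearR |L| (p.δ / 2) (half_pos p.δ_pos), eventually_ge_atTop T₀,
    S.R_top.eventually_ge_atTop L] with t h1 h2 h3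
  rcases (S.f_nonneg t).eq_or_lt with h0 | h0
  · linarith
  · by_contra hlt
    push Not at hlt
    have h4 := S.f_le t h2
    have h5 := h1 (f t) (by
      rw [abs_sub_comm, abs_of_nonneg (by linarith)]
      exact hlt.le.trans (le_abs_self L))
    have := p.δ_pos
    linarith [S.attained t h2 h0]

/-- Upper semicontinuity of the escape point. -/
theorem usc (S : Escape p κ K u ur urr ut R f T₀ b c) {t₀ : ℝ} (ht₀ : T₀ < t₀) {ε : ℝ}
    (hε : 0 < ε) (hε' : f t₀ + ε ≤ R t₀) : ∀ᶠ t in 𝓝 t₀, f t < f t₀ + ε := by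
  have hT := S.T_ge
  have hK := S.sol.K_nonneg
  have hb := S.b_nonneg
  have hf := S.f_nonneg t₀
  have hcont : ContinuousOn (fun r => ‖u r t₀‖) (Icc (f t₀ + ε) (R t₀)) := fun r _ =>
    (S.sol.dr r t₀ (by linarith)).continuousAt.continuousWithinAt.norm
  obtain ⟨r₀, hr₀, hmax⟩ := isCompact_Icc.exists_isMaxOn ⟨_, left_mem_Icc.2 hε'⟩ hcont
  have hlt : ‖u r₀ t₀‖ < p.δ := S.small t₀ ht₀.le r₀ (by linarith [hr₀.1]) hr₀.2
  have hcl : ∀ᶠ t in 𝓝 t₀, ‖u r₀ t₀‖ + K * |t - t₀| + K * (b * |t - t₀|) < p.δ := by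
    have : Continuous fun t => ‖u r₀ t₀‖ + K * |t - t₀| + K * (b * |t - t₀|) := by fun_prop
    exact (this.tendsto t₀).eventually (gt_mem_nhds (by simpa using hlt))
  filter_upwards [hcl, Ioi_mem_nhds ht₀] with t h1 (h2 : T₀ < t)
  by_contra hge
  push Not at hge
  have ha := S.attained t h2.le (by linarith)
  have hfR := S.f_le t h2.le
  have hRR := (le_abs_self _).trans (S.R_lip t₀ ht₀.le t h2.le)
  set r' := min (f t) (R t₀) with hr'
  have hr'm : r' ∈ Icc (f t₀ + ε) (R t₀) := ⟨le_min hge hε', min_le_right _ _⟩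
  have hd : |f t - r'| ≤ b * |t - t₀| := by
    rw [abs_of_nonneg (by linarith [min_le_left (f t) (R t₀)])]
    rcases min_choice (f t) (R t₀) with h | h <;> rw [hr', h]
    · simp; positivity
    · linarith
  have e1 := S.sol.lip_r (r := r') (r' := f t) (t := t) (by linarith [hr'm.1]) (S.f_nonneg t)
    (by linarith)
  have e2 := S.sol.lip_t (r := r') (t := t₀) (t' := t) (by linarith [hr'm.1]) (by linarith)
    (by linarith)
  have e3 : ‖u r' t₀‖ ≤ ‖u r₀ t₀‖ := hmax hr'm
  have e4 := norm_le_norm_add_norm_sub' (u (f t) t) (u r' t)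
  have e5 := norm_le_norm_add_norm_sub' (u r' t) (u r' t₀)
  have e6 : K * |f t - r'| ≤ K * (b * |t - t₀|) := mul_le_mul_of_nonneg_left hd hK
  linarith

/-- The escape point cannot jump ahead. -/
theorem bounded_advance [ProperSpace E] (S : Escape p κ K u ur urr ut R f T₀ b c) (s : ℝ) :
    ∃ k T : ℝ, T₀ ≤ T ∧ ∀ t, T ≤ t → ∀ τ ∈ Icc 0 s, f (t + τ) ≤ f t + k := by
  by_contra hcon
  push Not at hcon
  have hT := S.T_ge
  choose t ht τ hτ hf using fun n : ℕ => hcon n (max T₀ n) (le_max_left _ _)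
  have ht0 : ∀ n, T₀ ≤ t n := fun n => (le_max_left _ _).trans (ht n)
  have htn : ∀ n : ℕ, (n:ℝ) ≤ t n := fun n => (le_max_right _ _).trans (ht n)
  set F : Ultrafilter ℕ := hyperfilter ℕ with hF
  have hFle : (F : Filter ℕ) ≤ atTop := Nat.hyperfilter_le_atTop
  have htop : Tendsto t F atTop :=
    (tendsto_atTop_mono htn tendsto_natCast_atTop_atTop).mono_left hFle
  have hrn : ∀ n : ℕ, (n:ℝ) ≤ f (t n + τ n) := fun n => by linarith [hf n, S.f_nonneg (t n)]
  have hrtop : Tendsto (fun n => f (t n + τ n)) F atTop :=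
    (tendsto_atTop_mono hrn tendsto_natCast_atTop_atTop).mono_left hFle
  obtain ⟨U, P, Z, W, SU, hU, hP, hW⟩ := (S.sol.asymp hrtop htop).exists_limit
  obtain ⟨τ₀, hτ₀, hτF⟩ := isCompact_Icc.ultrafilter_le_nhds' (F.map τ) (by
    rw [Ultrafilter.mem_map]; exact Eventually.of_forall hτ)
  have hτF : Tendsto τ F (𝓝 τ₀) := hτF
  have hδ := p.δ_pos
  have hgap : Tendsto (fun n => R (t n + τ n) - f (t n + τ n)) F atTop :=
    S.tendsto_gap.comp (tendsto_atTop_mono (fun n => le_add_of_nonneg_right (hτ n).1) htop)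
  have hUle : ∀ ξ, ‖U ξ 0‖ ≤ p.δ := by
    intro ξ
    refine le_of_tendsto (hU ξ 0).norm ?_
    filter_upwards [hgap.eventually_ge_atTop (b * s + ξ),
      (tendsto_natCast_atTop_atTop (R := ℝ)).mono_left hFle |>.eventually_ge_atTop (-ξ)]
      with n h1 h2
    rw [add_zero]
    refine (S.small _ (ht0 n) _ (by linarith [hf n]) ?_).le
    have h3 := (le_abs_self _).trans (S.R_lip (t n) (ht0 n) (t n + τ n)
      ((ht0 n).trans (by linarith [(hτ n).1])))
    rw [add_sub_cancel_left, abs_of_nonneg (hτ n).1] at h3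
    have := mul_le_mul_of_nonneg_left (hτ n).2 S.b_nonneg
    linarith
  have hat : ∀ n : ℕ, 1 ≤ n → ‖u (f (t n + τ n)) (t n + τ n)‖ = p.δ := fun n hn =>
    S.attained _ (by linarith [ht0 n, (hτ n).1]) (by
      have : (1:ℝ) ≤ n := by exact_mod_cast hn
      linarith [hrn n])
  have hlim := S.sol.tendsto_comp hrtop htop (tendsto_const_nhds (x := (0:ℝ))) hτF (hU 0 τ₀)
  simp only [add_zero] at hlim
  have hUδ : ‖U 0 τ₀‖ = p.δ := tendsto_nhds_unique hlim.norm (tendsto_const_nhds.congr' (by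
    filter_upwards [hFle (eventually_ge_atTop 1)] with n hn using (hat n hn).symm))
  have hτ0 : τ₀ = 0 := by
    by_contra hne
    have hpos : 0 < τ₀ := lt_of_le_of_ne hτ₀.1 (Ne.symm hne)
    have h1 := SU.decay_line hτ₀.1 hUle 0
    rw [hUδ, sub_zero] at h1
    have h2 : Real.exp (-p.lam * τ₀) < 1 := by
      rw [Real.exp_lt_one_iff]; nlinarith [p.lam_pos]
    nlinarith [pow_pos hδ 2]
  rw [hτ0] at hUδ hlim hτF
  have hmax : ⟪U 0 0, W 0 0⟫ < 0 := by
    have d1 : ∀ x, HasDerivAt (fun x => ‖U x 0‖ ^ 2) (2 * ⟪U x 0, P x 0⟫) x := fun x =>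
      (SU.dU x 0).norm_sq
    have d2 := ((SU.dU 0 0).inner ℝ (SU.dP 0 0)).const_mul 2
    have hm : IsLocalMax (fun x => ‖U x 0‖ ^ 2) 0 := Eventually.of_forall fun x => by
      simp only [hUδ]
      have := hUle x
      gcongr
    have h2 := (IsLocalMax.deriv_two_conditions (Eventually.of_forall d1) d2 hm).2
    have h3 := p.coer (U 0 0) hUδ.le
    rw [hUδ] at h3
    rw [SU.pde, inner_sub_right]
    rw [real_inner_self_eq_norm_sq] at h2
    nlinarith [sq_nonneg ‖P 0 0‖, p.lam_pos, pow_pos hδ 2, mul_pos p.lam_pos (pow_pos hδ 2)]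
  have hreg : 0 ≤ RadSol.regConst p κ K := S.sol.K_nonneg.trans S.sol.K_le
  set M := 2 * p.C * RadSol.regConst p κ K with hM
  have hineq : ∀ᶠ n in (F : Filter ℕ), -(M * Real.sqrt (τ n)) ≤
      ⟪u (f (t n + τ n)) (t n + τ n) + u (f (t n + τ n)) (t n), ut (f (t n + τ n)) (t n)⟫ := by
    filter_upwards [hrtop.eventually_ge_atTop 3, hFle (eventually_ge_atTop 1),
      hgap.eventually_ge_atTop (b * s)] with n h3 h1 h4
    have hτn := (hτ n).1
    set r := f (t n + τ n) with hr
    have hsm : ‖u r (t n)‖ < p.δ := by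
      refine S.small _ (ht0 n) _ (by linarith [hf n, (Nat.cast_nonneg n : (0:ℝ) ≤ n)]) ?_
      have h3 := (le_abs_self _).trans (S.R_lip (t n) (ht0 n) (t n + τ n)
        ((ht0 n).trans (by linarith [(hτ n).1])))
      rw [add_sub_cancel_left, abs_of_nonneg (hτ n).1] at h3
      have := mul_le_mul_of_nonneg_left (hτ n).2 S.b_nonneg
      linarith
    have hτpos : 0 < τ n := by
      rcases hτn.eq_or_lt with h | h
      · have := hat n h1
        rw [← hr, ← h, add_zero] at this
        linarith
      · exact h
    have hty := S.sol.taylor_t (r := r) (t := t n) (t' := t n + τ n) h3 (by linarith [ht0 n])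
      (by linarith [ht0 n])
    rw [add_sub_cancel_left, abs_of_pos hτpos] at hty
    set e := u r (t n + τ n) - u r (t n) - τ n • ut r (t n) with he
    set w := u r (t n + τ n) + u r (t n) with hw
    have hwn : ‖w‖ ≤ 2 * p.C := (norm_add_le _ _).trans (by
      linarith [S.sol.bu r (t n + τ n) (by linarith) (by linarith [ht0 n]),
        S.sol.bu r (t n) (by linarith) (by linarith [ht0 n])])
    have hdiff : ⟪w, u r (t n + τ n) - u r (t n)⟫ = p.δ ^ 2 - ‖u r (t n)‖ ^ 2 := by
      rw [hw, inner_sub_right, inner_add_left, inner_add_left, real_inner_self_eq_norm_sq,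
        real_inner_self_eq_norm_sq, real_inner_comm (u r (t n + τ n)), hat n h1]
      ring
    have hpos : 0 ≤ ⟪w, u r (t n + τ n) - u r (t n)⟫ := by
      rw [hdiff]; nlinarith [norm_nonneg (u r (t n))]
    have hsplit : ⟪w, u r (t n + τ n) - u r (t n)⟫ = τ n * ⟪w, ut r (t n)⟫ + ⟪w, e⟫ := by
      rw [← inner_smul_right, ← inner_add_right, he]
      congr 1
      abel
    have hwe : ⟪w, e⟫ ≤ 2 * p.C * (RadSol.regConst p κ K * Real.sqrt (τ n) * τ n) :=
      (real_inner_le_norm _ _).trans (mul_le_mul hwn hty (norm_nonneg _) (by linarith [p.C_pos]))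
    have : 0 ≤ τ n * (⟪w, ut r (t n)⟫ + M * Real.sqrt (τ n)) := by
      rw [hM]; nlinarith
    have := (mul_nonneg_iff_of_pos_left hτpos).1 this
    linarith
  have hL1 : Tendsto (fun n => -(M * Real.sqrt (τ n))) F (𝓝 0) := by
    have := ((Real.continuous_sqrt.tendsto 0).comp hτF).const_mul M |>.neg
    simpa using this
  have hu0 := hU 0 0
  have hw0 := hW 0 0
  simp only [add_zero] at hu0 hw0
  have hL2 := (hlim.add hu0).inner (𝕜 := ℝ) hw0
  have := le_of_tendsto_of_tendsto hL1 hL2 hineq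
  rw [inner_add_left] at this
  linarith

end Escape

end

section

variable {E : Type*} [NormedAddCommGroup E] [InnerProductSpace ℝ E]

/-- There is a nonzero front profile of speed `c` invading the origin. -/
def HasFront (p : Pot E) (c : ℝ) : Prop :=
  ∃ (K : ℝ) (φ ψ : ℝ → E), Profile p c K φ ψ ∧ ∃ ξ, φ ξ ≠ 0

namespace Escape
variable {p : Pot E} {κ K : ℝ} {u ur urr ut : ℝ → ℝ → E} {R f : ℝ → ℝ} {T₀ b c : ℝ}

/-- Limits of the solution around the escape point. -/
theorem exists_limit [ProperSpace E] (S : Escape p κ K u ur urr ut R f T₀ b c) {ι : Type*}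
    {F : Ultrafilter ι} {t : ι → ℝ} (ht : Tendsto t F atTop)
    (hf : Tendsto (fun i => f (t i)) F atTop) :
    ∃ U P Z W : ℝ → ℝ → E, EntireSol p (RadSol.regConst p κ K) U P Z W ∧
      (∀ ξ s, Tendsto (fun i => u (f (t i) + ξ) (t i + s)) F (𝓝 (U ξ s))) ∧
      (∀ ξ s, Tendsto (fun i => ur (f (t i) + ξ) (t i + s)) F (𝓝 (P ξ s))) ∧
      (∀ ξ s, Tendsto (fun i => ut (f (t i) + ξ) (t i + s)) F (𝓝 (W ξ s))) ∧
      ‖U 0 0‖ = p.δ ∧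
      ∀ s B ξ, (∀ᶠ i in (F : Filter ι), f (t i + s) ≤ f (t i) + B) → B ≤ ξ → ‖U ξ s‖ ≤ p.δ := by
  obtain ⟨U, P, Z, W, SU, hU, hP, hW⟩ := (S.sol.asymp hf ht).exists_limit
  refine ⟨U, P, Z, W, SU, hU, hP, hW, ?_, ?_⟩
  · have h0 := (hU 0 0).norm
    simp only [add_zero] at h0
    refine tendsto_nhds_unique h0 (tendsto_const_nhds.congr' ?_)
    filter_upwards [ht.eventually_ge_atTop T₀, hf.eventually_gt_atTop 0] with i h1 h2
    exact (S.attained _ h1 h2).symm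
  · intro s B ξ hB hξ
    have key : ∀ ξ, B < ξ → ‖U ξ s‖ ≤ p.δ := by
      intro ξ hξ
      refine le_of_tendsto (hU ξ s).norm ?_
      filter_upwards [hB, (S.tendsto_gap.comp ht).eventually_ge_atTop (b * |s| + ξ),
        ht.eventually_ge_atTop T₀, (tendsto_atTop_add_const_right _ s ht).eventually_ge_atTop T₀]
        with i h1 h2 h3 h4
      refine (S.small _ h4 _ (by linarith) ?_).le
      have h5 := (neg_abs_le _).trans' (neg_le_neg (S.R_lip _ h3 _ h4))
      rw [add_sub_cancel_left] at h5
      simp only [Function.comp] at h2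
      linarith
    have hcont : Continuous fun ξ => ‖U ξ s‖ :=
      (SU.continuous_U.comp (continuous_id.prodMk continuous_const)).norm
    have hcl : closure (Ioi B) ⊆ {ξ | ‖U ξ s‖ ≤ p.δ} :=
      closure_minimal (fun ξ hξ => key ξ hξ) (isClosed_le hcont continuous_const)
    rw [closure_Ioi] at hcl
    exact hcl hξ

/-- When no front travels at speed `a`, the escape point does not stay behind one of its positions
in the frame of speed `a` over long time intervals. -/
theorem exists_ahead [ProperSpace E] (S : Escape p κ K u ur urr ut R f T₀ b c) {a : ℝ} (ha : 0 < a)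
    (hN : ¬ HasFront p a) : ∃ s T : ℝ, 0 < s ∧ ∀ t₀, T ≤ t₀ →
      ∃ t, |t - t₀| ≤ s ∧ f t₀ - a * t₀ < f t - a * t := by
  by_contra hcon
  push Not at hcon
  choose t ht hloc using fun n : ℕ => hcon (n + 1) n (by positivity)
  set F : Ultrafilter ℕ := hyperfilter ℕ with hF
  have hFle : (F : Filter ℕ) ≤ atTop := Nat.hyperfilter_le_atTop
  have hn : Tendsto (fun n : ℕ => (n:ℝ)) F atTop := tendsto_natCast_atTop_atTop.mono_left hFle
  have htop : Tendsto t F atTop := tendsto_atTop_mono ht hn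
  have hftop : Tendsto (fun n => f (t n)) F atTop := by
    refine tendsto_atTop_mono (fun n => ?_) (hn.const_mul_atTop ha)
    have h1 := hloc n (t n - n) (by
      rw [sub_sub_cancel_left, abs_neg, abs_of_nonneg (Nat.cast_nonneg n)]; linarith)
    have := S.f_nonneg (t n - n)
    linarith
  obtain ⟨U, P, Z, W, SU, -, -, -, h0, hle⟩ := S.exists_limit htop hftop
  have hsm : EntireSol.SmallAhead p U a 0 0 := by
    intro s ξ hξ
    refine hle s (a * s) ξ ?_ (by linarith)
    filter_upwards [hn.eventually_ge_atTop |s|] with n h1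
    have := hloc n (t n + s) (by rw [add_sub_cancel_left]; linarith)
    linarith
  have hδ := p.δ_pos
  obtain ⟨U', P', Z', W', SU', hs', ⟨ξ, s, hne⟩, hw⟩ := SU.exists_isWave ha hsm
    ⟨0, 0, fun h => by rw [h, norm_zero] at h0; linarith⟩
  rw [hw.U_eq SU'] at hne
  exact hN ⟨_, _, _, hw.profile SU' ha le_rfl ha.le hs', _, hne⟩

theorem exists_isMax [ProperSpace E] (S : Escape p κ K u ur urr ut R f T₀ b c) {a : ℝ} (ha : 0 < a)
    (hN : ¬ HasFront p a) : ∃ s T : ℝ, 0 < s ∧ ∀ x y, T ≤ x → x ≤ y → ∃ z ∈ Icc x y,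
      (z ≤ x + s ∨ y - s ≤ z) ∧ ∀ t ∈ Icc x y, f t - a * t ≤ f z - a * z := by
  obtain ⟨s, T, hs, h⟩ := S.exists_ahead ha hN
  obtain ⟨T', hT'⟩ := eventually_atTop.1 (S.tendsto_gap.eventually_ge_atTop 1)
  refine ⟨s, max T (max T' (T₀ + 1)), hs, fun x y hx hxy => ?_⟩
  have hx1 := (le_max_left _ _).trans hx
  have hx2 := ((le_max_left _ _).trans (le_max_right _ _)).trans hx
  have hx3 := ((le_max_right _ _).trans (le_max_right _ _)).trans hx
  have husc : UpperSemicontinuousOn (fun t => f t - a * t) (Icc x y) := by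
    intro t₀ ht₀ v hv
    refine eventually_nhdsWithin_of_eventually_nhds ?_
    set ε := min 1 ((v - (f t₀ - a * t₀)) / 2) with hε
    have hεpos : 0 < ε := lt_min one_pos (by linarith)
    have hε2 : ε ≤ (v - (f t₀ - a * t₀)) / 2 := min_le_right _ _
    have hgap := hT' t₀ (hx2.trans ht₀.1)
    have hu := S.usc (t₀ := t₀) (by linarith [ht₀.1]) hεpos
      (by linarith [min_le_left 1 ((v - (f t₀ - a * t₀)) / 2)])
    have hc : ∀ᶠ t in 𝓝 t₀, a * t₀ - ε < a * t :=
      (continuous_const_mul a).continuousAt.eventually (lt_mem_nhds (by linarith))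
    filter_upwards [hu, hc] with t h1 h2
    linarith
  obtain ⟨z, hz, hmax⟩ := husc.exists_isMaxOn ⟨x, left_mem_Icc.2 hxy⟩ isCompact_Icc
  refine ⟨z, hz, ?_, fun t ht => hmax ht⟩
  by_contra hcon
  push Not at hcon
  obtain ⟨t, ht, hlt⟩ := h z (by linarith [hz.1])
  rw [abs_le] at ht
  have : f t - a * t ≤ f z - a * z := hmax ⟨by linarith, by linarith⟩
  linarith

theorem bounded_advance_frame [ProperSpace E] (S : Escape p κ K u ur urr ut R f T₀ b c) {a : ℝ}
    (ha : 0 ≤ a) (s : ℝ) : ∃ k T : ℝ, ∀ t, T ≤ t → ∀ z ∈ Icc t (t + s),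
      f z - a * z ≤ f t - a * t + k := by
  obtain ⟨k, T, -, h⟩ := S.bounded_advance s
  refine ⟨k, T, fun t ht z hz => ?_⟩
  have h1 := h t ht (z - t) ⟨by linarith [hz.1], by linarith [hz.2]⟩
  rw [add_sub_cancel] at h1
  nlinarith [hz.1]

theorem lower_speed [ProperSpace E] (S : Escape p κ K u ur urr ut R f T₀ b c) {a : ℝ} (ha : 0 < a)
    (hac : a < c) (hN : ¬ HasFront p a) :
    ∃ k T : ℝ, ∀ x y, T ≤ x → x ≤ y → f x - a * x ≤ f y - a * y + k := by
  obtain ⟨s, T₁, hs, hmax⟩ := S.exists_isMax ha hN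
  obtain ⟨k, T₂, hk⟩ := S.bounded_advance_frame ha.le s
  set T := max T₁ T₂ with hT
  have alt : ∀ x y, T ≤ x → x ≤ y → f x - a * x ≤ f T - a * T + k ∨
      f x - a * x ≤ f y - a * y + k := by
    intro x y hx hxy
    obtain ⟨z, hz, hloc, hm⟩ := hmax T (y + s) (le_max_left _ _) (by linarith)
    have h1 := hm x ⟨hx, by linarith⟩
    rcases hloc with h | h
    · left; linarith [hk T (le_max_right _ _) z ⟨hz.1, h⟩]
    · right; linarith [hk y ((le_max_right _ _).trans (hx.trans hxy)) z ⟨by linarith, hz.2⟩]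
  set a' := (a + c) / 2 with ha'
  have hev : ∀ᶠ t in atTop, max 0 (f T - a * T + k) ≤ (a' - a) * t :=
    (tendsto_id.const_mul_atTop (by linarith : 0 < a' - a)).eventually_ge_atTop _
  obtain ⟨x₀, hx1, hx2, hx3⟩ :=
    ((S.freq a' (by linarith)).and_eventually (hev.and (eventually_ge_atTop T))).exists
  have hx0 : f T - a * T + k < f x₀ - a * x₀ := by
    linarith [le_max_right 0 (f T - a * T + k)]
  refine ⟨k, x₀, fun x y hx hxy => ?_⟩
  rcases alt x y (hx3.trans hx) hxy with h | h
  · rcases alt x₀ y hx3 (hx.trans hxy) with h' | h' <;> linarith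
  · exact h

theorem upper_speed [ProperSpace E] (S : Escape p κ K u ur urr ut R f T₀ b c) {a : ℝ}
    (hac : c < a) (hN : ¬ HasFront p a) :
    ∃ k T : ℝ, ∀ x y, T ≤ x → x ≤ y → f y - a * y ≤ f x - a * x + k := by
  have ha := S.c_pos.trans hac
  obtain ⟨s, T₁, hs, hmax⟩ := S.exists_isMax ha hN
  obtain ⟨k, T₂, hk⟩ := S.bounded_advance_frame ha.le s
  refine ⟨k, max T₁ T₂, fun x y hx hxy => ?_⟩
  set a' := (a + c) / 2 with ha'
  have hev : ∀ᶠ t in atTop, -(f y - a * y) ≤ (a - a') * t :=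
    (tendsto_id.const_mul_atTop (by linarith : 0 < a - a')).eventually_ge_atTop _
  obtain ⟨N, hN⟩ := eventually_atTop.1 ((S.even a' (by linarith)).and hev)
  obtain ⟨z, hz, hloc, hm⟩ := hmax x (max y (N + s)) ((le_max_left _ _).trans hx)
    (hxy.trans (le_max_left _ _))
  have h1 := hm y ⟨hxy, le_max_left _ _⟩
  rcases hloc with h | h
  · linarith [hk x ((le_max_right _ _).trans hx) z ⟨hz.1, h⟩]
  · have h2 := hN z (by linarith [le_max_right y (N + s)])
    nlinarith [h2.1, h2.2]

/-- The escape point tends to infinity, when fronts have rare speeds. -/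
theorem tendsto_atTop [ProperSpace E] (S : Escape p κ K u ur urr ut R f T₀ b c)
    (hd : ∀ x y, 0 < x → x < y → ∃ a ∈ Ioo x y, ¬ HasFront p a) : Tendsto f atTop atTop := by
  obtain ⟨a, ha, hN⟩ := hd (c / 2) c (half_pos S.c_pos) (half_lt_self S.c_pos)
  have ha0 : 0 < a := (half_pos S.c_pos).trans ha.1
  obtain ⟨k, T, h⟩ := S.lower_speed ha0 ha.2 hN
  refine tendsto_atTop_mono' _ ?_
    (tendsto_atTop_add_const_right _ (f T - a * T - k) (tendsto_id.const_mul_atTop ha0))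
  filter_upwards [eventually_ge_atTop T] with t ht
  have := h T t le_rfl ht
  simp only [id]
  linarith

/-- Around the escape point the solution approaches travelling fronts. -/
theorem exists_limit_wave [ProperSpace E] (S : Escape p κ K u ur urr ut R f T₀ b c)
    (hd : ∀ x y, 0 < x → x < y → ∃ a ∈ Ioo x y, ¬ HasFront p a) {ι : Type*}
    {F : Ultrafilter ι} {t : ι → ℝ} (ht : Tendsto t F atTop) :
    ∃ φ ψ : ℝ → E, Profile p c (RadSol.regConst p κ K) φ ψ ∧ ‖φ 0‖ = p.δ ∧
      (∀ ξ, 0 ≤ ξ → ‖φ ξ‖ ≤ p.δ) ∧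
      (∀ ξ, Tendsto (fun i => u (f (t i) + ξ) (t i)) F (𝓝 (φ ξ))) ∧
      (∀ ξ, Tendsto (fun i => ur (f (t i) + ξ) (t i)) F (𝓝 (ψ ξ))) ∧
      (∀ ξ, Tendsto (fun i => ut (f (t i) + ξ) (t i)) F (𝓝 (-(c • ψ ξ)))) := by
  obtain ⟨U, P, Z, W, SU, hU, hP, hW, h0, hle⟩ := S.exists_limit ht ((S.tendsto_atTop hd).comp ht)
  have hc := S.c_pos
  have hsm : ∀ η, 0 < η → ∃ k, EntireSol.SmallAhead p U c η k := by
    intro η hη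
    obtain ⟨a₁, ha₁, hN₁⟩ := hd (max (c / 2) (c - η)) c (lt_max_of_lt_left (half_pos hc))
      (max_lt (half_lt_self hc) (by linarith))
    obtain ⟨a₂, ha₂, hN₂⟩ := hd c (c + η) hc (by linarith)
    have hb1 := (le_max_left _ _).trans_lt ha₁.1
    have hb2 := (le_max_right _ _).trans_lt ha₁.1
    obtain ⟨k₁, T₁, h1⟩ := S.lower_speed (by linarith) ha₁.2 hN₁
    obtain ⟨k₂, T₂, h2⟩ := S.upper_speed ha₂.1 hN₂
    refine ⟨max k₁ k₂, fun s ξ hξ => hle s _ ξ ?_ hξ⟩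
    filter_upwards [ht.eventually_ge_atTop T₂,
      (tendsto_atTop_add_const_right _ s ht).eventually_ge_atTop T₁] with i i1 i2
    rcases le_total 0 s with hs | hs
    · have := h2 (t i) (t i + s) i1 (by linarith)
      rw [abs_of_nonneg hs]
      nlinarith [le_max_right k₁ k₂, ha₂.2]
    · have := h1 (t i + s) (t i) i2 (by linarith)
      rw [abs_of_nonpos hs]
      nlinarith [le_max_left k₁ k₂]
  have hw := SU.isWave_of_smallAhead hc hsm
  obtain ⟨k, hk⟩ := hsm c hc
  have hU0 := fun ξ => hU ξ 0
  have hP0 := fun ξ => hP ξ 0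
  have hW0 := fun ξ => hW ξ 0
  simp only [add_zero] at hU0 hP0 hW0
  refine ⟨_, _, hw.profile SU hc hc.le le_rfl hk, h0, fun ξ hξ => hle 0 0 ξ (by simp) hξ, hU0, hP0,
    fun ξ => ?_⟩
  rw [← eq_neg_of_add_eq_zero_left (hw ξ 0)]
  exact hW0 ξ

end Escape

end

section

variable {E : Type*} [NormedAddCommGroup E] [InnerProductSpace ℝ E]

namespace RadSol
variable {p : Pot E} {κ K : ℝ} {u ur urr ut : ℝ → ℝ → E}

theorem ur_lip_r (S : RadSol p κ K u ur urr ut) {r r' t : ℝ} (hr : 0 ≤ r) (hr' : 0 ≤ r')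
    (ht : 0 < t) : ‖ur r' t - ur r t‖ ≤ K * |r' - r| :=
  norm_sub_le_of_deriv_le (f := fun x => ur x t) (fun z _ => S.drr z t ht) fun z hz =>
    S.burr z t (le_of_mem_uIcc_of_le hz hr hr') ht

theorem continuousAt_u (S : RadSol p κ K u ur urr ut) {q : ℝ × ℝ} (hr : 3 < q.1) (ht : 2 < q.2) :
    ContinuousAt (fun q : ℝ × ℝ => u q.1 q.2) q :=
  S.continuousOn.continuousAt (prod_mem_nhds (Ici_mem_nhds (by linarith))
    (Ioi_mem_nhds (by linarith)))

theorem eventually_region {q : ℝ × ℝ} (hr : 3 < q.1) (ht : 2 < q.2) :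
    ∀ᶠ v : ℝ × ℝ in 𝓝 q, 3 < v.1 ∧ 2 < v.2 :=
  prod_mem_nhds (Ioi_mem_nhds hr) (Ioi_mem_nhds ht)

theorem continuousAt_ur (S : RadSol p κ K u ur urr ut) {q : ℝ × ℝ} (hr : 3 < q.1) (ht : 2 < q.2) :
    ContinuousAt (fun q : ℝ × ℝ => ur q.1 q.2) q := by
  rw [ContinuousAt, tendsto_iff_norm_sub_tendsto_zero]
  have hg : Tendsto (fun v : ℝ × ℝ => lipConst p κ K * |v.2 - q.2| + K * |v.1 - q.1|) (𝓝 q)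
      (𝓝 0) := by
    have : Continuous fun v : ℝ × ℝ => lipConst p κ K * |v.2 - q.2| + K * |v.1 - q.1| := by
      fun_prop
    simpa using this.tendsto q
  refine squeeze_zero' (Eventually.of_forall fun _ => norm_nonneg _) ?_ hg
  filter_upwards [eventually_region hr ht] with v hv
  have h1 := S.ur_lip_t (r := v.1) (t := q.2) (t' := v.2) hv.1.le ht.le hv.2.le
  have h2 := S.ur_lip_r (r := q.1) (r' := v.1) (t := q.2) (by linarith) (by linarith [hv.1])
    (by linarith)
  rw [← sub_add_sub_cancel _ (ur v.1 q.2)]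
  exact (norm_add_le _ _).trans (add_le_add h1 h2)

theorem continuousAt_ut (S : RadSol p κ K u ur urr ut) {q : ℝ × ℝ} (hr : 3 < q.1) (ht : 2 < q.2) :
    ContinuousAt (fun q : ℝ × ℝ => ut q.1 q.2) q := by
  rw [ContinuousAt, tendsto_iff_norm_sub_tendsto_zero]
  have hg : Tendsto (fun v : ℝ × ℝ => ((5 + κ) * lipConst p κ K) * Real.sqrt |v.2 - q.2| +
      lipConst p κ K * |v.1 - q.1|) (𝓝 q) (𝓝 0) := by
    have : Continuous fun v : ℝ × ℝ => ((5 + κ) * lipConst p κ K) * Real.sqrt |v.2 - q.2| +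
      lipConst p κ K * |v.1 - q.1| := by fun_prop
    simpa using this.tendsto q
  refine squeeze_zero' (Eventually.of_forall fun _ => norm_nonneg _) ?_ hg
  filter_upwards [eventually_region hr ht] with v hv
  have h1 := S.ut_holder_t (r := v.1) (t := q.2) (t' := v.2) hv.1.le ht.le hv.2.le
  have h2 := S.ut_lip_r (r := q.1) (r' := v.1) (t := q.2) hr.le hv.1.le ht.le
  rw [← sub_add_sub_cancel _ (ut v.1 q.2)]
  exact (norm_add_le _ _).trans (add_le_add h1 h2)

/-- Implicit differentiation of a continuous curve along which the norm is constant. -/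
theorem hasDerivAt_level (S : RadSol p κ K u ur urr ut) {g : ℝ → ℝ} {t₀ : ℝ} (hr : 3 < g t₀)
    (ht : 2 < t₀) (hg : ContinuousAt g t₀)
    (hl : ∀ᶠ t in 𝓝 t₀, ‖u (g t) t‖ ^ 2 = ‖u (g t₀) t₀‖ ^ 2)
    (hne : ⟪u (g t₀) t₀, ur (g t₀) t₀⟫ ≠ 0) :
    HasDerivAt g (-(⟪u (g t₀) t₀, ut (g t₀) t₀⟫ / ⟪u (g t₀) t₀, ur (g t₀) t₀⟫)) t₀ := by
  set Q : ℝ → ℝ → ℝ := fun t r => ‖u r t‖ ^ 2 with hQ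
  set Q₁ : ℝ → ℝ → ℝ →L[ℝ] ℝ := fun t r =>
    ContinuousLinearMap.toSpanSingleton ℝ (2 * ⟪u r t, ut r t⟫) with hQ₁
  set Q₂ : ℝ → ℝ → ℝ →L[ℝ] ℝ := fun t r =>
    ContinuousLinearMap.toSpanSingleton ℝ (2 * ⟪u r t, ur r t⟫) with hQ₂
  have hev : ∀ᶠ v : ℝ × ℝ in 𝓝 (t₀, g t₀), 2 < v.1 ∧ 3 < v.2 :=
    prod_mem_nhds (Ioi_mem_nhds ht) (Ioi_mem_nhds hr)
  have hsw : ContinuousAt (fun v : ℝ × ℝ => (v.2, v.1)) (t₀, g t₀) :=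
    (continuous_snd.prodMk continuous_fst).continuousAt
  have cu : ContinuousAt (fun v : ℝ × ℝ => u v.2 v.1) (t₀, g t₀) :=
    ContinuousAt.comp (g := fun q : ℝ × ℝ => u q.1 q.2) (f := fun v : ℝ × ℝ => (v.2, v.1))
      (S.continuousAt_u (q := (g t₀, t₀)) hr ht) hsw
  have cur : ContinuousAt (fun v : ℝ × ℝ => ur v.2 v.1) (t₀, g t₀) :=
    ContinuousAt.comp (g := fun q : ℝ × ℝ => ur q.1 q.2) (f := fun v : ℝ × ℝ => (v.2, v.1))
      (S.continuousAt_ur (q := (g t₀, t₀)) hr ht) hsw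
  have cut : ContinuousAt (fun v : ℝ × ℝ => ut v.2 v.1) (t₀, g t₀) :=
    ContinuousAt.comp (g := fun q : ℝ × ℝ => ut q.1 q.2) (f := fun v : ℝ × ℝ => (v.2, v.1))
      (S.continuousAt_ut (q := (g t₀, t₀)) hr ht) hsw
  have hspan : Continuous fun x : ℝ => ContinuousLinearMap.toSpanSingleton ℝ x :=
    (ContinuousLinearMap.toSpanSingletonCLE (𝕜 := ℝ) (E := ℝ)).continuous
  have hstrict : HasStrictFDerivAt (Function.uncurry Q)
      ((Q₁ t₀ (g t₀)).coprod (Q₂ t₀ (g t₀))) (t₀, g t₀) := by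
    refine hasStrictFDerivAt_uncurry_coprod (u := (t₀, g t₀)) (f := Q) (f₁ := Q₁) (f₂ := Q₂) ?_ ?_ ?_ ?_
    · filter_upwards [hev] with v hv
      exact ((S.dt v.2 v.1 (by linarith [hv.1])).norm_sq).hasFDerivAt
    · filter_upwards [hev] with v hv
      exact ((S.dr v.2 v.1 (by linarith [hv.1])).norm_sq).hasFDerivAt
    · exact hspan.continuousAt.comp (f := fun v : ℝ × ℝ => 2 * ⟪u v.2 v.1, ut v.2 v.1⟫)
        ((cu.inner (𝕜 := ℝ) cut).const_mul 2)
    · exact hspan.continuousAt.comp (f := fun v : ℝ × ℝ => 2 * ⟪u v.2 v.1, ur v.2 v.1⟫)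
        ((cu.inner (𝕜 := ℝ) cur).const_mul 2)
  have hinv : (((Q₁ t₀ (g t₀)).coprod (Q₂ t₀ (g t₀))) ∘L .inr ℝ ℝ ℝ).IsInvertible := by
    refine ⟨ContinuousLinearEquiv.unitsEquivAut ℝ (Units.mk0 _ (mul_ne_zero two_ne_zero hne)), ?_⟩
    ext
    simp [hQ₂]
  have hψ := (hstrict.hasStrictFDerivAt_implicitFunctionOfProdDomain hinv).hasFDerivAt.hasDerivAt
  have hgψ : hstrict.implicitFunctionOfProdDomain hinv =ᶠ[𝓝 t₀] g := by
    have h1 := (continuousAt_id.prodMk hg).eventually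
      (hstrict.eventually_apply_eq_iff_implicitFunctionOfProdDomain hinv)
    filter_upwards [h1, hl] with t h1 h2
    exact h1.1 h2
  have hd := hψ.congr_of_eventuallyEq hgψ.symm
  have hcomp := hstrict.hasFDerivAt.comp_hasDerivAt t₀ ((hasDerivAt_id t₀).prodMk hd)
  have hzero : HasDerivAt (Function.uncurry Q ∘ fun t => (id t, g t)) 0 t₀ :=
    (hasDerivAt_const t₀ (‖u (g t₀) t₀‖ ^ 2)).congr_of_eventuallyEq hl
  have heq := hcomp.unique hzero
  simp only [hQ₁, hQ₂, ContinuousLinearMap.coprod_apply,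
    ContinuousLinearMap.toSpanSingleton_apply, smul_eq_mul] at heq
  refine hd.congr_deriv ?_
  rw [← neg_div, eq_div_iff hne]
  linarith

end RadSol

namespace Escape
variable {p : Pot E} {κ K : ℝ} {u ur urr ut : ℝ → ℝ → E} {R f : ℝ → ℝ} {T₀ b c : ℝ}

theorem continuousAt (S : Escape p κ K u ur urr ut R f T₀ b c) {t₀ : ℝ} (ht₀ : T₀ < t₀)
    (hgap : f t₀ < R t₀) (hf : 0 < f t₀) (htr : ⟪u (f t₀) t₀, ur (f t₀) t₀⟫ < 0) :
    ContinuousAt f t₀ := by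
  have hT := S.T_ge
  have hR : ContinuousAt R t₀ := by
    rw [ContinuousAt, tendsto_iff_norm_sub_tendsto_zero]
    have hg : Tendsto (fun t => b * |t - t₀|) (𝓝 t₀) (𝓝 0) := by
      have : Continuous fun t => b * |t - t₀| := by fun_prop
      simpa using this.tendsto t₀
    refine squeeze_zero' (Eventually.of_forall fun _ => norm_nonneg _) ?_ hg
    filter_upwards [Ioi_mem_nhds ht₀] with t ht
    exact S.R_lip _ ht₀.le _ (le_of_lt ht)
  refine tendsto_order.2 ⟨fun v hv => ?_, fun v hv => ?_⟩
  · have hd := ((S.sol.dr (f t₀) t₀ (by linarith)).norm_sq).tendsto_slope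
    have hneg := (hd.eventually (gt_mem_nhds (by linarith : 2 * ⟪u (f t₀) t₀, ur (f t₀) t₀⟫ < 0)))
    obtain ⟨y, hy1, hy2, hy3⟩ := ((hneg.filter_mono (nhdsLT_le_nhdsNE _)).and
      (Ioo_mem_nhdsLT hv)).exists
    rw [slope_def_field, div_neg_iff] at hy1
    have hy : p.δ < ‖u y t₀‖ := by
      rcases hy1 with h | h
      · have := S.attained t₀ ht₀.le hf
        rw [this] at h
        exact lt_of_pow_lt_pow_left₀ 2 (norm_nonneg _) (by linarith [h.1])
      · linarith [h.2]
    have hc := (S.sol.dt y t₀ (by linarith)).continuousAt.norm.eventually (lt_mem_nhds hy)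
    filter_upwards [hc, Ioi_mem_nhds ht₀, hR.eventually (lt_mem_nhds (hy3.trans hgap))]
      with t h1 h2 h3
    by_contra hle
    exact h1.not_gt (S.small t (le_of_lt h2) y (by linarith) h3.le)
  · set ε := min (v - f t₀) (R t₀ - f t₀) with hε
    have h1 := S.usc ht₀ (ε := ε) (lt_min (by linarith) (by linarith))
      (by linarith [min_le_right (v - f t₀) (R t₀ - f t₀)])
    filter_upwards [h1] with t ht
    linarith [min_le_left (v - f t₀) (R t₀ - f t₀)]

variable [ProperSpace E]

theorem eventually_transversal (S : Escape p κ K u ur urr ut R f T₀ b c)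
    (hd : ∀ x y, 0 < x → x < y → ∃ a ∈ Ioo x y, ¬ HasFront p a) :
    ∀ᶠ t in atTop, ⟪u (f t) t, ur (f t) t⟫ < 0 := by
  refine mem_iff_ultrafilter.2 fun F hF => ?_
  obtain ⟨φ, ψ, hφ, h0, hle, hu, hur, -⟩ := S.exists_limit_wave hd (t := id) (tendsto_id'.2 hF)
  have hδ := p.δ_pos
  have hne : φ 0 ≠ 0 := fun h => by rw [h, norm_zero] at h0; linarith
  have hu := hu 0
  have hur := hur 0
  simp only [add_zero, id] at hu hur
  exact (hu.inner (𝕜 := ℝ) hur).eventually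
    (gt_mem_nhds (hφ.inner_neg S.c_pos.le hle hne le_rfl))

/-- The derivative of the escape point. -/
theorem eventually_hasDerivAt (S : Escape p κ K u ur urr ut R f T₀ b c)
    (hd : ∀ x y, 0 < x → x < y → ∃ a ∈ Ioo x y, ¬ HasFront p a) :
    ∀ᶠ t in atTop, HasDerivAt f (-(⟪u (f t) t, ut (f t) t⟫ / ⟪u (f t) t, ur (f t) t⟫)) t ∧
      ContinuousAt (fun t => -(⟪u (f t) t, ut (f t) t⟫ / ⟪u (f t) t, ur (f t) t⟫)) t ∧
      ContinuousAt (fun t => (u (f t) t, ur (f t) t)) t := by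
  have hT := S.T_ge
  filter_upwards [S.eventually_transversal hd, eventually_gt_atTop T₀,
    S.tendsto_gap.eventually_gt_atTop 0, (S.tendsto_atTop hd).eventually_gt_atTop 3]
    with t h1 h2 h3 h4
  have hc := S.continuousAt h2 (by linarith) (by linarith) h1
  have hpair : ContinuousAt (fun t => (f t, t)) t := hc.prodMk continuousAt_id
  have cu := (S.sol.continuousAt_u (q := (f t, t)) h4 (by linarith)).comp
    (f := fun t => (f t, t)) hpair
  have cur := (S.sol.continuousAt_ur (q := (f t, t)) h4 (by linarith)).comp
    (f := fun t => (f t, t)) hpair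
  have cut := (S.sol.continuousAt_ut (q := (f t, t)) h4 (by linarith)).comp
    (f := fun t => (f t, t)) hpair
  refine ⟨S.sol.hasDerivAt_level h4 (by linarith) hc ?_ h1.ne, ?_, cu.prodMk cur⟩
  · filter_upwards [Ioi_mem_nhds h2, hc.eventually (lt_mem_nhds h4)] with t' h2' h4'
    rw [S.attained _ (le_of_lt h2') (by linarith), S.attained _ h2.le (by linarith)]
  · exact ((cu.inner (𝕜 := ℝ) cut).div (cu.inner (𝕜 := ℝ) cur) h1.ne).neg

theorem tendsto_deriv (S : Escape p κ K u ur urr ut R f T₀ b c)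
    (hd : ∀ x y, 0 < x → x < y → ∃ a ∈ Ioo x y, ¬ HasFront p a) :
    Tendsto (deriv f) atTop (𝓝 c) := by
  have hder : (fun t => -(⟪u (f t) t, ut (f t) t⟫ / ⟪u (f t) t, ur (f t) t⟫)) =ᶠ[atTop] deriv f :=
    (S.eventually_hasDerivAt hd).mono fun t ht => ht.1.deriv.symm
  refine Tendsto.congr' hder ((tendsto_iff_ultrafilter _ _ _).2 fun F hF => ?_)
  obtain ⟨φ, ψ, hφ, h0, hle, hu, hur, hut⟩ := S.exists_limit_wave hd (t := id) (tendsto_id'.2 hF)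
  have hδ := p.δ_pos
  have hne : φ 0 ≠ 0 := fun h => by rw [h, norm_zero] at h0; linarith
  have hneg := (hφ.inner_neg S.c_pos.le hle hne le_rfl).ne
  have hu := hu 0
  have hur := hur 0
  have hut := hut 0
  simp only [add_zero, id] at hu hur hut
  have := ((hu.inner (𝕜 := ℝ) hut).div (hu.inner (𝕜 := ℝ) hur) hneg).neg
  rw [inner_neg_right, inner_smul_right, neg_div, neg_neg, mul_div_cancel_right₀ _ hneg] at this
  exact this

theorem eventually_contDiffAt (S : Escape p κ K u ur urr ut R f T₀ b c)
    (hd : ∀ x y, 0 < x → x < y → ∃ a ∈ Ioo x y, ¬ HasFront p a) :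
    ∀ᶠ t in atTop, ContDiffAt ℝ 1 f t := by
  obtain ⟨T, hT⟩ := eventually_atTop.1 (S.eventually_hasDerivAt hd)
  filter_upwards [eventually_gt_atTop T] with t ht
  have hon : ContDiffOn ℝ 1 f (Ioi T) := by
    refine contDiffOn_one_iff_derivWithin (uniqueDiffOn_Ioi T) |>.2 ⟨fun x hx =>
      (hT x (le_of_lt hx)).1.differentiableAt.differentiableWithinAt, fun x hx => ?_⟩
    refine ((hT x (le_of_lt hx)).2.1.continuousWithinAt).congr_of_mem (fun y hy => ?_) hx
    rw [derivWithin_of_isOpen isOpen_Ioi hy, (hT y (le_of_lt hy)).1.deriv]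
  exact hon.contDiffAt (Ioi_mem_nhds ht)

/-- Convergence towards a single front profile around the escape point. -/
theorem exists_profile (S : Escape p κ K u ur urr ut R f T₀ b c)
    (hd : ∀ x y, 0 < x → x < y → ∃ a ∈ Ioo x y, ¬ HasFront p a) {X : Set (E × E)}
    (hX : IsTotallyDisconnected X)
    (hmem : ∀ φ ψ, Profile p c (RadSol.regConst p κ K) φ ψ → ‖φ 0‖ = p.δ →
      (∀ ξ, 0 < ξ → ‖φ ξ‖ < p.δ) → (φ 0, ψ 0) ∈ X) :
    ∃ φ ψ : ℝ → E, Profile p c (RadSol.regConst p κ K) φ ψ ∧ ‖φ 0‖ = p.δ ∧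
      (∀ ξ, 0 < ξ → ‖φ ξ‖ < p.δ) ∧
      (∀ ξ, Tendsto (fun t => u (f t + ξ) t) atTop (𝓝 (φ ξ))) ∧
      (∀ ξ, Tendsto (fun t => ur (f t + ξ) t) atTop (𝓝 (ψ ξ))) := by
  have hδ := p.δ_pos
  have hlt : ∀ {φ ψ : ℝ → E}, Profile p c (RadSol.regConst p κ K) φ ψ → ‖φ 0‖ = p.δ →
      (∀ ξ, 0 ≤ ξ → ‖φ ξ‖ ≤ p.δ) → ∀ ξ, 0 < ξ → ‖φ ξ‖ < p.δ := by
    intro φ ψ hφ h0 hle ξ hξ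
    have := hφ.norm_lt S.c_pos.le hle (fun h => by rw [h, norm_zero] at h0; linarith) hξ
    rwa [h0] at this
  obtain ⟨T, hT⟩ := eventually_atTop.1 (S.eventually_hasDerivAt hd)
  obtain ⟨x, hx⟩ := exists_tendsto_of_isTotallyDisconnected (l := atTop)
    (γ := fun t => (u (f t) t, ur (f t) t))
    ((isCompact_closedBall (0:E) p.C).prod (isCompact_closedBall (0:E) K)) (by
      filter_upwards [eventually_gt_atTop 0] with t ht
      exact ⟨mem_closedBall_zero_iff.2 (S.sol.bu _ _ (S.f_nonneg t) ht),
        mem_closedBall_zero_iff.2 (S.sol.bur _ _ (S.f_nonneg t) ht)⟩)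
    (IsPreconnected.image_filter_basis_atTop (a := T) fun t ht =>
      (hT t ht).2.2.continuousWithinAt) hX (by
      intro x hx
      obtain ⟨F, hF, hxF⟩ := mapClusterPt_iff_ultrafilter.1 hx
      obtain ⟨φ, ψ, hφ, h0, hle, hu, hur, -⟩ :=
        S.exists_limit_wave hd (t := id) (tendsto_id'.2 hF)
      have hu := hu 0
      have hur := hur 0
      simp only [add_zero, id] at hu hur
      rw [tendsto_nhds_unique hxF (hu.prodMk_nhds hur)]
      exact hmem φ ψ hφ h0 (hlt hφ h0 hle))
  obtain ⟨F₀, hF₀⟩ := Ultrafilter.exists_le (atTop : Filter ℝ)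
  obtain ⟨φ, ψ, hφ, h0, hle, hu, hur, -⟩ := S.exists_limit_wave hd (t := id) (tendsto_id'.2 hF₀)
  have hx0 : x = (φ 0, ψ 0) := by
    have hu := hu 0
    have hur := hur 0
    simp only [add_zero, id] at hu hur
    exact tendsto_nhds_unique (hx.mono_left hF₀) (hu.prodMk_nhds hur)
  have hall : ∀ F : Ultrafilter ℝ, (F : Filter ℝ) ≤ atTop → ∀ ξ,
      Tendsto (fun t => u (f t + ξ) t) F (𝓝 (φ ξ)) ∧
      Tendsto (fun t => ur (f t + ξ) t) F (𝓝 (ψ ξ)) := by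
    intro F hF ξ
    obtain ⟨φ', ψ', hφ', h0', hle', hu', hur', -⟩ :=
      S.exists_limit_wave hd (t := id) (tendsto_id'.2 hF)
    have hu0 := hu' 0
    have hur0 := hur' 0
    simp only [add_zero, id] at hu0 hur0
    have := tendsto_nhds_unique (hx.mono_left hF) (hu0.prodMk_nhds hur0)
    rw [hx0, Prod.mk.injEq] at this
    obtain ⟨e1, e2⟩ := hφ.unique hφ' S.c_pos.le this.1 this.2 ξ
    rw [e1, e2]
    exact ⟨hu' ξ, hur' ξ⟩
  exact ⟨φ, ψ, hφ, h0, hlt hφ h0 hle,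
    fun ξ => (tendsto_iff_ultrafilter _ _ _).2 fun F hF => (hall F hF ξ).1,
    fun ξ => (tendsto_iff_ultrafilter _ _ _).2 fun F hF => (hall F hF ξ).2⟩

end Escape

end

section

variable {E : Type*} [NormedAddCommGroup E] [InnerProductSpace ℝ E]

/-- The mean value of `h` between the origin and `t`. -/
def meanValue (h : ℝ → ℝ) (t : ℝ) : ℝ := ∫ x in (0:ℝ)..1, h (t * x)

section meanValue
variable {h : ℝ → ℝ}

theorem Monotone.intervalIntegrable_comp_mul (hm : Monotone h) (t a b : ℝ) :
    IntervalIntegrable (fun x => h (t * x)) volume a b := by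
  rcases le_total 0 t with ht | ht
  · exact (show Monotone fun x => h (t * x) from fun x y hxy =>
      hm (mul_le_mul_of_nonneg_left hxy ht)).intervalIntegrable
  · exact (show Antitone fun x => h (t * x) from fun x y hxy =>
      hm (mul_le_mul_of_nonpos_left hxy ht)).intervalIntegrable

theorem Monotone.meanValue (hm : Monotone h) : Monotone (meanValue h) := fun s t hst =>
  intervalIntegral.integral_mono_on zero_le_one (hm.intervalIntegrable_comp_mul s 0 1)
    (hm.intervalIntegrable_comp_mul t 0 1) fun _ hx => hm (mul_le_mul_of_nonneg_right hst hx.1)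

theorem meanValue_nonneg (h0 : ∀ x, 0 ≤ h x) (t : ℝ) : 0 ≤ meanValue h t :=
  intervalIntegral.integral_nonneg zero_le_one fun _ _ => h0 _

theorem Monotone.meanValue_le (hm : Monotone h) {t : ℝ} (ht : 0 ≤ t) :
    _root_.meanValue h t ≤ h t := by
  have := intervalIntegral.integral_mono_on zero_le_one (hm.intervalIntegrable_comp_mul t 0 1)
    (intervalIntegrable_const (c := h t)) fun x hx =>
      hm (show t * x ≤ t from mul_le_of_le_one_right ht hx.2)
  simpa [_root_.meanValue] using this

theorem Monotone.half_le_meanValue (hm : Monotone h) (h0 : ∀ x, 0 ≤ h x) {t : ℝ} (ht : 0 ≤ t) :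
    h (t / 2) / 2 ≤ _root_.meanValue h t := by
  have h1 := intervalIntegral.integral_mono_on (by norm_num : (1/2:ℝ) ≤ 1)
    (intervalIntegrable_const (c := h (t / 2))) (hm.intervalIntegrable_comp_mul t (1/2) 1)
    fun x hx => hm (show t / 2 ≤ t * x by nlinarith [hx.1])
  have h2 : 0 ≤ ∫ x in (0:ℝ)..(1/2), h (t * x) :=
    intervalIntegral.integral_nonneg (by norm_num) fun _ _ => h0 _
  have h3 := intervalIntegral.integral_add_adjacent_intervals
    (hm.intervalIntegrable_comp_mul t 0 (1/2)) (hm.intervalIntegrable_comp_mul t (1/2) 1)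
  rw [intervalIntegral.integral_const, smul_eq_mul] at h1
  unfold _root_.meanValue
  linarith

theorem Monotone.tendsto_meanValue (hm : Monotone h) (h0 : ∀ x, 0 ≤ h x)
    (hh : Tendsto h atTop atTop) : Tendsto (_root_.meanValue h) atTop atTop := by
  refine tendsto_atTop_mono' _ ?_
    ((hh.comp (tendsto_id.atTop_div_const two_pos)).atTop_div_const two_pos)
  filter_upwards [eventually_ge_atTop 0] with t ht using hm.half_le_meanValue h0 ht

theorem meanValue_eq (t : ℝ) (ht : t ≠ 0) : meanValue h t = t⁻¹ * ∫ x in (0:ℝ)..t, h x := by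
  have := intervalIntegral.integral_comp_mul_left (a := 0) (b := 1) h ht
  simpa [meanValue] using this

theorem Monotone.continuousAt_meanValue (hm : Monotone h) {t : ℝ} (ht : 0 < t) :
    ContinuousAt (_root_.meanValue h) t := by
  have hc : Continuous fun t => ∫ x in (0:ℝ)..t, h x :=
    intervalIntegral.continuous_primitive (fun _ _ => hm.intervalIntegrable) 0
  refine ((continuousAt_inv₀ ht.ne').mul hc.continuousAt).congr ?_
  filter_upwards [Ioi_mem_nhds ht] with s hs using (meanValue_eq s (ne_of_gt hs)).symm

theorem Monotone.hasDerivAt_meanValue (hm : Monotone h) {t : ℝ} (ht : 0 < t)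
    (hc : ContinuousAt h t) : HasDerivAt (_root_.meanValue h) ((h t - _root_.meanValue h t) / t) t := by
  have hd : HasDerivAt (fun t => ∫ x in (0:ℝ)..t, h x) (h t) t :=
    intervalIntegral.integral_hasDerivAt_right hm.intervalIntegrable
      hm.measurable.stronglyMeasurable.stronglyMeasurableAtFilter hc
  have h1 := ((hasDerivAt_inv ht.ne').mul hd).congr_of_eventuallyEq (f₁ := _root_.meanValue h) (by
    filter_upwards [Ioi_mem_nhds ht] with s hs using meanValue_eq s (ne_of_gt hs))
  refine h1.congr_deriv ?_
  rw [meanValue_eq t ht.ne']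
  field_simp
  ring

end meanValue

/-- Diagonal extraction with a slowly varying index. -/
theorem exists_slow {P : ℕ → ℝ → Prop} (hP : ∀ n, ∀ᶠ t in atTop, P n t) :
    ∃ (N : ℝ → ℕ) (ℓ ℓ' : ℝ → ℝ), Tendsto N atTop atTop ∧ (∀ᶠ t in atTop, P (N t) t) ∧
      (∀ᶠ t in atTop, HasDerivAt ℓ (ℓ' t) t) ∧ Tendsto ℓ' atTop (𝓝 0) ∧ Tendsto ℓ atTop atTop ∧
      ∀ᶠ t in atTop, ℓ t ≤ N t := by
  classical
  choose T hT using fun n => eventually_atTop.1 (hP n)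
  set B : ℕ → ℝ := fun n => max (T n) ((n:ℝ) ^ 2) with hB
  set N : ℝ → ℕ := fun t => Nat.findGreatest (fun n => B n ≤ t) ⌊t⌋₊ with hN
  have hNmono : Monotone N := fun s t hst =>
    Nat.findGreatest_mono (fun n (hn : B n ≤ s) => hn.trans hst) (Nat.floor_mono hst)
  have hNtop : Tendsto N atTop atTop := tendsto_atTop.2 fun n => by
    filter_upwards [eventually_ge_atTop (max (n:ℝ) (B n))] with t ht
    exact Nat.le_findGreatest (Nat.le_floor ((le_max_left _ _).trans ht))
      ((le_max_right _ _).trans ht)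
  have hNspec : ∀ t, B 0 ≤ t → B (N t) ≤ t := fun t ht =>
    Nat.findGreatest_spec (P := fun n => B n ≤ t) (Nat.zero_le _) ht
  set h : ℝ → ℝ := fun t => (N t : ℝ) with hh
  have hm : Monotone h := fun s t hst => Nat.cast_le.2 (hNmono hst)
  have h0 : ∀ t, 0 ≤ h t := fun t => Nat.cast_nonneg _
  have htop : Tendsto h atTop atTop := tendsto_natCast_atTop_atTop.comp hNtop
  have hm1 := hm.meanValue
  have h10 := meanValue_nonneg h0
  have hsq : ∀ t, B 0 ≤ t → h t ≤ Real.sqrt t := fun t ht => by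
    refine Real.le_sqrt_of_sq_le ?_
    exact (le_max_right _ _).trans (hNspec t ht)
  refine ⟨N, meanValue (meanValue h), fun t => (meanValue h t - meanValue (meanValue h) t) / t,
    hNtop, ?_, ?_, ?_, hm1.tendsto_meanValue h10 (hm.tendsto_meanValue h0 htop), ?_⟩
  · filter_upwards [eventually_ge_atTop (B 0)] with t ht
    exact hT _ _ ((le_max_left _ _).trans (hNspec t ht))
  · filter_upwards [eventually_gt_atTop 0] with t ht
    exact hm1.hasDerivAt_meanValue ht (hm.continuousAt_meanValue ht)
  · have hlim : Tendsto (fun t : ℝ => (Real.sqrt t)⁻¹) atTop (𝓝 0) :=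
      Real.tendsto_sqrt_atTop.inv_tendsto_atTop
    refine squeeze_zero' ?_ ?_ hlim
    · filter_upwards [eventually_gt_atTop 0] with t ht
      exact div_nonneg (sub_nonneg.2 (hm1.meanValue_le ht.le)) ht.le
    · filter_upwards [eventually_gt_atTop 0, eventually_ge_atTop (B 0)] with t ht ht'
      rw [div_le_iff₀ ht]
      have e : (Real.sqrt t)⁻¹ * t = Real.sqrt t := by
        rw [inv_mul_eq_div, Real.div_sqrt]
      rw [e]
      linarith [meanValue_nonneg h10 t, hm.meanValue_le ht.le, hsq t ht']
  · filter_upwards [eventually_ge_atTop 0] with t ht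
    exact (hm1.meanValue_le ht).trans (hm.meanValue_le ht)

/-- A function which is eventually differentiable coincides eventually with an everywhere
differentiable one. -/
theorem exists_differentiable_eventuallyEq {g : ℝ → ℝ} {T : ℝ}
    (hg : ∀ t, T ≤ t → DifferentiableAt ℝ g t) :
    ∃ g₁ : ℝ → ℝ, (∀ t, DifferentiableAt ℝ g₁ t) ∧ ∀ t, T ≤ t → g₁ t = g t := by
  classical
  set a : ℝ → ℝ := fun t => g T + deriv g T * (t - T) with ha
  have hda : ∀ t, HasDerivAt a (deriv g T) t := fun t =>
    ((((hasDerivAt_id t).sub_const T).const_mul _).const_add _).congr_deriv (by ring)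
  refine ⟨fun t => if t < T then a t else g t, fun t => ?_, fun t ht => if_neg (not_lt.2 ht)⟩
  rcases lt_trichotomy t T with h | h | h
  · refine (hda t).differentiableAt.congr_of_eventuallyEq ?_
    filter_upwards [Iio_mem_nhds h] with s hs using if_pos hs
  · subst h
    have h1 : HasDerivWithinAt (fun s => if s < t then a s else g s) (deriv g t) (Iic t) t := by
      refine (hda t).hasDerivWithinAt.congr_of_mem (fun s hs => ?_) self_mem_Iic
      rcases (mem_Iic.1 hs).lt_or_eq with h | h
      · exact if_pos h
      · simp [h, ha]
    have h2 : HasDerivWithinAt (fun s => if s < t then a s else g s) (deriv g t) (Ici t) t :=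
      (hg t le_rfl).hasDerivAt.hasDerivWithinAt.congr_of_mem
        (fun s hs => if_neg (not_lt.2 hs)) self_mem_Ici
    have h3 := h1.union h2
    rw [Iic_union_Ici, hasDerivWithinAt_univ] at h3
    exact h3.differentiableAt
  · refine (hg t h.le).congr_of_eventuallyEq ?_
    filter_upwards [Ioi_mem_nhds h] with s hs using if_neg (not_lt.2 (le_of_lt hs))

/-- Pointwise convergence of equi-Lipschitz maps is uniform on compact intervals. -/
theorem eventually_forall_Icc_of_lipschitz {ι : Type*} {l : Filter ι} {v : ℝ → ι → E} {w : ℝ → E}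
    {K L : ℝ} (hv : ∀ᶠ i in l, ∀ x ∈ Icc (-L) L, ∀ y ∈ Icc (-L) L, ‖v x i - v y i‖ ≤ K * |x - y|)
    (hw : Continuous w) (h : ∀ ξ, Tendsto (v ξ) l (𝓝 (w ξ))) {η : ℝ} (hη : 0 < η) :
    ∀ᶠ i in l, ∀ ξ ∈ Icc (-L) L, ‖v ξ i - w ξ‖ ≤ η := by
  refine mem_iff_ultrafilter.2 fun F hF => ?_
  by_contra hcon
  have hcon : ∀ᶠ i in (F : Filter ι), ¬ ∀ ξ ∈ Icc (-L) L, ‖v ξ i - w ξ‖ ≤ η :=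
    Ultrafilter.compl_mem_iff_notMem.2 hcon
  have hex : ∃ ξ : ι → ℝ, ∀ᶠ i in (F : Filter ι), ξ i ∈ Icc (-L) L ∧ η < ‖v (ξ i) i - w (ξ i)‖ := by
    have : ∀ i, ∃ x : ℝ, (¬ ∀ ξ ∈ Icc (-L) L, ‖v ξ i - w ξ‖ ≤ η) →
        x ∈ Icc (-L) L ∧ η < ‖v x i - w x‖ := fun i => by
      by_cases hi : ∀ ξ ∈ Icc (-L) L, ‖v ξ i - w ξ‖ ≤ η
      · exact ⟨0, fun h => absurd hi h⟩
      · push Not at hi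
        obtain ⟨x, hx⟩ := hi
        exact ⟨x, fun _ => hx⟩
    choose ξ hξ using this
    exact ⟨ξ, hcon.mono hξ⟩
  obtain ⟨ξ, hξ⟩ := hex
  obtain ⟨x, hx, hxF⟩ := isCompact_Icc.ultrafilter_le_nhds' (F.map ξ) (hξ.mono fun _ h => h.1)
  have hxF : Tendsto ξ F (𝓝 x) := hxF
  have hlim : Tendsto (fun i => K * |ξ i - x| + ‖v x i - w x‖ + ‖w x - w (ξ i)‖) F (𝓝 0) := by
    have a1 := (hxF.sub_const x).abs.const_mul K
    have a2 := (((h x).mono_left hF).sub_const (w x)).norm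
    have a3 := (((hw.tendsto x).comp hxF).const_sub (w x)).norm
    simpa using (a1.add a2).add a3
  obtain ⟨i, h1, h2, h3⟩ := (hξ.and ((hv.filter_mono hF).and
    (hlim.eventually (gt_mem_nhds hη)))).exists
  have h4 := h2 (ξ i) h1.1 x hx
  have h5 : v (ξ i) i - w (ξ i) = (v (ξ i) i - v x i) + (v x i - w x) + (w x - w (ξ i)) := by abel
  have h6 := h1.2
  rw [h5] at h6
  linarith [norm_add₃_le (a := v (ξ i) i - v x i) (b := v x i - w x) (c := w x - w (ξ i))]

end

section

variable {E : Type*} [NormedAddCommGroup E] [InnerProductSpace ℝ E]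

namespace Escape
variable [ProperSpace E] {p : Pot E} {κ K : ℝ} {u ur urr ut : ℝ → ℝ → E} {R f : ℝ → ℝ}
  {T₀ b c : ℝ}

/-- The solution is small far ahead of the escape point. -/
theorem exists_forall_ahead_le (S : Escape p κ K u ur urr ut R f T₀ b c)
    (hd : ∀ x y, 0 < x → x < y → ∃ a ∈ Ioo x y, ¬ HasFront p a) {η : ℝ} (hη : 0 < η) :
    ∃ L T : ℝ, ∀ t, T ≤ t → ∀ r, f t + L ≤ r → r ≤ R t → ‖u r t‖ ≤ η := by
  by_contra hcon
  push Not at hcon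
  choose t ht r hr1 hr2 hr3 using fun n : ℕ => hcon n n
  set F : Ultrafilter ℕ := hyperfilter ℕ with hF
  have hn : Tendsto (fun n : ℕ => (n:ℝ)) F atTop :=
    tendsto_natCast_atTop_atTop.mono_left Nat.hyperfilter_le_atTop
  have htop : Tendsto t F atTop := tendsto_atTop_mono ht hn
  have hrtop : Tendsto r F atTop :=
    tendsto_atTop_mono (fun n => by linarith [hr1 n, S.f_nonneg (t n)]) hn
  have hgap : Tendsto (fun n => R (t n) - r n) F atTop := Filter.tendsto_atTop.2 fun L => by
    filter_upwards [htop.eventually (S.nearR L η hη)] with n h1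
    by_contra hlt
    refine (hr3 n).not_ge (h1 _ ?_)
    rw [abs_sub_comm, abs_of_nonneg (by linarith [hr2 n])]
    linarith
  obtain ⟨a, ha, hN⟩ := hd (c / 2) c (half_pos S.c_pos) (half_lt_self S.c_pos)
  have ha0 : 0 < a := (half_pos S.c_pos).trans ha.1
  obtain ⟨k, T, hlow⟩ := S.lower_speed ha0 ha.2 hN
  obtain ⟨U, P, Z, W, SU, hU, -, -⟩ := (S.sol.asymp hrtop htop).exists_limit
  have hsm : ∀ s ≤ 0, ∀ ξ, ‖U ξ s‖ ≤ p.δ := fun s hs ξ => by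
    refine le_of_tendsto (hU ξ s).norm ?_
    filter_upwards [hgap.eventually_ge_atTop (ξ + b * |s|), hn.eventually_gt_atTop (k - ξ),
      htop.eventually_ge_atTop T₀, htop.eventually_ge_atTop (T₀ - s),
      htop.eventually_ge_atTop (T - s)] with n h1 h2 h3 h4 h5
    have h6 := hlow (t n + s) (t n) (by linarith) (by linarith)
    have h7 := abs_le.1 (S.R_lip (t n) h3 (t n + s) (by linarith))
    rw [add_sub_cancel_left] at h7
    refine (S.small _ (by linarith) _ ?_ (by linarith [h7.1])).le
    nlinarith [hr1 n]
  have h0 : ‖U 0 0‖ ^ 2 ≤ 0 := by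
    have hlim : Tendsto (fun s : ℝ => p.δ ^ 2 * Real.exp (-(p.lam * s))) atTop (𝓝 (p.δ ^ 2 * 0)) :=
      (Real.tendsto_exp_neg_atTop_nhds_zero.comp
        (tendsto_id.const_mul_atTop p.lam_pos)).const_mul _
    rw [mul_zero] at hlim
    refine ge_of_tendsto hlim ?_
    filter_upwards [eventually_ge_atTop 0] with s hs
    have := SU.decay_line (s0 := -s) (s := 0) (by linarith) (hsm _ (by linarith)) 0
    simpa using this
  have h1 : η ≤ ‖U 0 0‖ := ge_of_tendsto (hU 0 0).norm (Eventually.of_forall fun n => by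
    simpa using (hr3 n).le)
  nlinarith

variable {φ ψ : ℝ → E}

theorem eventually_forall_Icc_le (S : Escape p κ K u ur urr ut R f T₀ b c)
    (hd : ∀ x y, 0 < x → x < y → ∃ a ∈ Ioo x y, ¬ HasFront p a) {K' : ℝ}
    (hφ : Profile p c K' φ ψ)
    (hu : ∀ ξ, Tendsto (fun t => u (f t + ξ) t) atTop (𝓝 (φ ξ)))
    (hur : ∀ ξ, Tendsto (fun t => ur (f t + ξ) t) atTop (𝓝 (ψ ξ))) (L : ℝ) {η : ℝ} (hη : 0 < η) :
    ∀ᶠ t in atTop, ∀ ξ ∈ Icc (-L) L, ‖u (f t + ξ) t - φ ξ‖ ≤ η ∧ ‖ur (f t + ξ) t - ψ ξ‖ ≤ η := by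
  have hev : ∀ᶠ t in atTop, L ≤ f t ∧ 0 < t :=
    ((S.tendsto_atTop hd).eventually_ge_atTop L).and (eventually_gt_atTop 0)
  have h1 := eventually_forall_Icc_of_lipschitz (v := fun ξ t => u (f t + ξ) t) (K := K) (L := L)
    (by
      filter_upwards [hev] with t ht x hx y hy
      simpa using S.sol.lip_r (r := f t + y) (r' := f t + x) (t := t) (by linarith [hy.1])
        (by linarith [hx.1]) ht.2) hφ.cφ hu hη
  have h2 := eventually_forall_Icc_of_lipschitz (v := fun ξ t => ur (f t + ξ) t) (K := K) (L := L)
    (by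
      filter_upwards [hev] with t ht x hx y hy
      simpa using S.sol.ur_lip_r (r := f t + y) (r' := f t + x) (t := t) (by linarith [hy.1])
        (by linarith [hx.1]) ht.2) hφ.cψ hur hη
  filter_upwards [h1, h2] with t h1 h2 ξ hξ using ⟨h1 ξ hξ, h2 ξ hξ⟩

theorem eventually_forall_ahead_sub_le (S : Escape p κ K u ur urr ut R f T₀ b c)
    (hd : ∀ x y, 0 < x → x < y → ∃ a ∈ Ioo x y, ¬ HasFront p a) {K' : ℝ}
    (hφ : Profile p c K' φ ψ)
    (hu : ∀ ξ, Tendsto (fun t => u (f t + ξ) t) atTop (𝓝 (φ ξ)))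
    (hur : ∀ ξ, Tendsto (fun t => ur (f t + ξ) t) atTop (𝓝 (ψ ξ))) (L : ℝ) {η : ℝ} (hη : 0 < η) :
    ∀ᶠ t in atTop, ∀ r ∈ Icc (f t - L) (R t), ‖u r t - φ (r - f t)‖ ≤ η := by
  obtain ⟨L₁, T, h1⟩ := S.exists_forall_ahead_le hd (half_pos hη)
  obtain ⟨L₂, h2⟩ := eventually_atTop.1
    (hφ.limφ.norm.eventually (gt_mem_nhds (by rw [norm_zero]; exact half_pos hη)))
  set M := max L (max L₁ L₂) with hM
  have hM1 : L ≤ M := le_max_left _ _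
  have hM2 : L₁ ≤ M := (le_max_left _ _).trans (le_max_right _ _)
  have hM3 : L₂ ≤ M := (le_max_right _ _).trans (le_max_right _ _)
  filter_upwards [S.eventually_forall_Icc_le hd hφ hu hur M hη, eventually_ge_atTop T]
    with t h3 h4 r hr
  rcases le_total r (f t + M) with h | h
  · have := (h3 (r - f t) ⟨by linarith [hr.1], by linarith⟩).1
    rwa [add_sub_cancel] at this
  · have h5 := h1 t h4 r (by linarith) hr.2
    have h6 := h2 (r - f t) (by linarith)
    linarith [norm_sub_le (u r t) (φ (r - f t))]

/-- A position, moving at the same asymptotic speed as the escape point and remaining far behind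
it, up to which the solution follows the front. -/
theorem exists_next (S : Escape p κ K u ur urr ut R f T₀ b c)
    (hd : ∀ x y, 0 < x → x < y → ∃ a ∈ Ioo x y, ¬ HasFront p a) {K' : ℝ}
    (hφ : Profile p c K' φ ψ)
    (hu : ∀ ξ, Tendsto (fun t => u (f t + ξ) t) atTop (𝓝 (φ ξ)))
    (hur : ∀ ξ, Tendsto (fun t => ur (f t + ξ) t) atTop (𝓝 (ψ ξ))) {x : E}
    (hx : Tendsto φ atBot (𝓝 x)) :
    ∃ g : ℝ → ℝ, (∀ t, DifferentiableAt ℝ g t) ∧ Tendsto (fun t => f t - g t) atTop atTop ∧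
      Tendsto (deriv g) atTop (𝓝 c) ∧
      (∀ η, 0 < η → ∀ᶠ t in atTop, ∀ r ∈ Icc (g t) (R t), ‖u r t - φ (r - f t)‖ ≤ η) ∧
      ∀ L η, 0 < η → ∀ᶠ t in atTop, ∀ r, |r| ≤ L →
        ‖u (g t + r) t - x‖ ≤ η ∧ ‖ur (g t + r) t‖ ≤ η := by
  obtain ⟨N, ℓ, ℓ', hN, hP, hℓd, hℓ', hℓ, hle⟩ := exists_slow
    (P := fun n t => (∀ r ∈ Icc (f t - n) (R t), ‖u r t - φ (r - f t)‖ ≤ 1 / ((n:ℝ) + 1)) ∧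
      ∀ ξ ∈ Icc (-(n:ℝ)) n, ‖u (f t + ξ) t - φ ξ‖ ≤ 1 / ((n:ℝ) + 1) ∧
        ‖ur (f t + ξ) t - ψ ξ‖ ≤ 1 / ((n:ℝ) + 1))
    fun n => (S.eventually_forall_ahead_sub_le hd hφ hu hur n Nat.one_div_pos_of_nat).and
      (S.eventually_forall_Icc_le hd hφ hu hur n Nat.one_div_pos_of_nat)
  have hinv : ∀ η : ℝ, 0 < η → ∀ᶠ t in atTop, 1 / ((N t : ℝ) + 1) < η := fun η hη =>
    (tendsto_one_div_add_atTop_nhds_zero_nat.comp hN).eventually (gt_mem_nhds hη)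
  have hfd : ∀ᶠ t in atTop, HasDerivAt f (deriv f t) t :=
    (S.eventually_hasDerivAt hd).mono fun t ht => ht.1.differentiableAt.hasDerivAt
  have hgd : ∀ᶠ t in atTop, HasDerivAt (fun t => f t - ℓ t / 2) (deriv f t - ℓ' t / 2) t := by
    filter_upwards [hfd, hℓd] with t h1 h2 using h1.sub (h2.div_const 2)
  obtain ⟨T, hT⟩ := eventually_atTop.1 hgd
  obtain ⟨g, hg, hgeq⟩ := exists_differentiable_eventuallyEq fun t ht => (hT t ht).differentiableAt
  have hgev : ∀ᶠ t in atTop, g t = f t - ℓ t / 2 := eventually_atTop.2 ⟨T, hgeq⟩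
  refine ⟨g, hg, ?_, ?_, fun η hη => ?_, fun L η hη => ?_⟩
  · refine (hℓ.atTop_div_const two_pos).congr' ?_
    filter_upwards [hgev] with t ht
    rw [ht]; ring
  · have h1 : Tendsto (fun t => deriv f t - ℓ' t / 2) atTop (𝓝 c) := by
      simpa using (S.tendsto_deriv hd).sub (hℓ'.div_const 2)
    refine h1.congr' ?_
    filter_upwards [eventually_gt_atTop T] with t ht
    refine ((hT t ht.le).congr_of_eventuallyEq ?_).deriv.symm
    filter_upwards [Ioi_mem_nhds ht] with s hs using hgeq s (le_of_lt hs)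
  · filter_upwards [hgev, hP, hinv η hη, hle, hℓ.eventually_ge_atTop 0] with t h1 h2 h3 h4 h5 r hr
    rw [h1] at hr
    exact (h2.1 r ⟨by linarith [hr.1], hr.2⟩).trans h3.le
  · obtain ⟨B, hB⟩ := eventually_atBot.1
      ((((hx.sub_const x).norm.eventually (gt_mem_nhds (a := η / 2) (by simpa using half_pos hη)))).and
        ((hφ.tendsto_ψ_atBot S.c_pos).norm.eventually (gt_mem_nhds (a := η / 2) (by simpa using half_pos hη))))
    filter_upwards [hgev, hP, hinv (η / 2) (half_pos hη), hle, hℓ.eventually_ge_atTop (2 * L),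
      hℓ.eventually_ge_atTop (2 * (L - B)), hℓ.eventually_ge_atTop 0] with t h1 h2 h3 h4 h5 h6 h7 r hr
    have hr := abs_le.1 hr
    have h8 := h2.2 (r - ℓ t / 2) ⟨by linarith [hr.1], by linarith⟩
    have h9 := hB (r - ℓ t / 2) (by linarith)
    have e : f t + (r - ℓ t / 2) = g t + r := by rw [h1]; ring
    rw [e] at h8
    constructor
    · linarith [norm_sub_le_norm_sub_add_norm_sub (u (g t + r) t) (φ (r - ℓ t / 2)) x]
    · have := norm_le_norm_sub_add (ur (g t + r) t) (ψ (r - ℓ t / 2))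
      linarith

end Escape

end

section

section potential
variable {V : Euc n → ℝ} {m : Euc n}

theorem contDiff_gradient (hV : ContDiff ℝ 2 V) : ContDiff ℝ 1 (gradient V) := by
  have h : ContDiff ℝ 1 (fderiv ℝ V) := hV.fderiv_right (by norm_num)
  exact (InnerProductSpace.toDual ℝ (Euc n)).symm.contDiff.comp h

theorem hasFDerivAt_gradient (hV : ContDiff ℝ 2 V) (x : Euc n) :
    HasFDerivAt (gradient V) (hess V x) x :=
  ((contDiff_gradient hV).differentiable one_ne_zero x).hasFDerivAt

theorem hasFDerivAt_innerSL_gradient (hV : ContDiff ℝ 2 V) (x : Euc n) :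
    HasFDerivAt V (innerSL ℝ (gradient V x)) x := by
  have h := ((hV.differentiable two_ne_zero) x).hasGradientAt.hasFDerivAt
  exact h

theorem EscData.inner_gradient_ge (D : EscData n V) (hV : ContDiff ℝ 2 V) (hm : m ∈ MinSet V)
    {x : Euc n} (hx : ‖x‖ ≤ D.dEsc) : D.lmin / 2 * ‖x‖ ^ 2 ≤ ⟪x, gradient V (x + m)⟫ := by
  have hline : ∀ s : ℝ, HasDerivAt (fun s : ℝ => s • x + m) x s := fun s =>
    (((hasDerivAt_id s).smul_const x).add_const m).congr_deriv (one_smul _ _)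
  have hd : ∀ s : ℝ, HasDerivAt (fun s : ℝ => ⟪x, gradient V (s • x + m)⟫)
      ⟪x, hess V (s • x + m) x⟫ s := fun s => by
    have h1 := (hasFDerivAt_gradient hV (s • x + m)).comp_hasDerivAt s (hline s)
    simpa using (hasDerivAt_const s x).inner ℝ h1
  obtain ⟨s, hs, he⟩ := exists_hasDerivAt_eq_slope (fun s : ℝ => ⟪x, gradient V (s • x + m)⟫)
    (fun s => ⟪x, hess V (s • x + m) x⟫) zero_lt_one
    (fun s _ => (hd s).continuousAt.continuousWithinAt) fun s _ => hd s
  have h1 := D.esc_lower m hm (s • x + m) (by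
    rw [add_sub_cancel_right, norm_smul, Real.norm_of_nonneg hs.1.le]
    nlinarith [norm_nonneg x, hs.1, hs.2]) x
  simp only [one_smul, zero_smul, zero_add, hm.1, inner_zero_right, sub_zero, div_one] at he
  rwa [he] at h1

/-- The potential translated so that the minimum point `m` is the origin. -/
theorem EscData.exists_pot (D : EscData n V) (hV : ContDiff ℝ 2 V) (hm : m ∈ MinSet V) (B : ℝ) :
    ∃ p : Pot (Euc n), p.G = (fun x => gradient V (x + m)) ∧ p.W = (fun x => V (x + m) - V m) ∧
      p.δ = D.dEsc ∧ B ≤ p.C := by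
  set C := max B 1 with hC
  obtain ⟨L', hL'⟩ := (isCompact_closedBall m C).exists_bound_of_continuousOn
    (f := hess V) (((contDiff_gradient hV).continuous_fderiv one_ne_zero).continuousOn)
  set L := max L' 1 with hL
  have hL1 : 0 < L := lt_of_lt_of_le one_pos (le_max_right _ _)
  have hdG : ∀ x, HasFDerivAt (fun x => gradient V (x + m)) (hess V (x + m)) x := fun x =>
    (hasFDerivAt_comp_add_right m).2 (hasFDerivAt_gradient hV (x + m))
  have hdW : ∀ x, HasFDerivAt (fun x => V (x + m) - V m) (innerSL ℝ (gradient V (x + m))) x :=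
    fun x => ((hasFDerivAt_comp_add_right m).2 (hasFDerivAt_innerSL_gradient hV (x + m))).sub_const _
  have hlip : ∀ x y, ‖x‖ ≤ C → ‖y‖ ≤ C →
      ‖gradient V (x + m) - gradient V (y + m)‖ ≤ L * ‖x - y‖ := by
    intro x y hx hy
    refine (convex_closedBall (0 : Euc n) C).norm_image_sub_le_of_norm_hasFDerivWithin_le
      (f := fun x => gradient V (x + m)) (f' := fun x => hess V (x + m))
      (fun z _ => (hdG z).hasFDerivWithinAt) (fun z hz => ?_) (by simpa using hy) (by simpa using hx)
    exact (hL' (z + m) (by simpa using hz)).trans (le_max_left _ _)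
  refine ⟨⟨fun x => gradient V (x + m), fun x => V (x + m) - V m, C, L, D.dEsc, D.lmin,
    lt_of_lt_of_le one_pos (le_max_right _ _), hL1, D.dEsc_pos, D.lmin_pos, ?_, ?_, hlip, ?_,
    fun x hx => D.inner_gradient_ge hV hm hx, hdW⟩, rfl, rfl, rfl, le_max_left _ _⟩
  · simpa using hm.1
  · simp
  · intro x y hx hy
    have h := (convex_segment x y).norm_image_sub_le_of_norm_hasFDerivWithin_le
      (f := fun z => V (z + m) - V m - innerSL ℝ (gradient V (x + m)) z)
      (f' := fun z => innerSL ℝ (gradient V (z + m)) - innerSL ℝ (gradient V (x + m)))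
      (C := L * ‖y - x‖)
      (fun z _ => ((hdW z).sub (ContinuousLinearMap.hasFDerivAt _)).hasFDerivWithinAt)
      (fun z hz => ?_) (left_mem_segment ℝ x y) (right_mem_segment ℝ x y)
    · rw [Real.norm_eq_abs] at h
      have e : V (y + m) - V m - (V (x + m) - V m) - ⟪y - x, gradient V (x + m)⟫ =
          V (y + m) - V m - innerSL ℝ (gradient V (x + m)) y -
            (V (x + m) - V m - innerSL ℝ (gradient V (x + m)) x) := by
        rw [innerSL_apply_apply, innerSL_apply_apply, real_inner_comm, inner_sub_right]
        ring
      rw [e]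
      linarith [sq ‖y - x‖]
    · have hz1 : ‖z‖ ≤ C := by
        have := (convex_closedBall (0 : Euc n) C).segment_subset (x := x) (y := y)
          (by simpa using hx) (by simpa using hy) hz
        simpa using this
      rw [← map_sub, innerSL_apply_norm]
      refine (hlip z x hz1 hx).trans ?_
      gcongr
      exact norm_sub_le_of_mem_segment hz

/-- Nondegenerate critical points are isolated. -/
theorem HNonDeg.isTotallyDisconnected (h : HNonDeg V) (hV : ContDiff ℝ 2 V) (m : Euc n)
    (s : Set (Euc n)) : IsTotallyDisconnected {x | x ∈ s ∧ gradient V (x + m) = 0} := by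
  have hdisc : DiscreteTopology {x | x ∈ s ∧ gradient V (x + m) = 0} := by
    refine discreteTopology_of_noAccPts fun x hx => ?_
    rw [accPt_iff_frequently_nhdsNE, not_frequently]
    have hd : HasFDerivAt (fun x => gradient V (x + m)) (hess V (x + m)) x :=
      (hasFDerivAt_comp_add_right m).2 (hasFDerivAt_gradient hV (x + m))
    obtain ⟨K, -, hK⟩ := LinearMap.exists_antilipschitzWith (hess V (x + m) : Euc n →ₗ[ℝ] Euc n)
      (LinearMap.ker_eq_bot'.2 fun v hv => h _ hx.2 v hv)
    filter_upwards [hd.eventually_ne (c := 0) ⟨K, hK⟩] with z hz hz'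
    exact hz hz'.2
  exact totallyDisconnectedSpace_subtype_iff.1 inferInstance

/-- Nonzero profiles for the translated potential yield bistable fronts. -/
theorem Profile.exists_phi {p : Pot (Euc n)} {c K : ℝ} {φ ψ : ℝ → Euc n} (h : Profile p c K φ ψ)
    (hV : ContDiff ℝ 2 V) (hm : m ∈ MinSet V) (hG : p.G = fun x => gradient V (x + m))
    (hW : p.W = fun x => V (x + m) - V m) (hnd : HNonDeg V) (hob : HOnlyBist V) (hc : 0 < c)
    (hne : ∃ ξ, φ ξ ≠ 0) :
    ∃ mm ∈ MinSet V, V mm < V m ∧ (fun ξ => φ ξ + m) ∈ Phi V c mm m ∧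
      deriv (fun ξ => φ ξ + m) = ψ := by
  obtain ⟨x, hx, hlim, hWx⟩ := h.exists_limit_atBot hc (by
    rw [hG]
    exact hnd.isTotallyDisconnected hV m {x | ‖x‖ ≤ p.C}) hne
  rw [hG] at hx
  rw [hW] at hWx
  have hdφ : ∀ ξ, HasDerivAt (fun ξ => φ ξ + m) (ψ ξ) ξ := fun ξ => (h.dφ ξ).add_const m
  have hder : deriv (fun ξ => φ ξ + m) = ψ := funext fun ξ => (hdφ ξ).deriv
  have hmem : (fun ξ => φ ξ + m) ∈ Phi V c (x + m) m := by
    refine ⟨?_, fun ξ => (hdφ ξ).differentiableAt, ?_, ?_, hlim.add_const m, ?_⟩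
    · obtain ⟨ξ, hξ⟩ := hne
      by_contra hcon
      push Not at hcon
      refine hξ (tendsto_nhds_unique (tendsto_const_nhds.congr fun ζ => ?_) h.limφ)
      exact add_right_cancel (hcon ξ ζ)
    · rw [hder]
      exact fun ξ => (h.dψ ξ).differentiableAt
    · intro ξ
      rw [hder, (h.dψ ξ).deriv, hG]
      abel
    · simpa using h.limφ.add_const m
  exact ⟨x + m, hob m hm (x + m) hx c hc ⟨_, hmem⟩, by linarith, hmem, hder⟩

theorem HGen.exists_not_hasFront {p : Pot (Euc n)} {dEsc : ℝ} (hgen : HGen V dEsc)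
    (hV : ContDiff ℝ 2 V) (hm : m ∈ MinSet V) (hG : p.G = fun x => gradient V (x + m))
    (hW : p.W = fun x => V (x + m) - V m) (x y : ℝ) (hx : 0 < x) (hxy : x < y) :
    ∃ a ∈ Ioo x y, ¬ HasFront p a := by
  by_contra hcon
  push Not at hcon
  have hsub : Ioo x y ⊆ {c : ℝ | 0 ≤ c ∧ (PhiInv V c m).Nonempty} := fun a ha => by
    obtain ⟨K, φ, ψ, hp, hne⟩ := hcon a ha
    have ha0 : 0 < a := hx.trans ha.1
    obtain ⟨mm, hmm, -, hφ, -⟩ := hp.exists_phi hV hm hG hW hgen.1 hgen.2.1 ha0 hne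
    exact ⟨ha0.le, _, mem_iUnion₂.2 ⟨mm, hmm, hφ⟩⟩
  have h1 := interior_maximal hsub isOpen_Ioo
  rw [hgen.2.2.1 m hm] at h1
  exact h1 (⟨by linarith, by linarith⟩ : (x + y) / 2 ∈ Ioo x y)

end potential

end

section

theorem IsRadialSolution.radSol {d : ℕ} {V : Euc n → ℝ} {u : ℝ → ℝ → Euc n} {m : Euc n}
    {p : Pot (Euc n)} {K : ℝ} (hu : IsRadialSolution d V u) (hd : 1 ≤ d)
    (hK : ∀ r t : ℝ, 0 ≤ r → 0 < t → ‖u r t‖ + ‖ur u r t‖ + ‖urr u r t‖ + ‖ut u r t‖ ≤ K)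
    (hG : p.G = fun x => gradient V (x + m)) (hC : K + ‖m‖ ≤ p.C) :
    RadSol p ((d : ℝ) - 1) K (fun r t => u r t - m) (ur u) (urr u) (ut u) where
  κ_nonneg := sub_nonneg.2 (by exact_mod_cast hd)
  dr r t ht := (hu.diff_r t ht r).hasDerivAt.sub_const m
  drr r t ht := (hu.diff_rr t ht r).hasDerivAt
  dt r t ht := (hu.diff_t t ht r).hasDerivAt.sub_const m
  bu r t hr ht := by
    linarith [hK r t hr ht, norm_nonneg (ur u r t), norm_nonneg (urr u r t),
      norm_nonneg (ut u r t), norm_sub_le (u r t) m]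
  bur r t hr ht := by
    linarith [hK r t hr ht, norm_nonneg (u r t), norm_nonneg (urr u r t), norm_nonneg (ut u r t)]
  burr r t hr ht := by
    linarith [hK r t hr ht, norm_nonneg (u r t), norm_nonneg (ur u r t), norm_nonneg (ut u r t)]
  but r t hr ht := by
    linarith [hK r t hr ht, norm_nonneg (u r t), norm_nonneg (ur u r t), norm_nonneg (urr u r t)]
  pde r t hr ht := by
    rw [hu.pde r hr t ht, hG]
    simp

section homogeneous
variable {u : ℝ → ℝ → Euc n} {m : Euc n} {cHom : ℝ} {rHom : ℝ → ℝ}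

theorem HHomWith.exists_lipschitz (h : HHomWith u m cHom rHom) :
    ∃ T, ∀ t, T ≤ t → ∀ t', T ≤ t' → |rHom t' - rHom t| ≤ (cHom + 1) * |t' - t| := by
  obtain ⟨hc, hd, hlim, -⟩ := h
  obtain ⟨T, hT⟩ := eventually_atTop.1 ((hlim.eventually (gt_mem_nhds (lt_add_one cHom))).and
    (hlim.eventually (lt_mem_nhds hc)))
  refine ⟨T, fun t ht t' ht' => ?_⟩
  have := (convex_Ici T).norm_image_sub_le_of_norm_deriv_le (f := rHom) (C := cHom + 1)
    (fun z _ => hd z) (fun z hz => ?_) (mem_Ici.2 ht) (mem_Ici.2 ht')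
  · simpa [Real.norm_eq_abs] using this
  · rw [Real.norm_of_nonneg (hT z hz).2.le]
    exact (hT z hz).1.le

theorem HHomWith.tendsto_atTop (h : HHomWith u m cHom rHom) : Tendsto rHom atTop atTop := by
  obtain ⟨hc, hd, hlim, -⟩ := h
  obtain ⟨T, hT⟩ := eventually_atTop.1 (hlim.eventually (lt_mem_nhds (half_lt_self hc)))
  have h1 : Tendsto (fun t => cHom / 2 * (t - T) + rHom T) atTop atTop :=
    tendsto_atTop_add_const_right _ _
      ((tendsto_atTop_add_const_right _ (-T) tendsto_id).const_mul_atTop (half_pos hc))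
  refine tendsto_atTop_mono' _ ?_ h1
  filter_upwards [eventually_ge_atTop T] with t ht
  have := (convex_Ici T).mul_sub_le_image_sub_of_le_deriv (f := rHom) (C := cHom / 2)
    (fun z _ => (hd z).continuousAt.continuousWithinAt)
    (fun z _ => (hd z).differentiableWithinAt)
    (fun z hz => (hT z (interior_subset hz)).le) T self_mem_Ici t ht ht
  linarith

theorem HHomWith.eventually_norm_le {d : ℕ} {V : Euc n → ℝ} (h : HHomWith u m cHom rHom)
    (hu : IsRadialSolution d V u) {p : Pot (Euc n)} {κ K : ℝ}
    (S : RadSol p κ K (fun r t => u r t - m) (ur u) (urr u) (ut u)) (L : ℝ) {ε : ℝ} (hε : 0 < ε) :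
    ∀ᶠ t in atTop, ∀ r, |r - rHom t| ≤ L → ‖u r t - m‖ ≤ ε := by
  rcases lt_or_ge L 0 with hL | hL
  · exact Eventually.of_forall fun t r hr => absurd (abs_nonneg (r - rHom t)) (by linarith)
  have hK := S.K_nonneg
  set η := min 1 (ε / (2 * (K + 1))) with hη
  have hηpos : 0 < η := lt_min one_pos (by positivity)
  have hη1 : η ≤ 1 := min_le_left _ _
  have hηK : K * η ≤ ε / 2 := by
    have h1 : η ≤ ε / (2 * (K + 1)) := min_le_right _ _
    rw [le_div_iff₀ (by positivity)] at h1
    nlinarith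
  have h_int := (h.2.2.2 (L + 1) (by linarith)).eventually
    (gt_mem_nhds (show (0:ℝ) < η * (ε / 2) ^ 2 by positivity))
  filter_upwards [h_int, h.tendsto_atTop.eventually_ge_atTop (L + 1), eventually_gt_atTop 0]
    with t h1 h2 h3 r hr
  by_contra hlt
  push Not at hlt
  have hr := abs_le.1 hr
  have hcu : Continuous fun x => u x t :=
    continuous_iff_continuousAt.2 fun x => (hu.diff_r t h3 x).continuousAt
  have hcur : Continuous fun x => ur u x t :=
    continuous_iff_continuousAt.2 fun x => (hu.diff_rr t h3 x).continuousAt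
  have hcont : Continuous fun x =>
      ‖u (rHom t + x) t - m‖ ^ 2 + ‖ur u (rHom t + x) t‖ ^ 2 := by
    have a1 := hcu.comp (continuous_const_add (rHom t))
    have a2 := hcur.comp (continuous_const_add (rHom t))
    exact ((a1.sub continuous_const).norm.pow 2).add (a2.norm.pow 2)
  have hmono := intervalIntegral.integral_mono_interval (μ := volume) (a := r - rHom t)
    (b := r - rHom t + η) (c := -(L + 1)) (d := L + 1) (by linarith) (by linarith) (by linarith)
    (Eventually.of_forall fun x => by simp only [Pi.zero_apply]; positivity)
    (hcont.intervalIntegrable (-(L + 1)) (L + 1))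
  have hlow : η * (ε / 2) ^ 2 ≤ ∫ x in (r - rHom t)..(r - rHom t + η),
      (‖u (rHom t + x) t - m‖ ^ 2 + ‖ur u (rHom t + x) t‖ ^ 2) := by
    have := intervalIntegral.integral_mono_on (μ := volume) (a := r - rHom t) (b := r - rHom t + η)
      (f := fun _ => (ε / 2) ^ 2) (by linarith) intervalIntegrable_const
      (hcont.intervalIntegrable (r - rHom t) (r - rHom t + η)) fun x hx => by
        have h4 := S.lip_r (r := r) (r' := rHom t + x) (t := t) (by linarith)
          (by linarith [hx.1]) h3
        rw [abs_of_nonneg (by linarith [hx.1])] at h4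
        have h5 : ‖u r t - m‖ ≤ ‖u (rHom t + x) t - m - (u r t - m)‖ + ‖u (rHom t + x) t - m‖ := by
          rw [norm_sub_rev (u (rHom t + x) t - m)]
          exact norm_le_norm_sub_add _ _
        have h6 : ε / 2 ≤ ‖u (rHom t + x) t - m‖ := by nlinarith [hx.2]
        nlinarith [sq_nonneg ‖ur u (rHom t + x) t‖]
    simpa using this
  linarith

theorem isClosed_rEscSet {dEsc t : ℝ} (hc : Continuous fun r => u r t) :
    IsClosed (rEscSet u m dEsc rHom t) :=
  isClosed_Icc.inter (isClosed_eq (hc.sub continuous_const).norm continuous_const)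

theorem bddAbove_rEscSet (dEsc t : ℝ) : BddAbove (rEscSet u m dEsc rHom t) :=
  ⟨rHom t, fun _ hr => hr.1.2⟩

theorem rEscF_nonneg (dEsc t : ℝ) : 0 ≤ rEscF u m dEsc rHom t :=
  Real.sSup_nonneg fun _ hr => hr.1.1

theorem rEscF_le {dEsc t : ℝ} (h : 0 ≤ rHom t) : rEscF u m dEsc rHom t ≤ rHom t :=
  Real.sSup_le (fun _ hr => hr.1.2) h

theorem rEscSet_nonempty {dEsc t : ℝ} (h : 0 < rEscF u m dEsc rHom t) :
    (rEscSet u m dEsc rHom t).Nonempty := by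
  by_contra hcon
  rw [rEscF, not_nonempty_iff_eq_empty.1 hcon, Real.sSup_empty] at h
  exact lt_irrefl _ h

theorem HHomWith.exists_escape {d : ℕ} {V : Euc n → ℝ} (h : HHomWith u m cHom rHom)
    (hu : IsRadialSolution d V u) {p : Pot (Euc n)} {κ K : ℝ}
    (S : RadSol p κ K (fun r t => u r t - m) (ur u) (urr u) (ut u))
    (hinv : 0 < cEscV u m p.δ rHom) :
    ∃ T, Escape p κ K (fun r t => u r t - m) (ur u) (urr u) (ut u) rHom (rEscF u m p.δ rHom) T
      (cHom + 1) (cEscV u m p.δ rHom) := by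
  obtain ⟨T₁, hlip⟩ := h.exists_lipschitz
  obtain ⟨T₂, hnear⟩ := eventually_atTop.1 (h.eventually_norm_le hu S 0 (half_pos p.δ_pos))
  obtain ⟨T₃, hpos⟩ := eventually_atTop.1 (h.tendsto_atTop.eventually_ge_atTop 0)
  set T := max (max 2 T₁) (max T₂ T₃) with hT
  have hT2 : 2 ≤ T := (le_max_left _ _).trans (le_max_left _ _)
  have hT₁ : T₁ ≤ T := (le_max_right _ _).trans (le_max_left _ _)
  have hT₂ : T₂ ≤ T := (le_max_left _ _).trans (le_max_right _ _)
  have hT₃ : T₃ ≤ T := (le_max_right _ _).trans (le_max_right _ _)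
  have hc := h.1
  have hcu : ∀ t, 0 < t → Continuous fun r => u r t := fun t ht =>
    continuous_iff_continuousAt.2 fun x => (hu.diff_r t ht x).continuousAt
  have hbdd : IsBoundedUnder (· ≤ ·) atTop fun t => rEscF u m p.δ rHom t / t := by
    refine isBoundedUnder_of_eventually_le (a := cHom + 2) ?_
    filter_upwards [eventually_ge_atTop T, eventually_ge_atTop (rHom T)] with t ht ht'
    have h1 := (le_abs_self _).trans (hlip T hT₁ t (hT₁.trans ht))
    rw [abs_of_nonneg (by linarith)] at h1
    have h2 : rEscF u m p.δ rHom t ≤ rHom t := rEscF_le (hpos t (hT₃.trans ht))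
    rw [div_le_iff₀ (by linarith)]
    nlinarith
  have hcob : IsCoboundedUnder (· ≤ ·) atTop fun t => rEscF u m p.δ rHom t / t := by
    refine IsBoundedUnder.isCoboundedUnder_le (isBoundedUnder_of_eventually_ge (a := 0) ?_)
    filter_upwards [eventually_ge_atTop 0] with t ht
    exact div_nonneg (rEscF_nonneg _ _) ht
  refine ⟨T, S, hT2, fun t => rEscF_nonneg _ _, fun t ht => rEscF_le (hpos t (hT₃.trans ht)), ?_,
    ?_, by linarith, fun t ht t' ht' => hlip t (hT₁.trans ht) t' (hT₁.trans ht'), h.tendsto_atTop,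
    fun L ε hε => h.eventually_norm_le hu S L hε, hinv, ?_, ?_⟩
  · intro t ht r hr1 hr2
    by_contra hcon
    push Not at hcon
    have h1 := hnear t (hT₂.trans ht) (rHom t) (by simp)
    obtain ⟨z, hz, hze⟩ := intermediate_value_Icc' (f := fun r => ‖u r t - m‖) hr2
      ((hcu t (by linarith)).sub continuous_const).norm.continuousOn
      (⟨by linarith [p.δ_pos], hcon⟩ : p.δ ∈ Icc _ _)
    have h0 : 0 ≤ rEscF u m p.δ rHom t := rEscF_nonneg _ _
    have h2 : z ≤ rEscF u m p.δ rHom t :=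
      le_csSup (bddAbove_rEscSet p.δ t) ⟨⟨by linarith [hz.1], hz.2⟩, hze⟩
    linarith [hz.1]
  · intro t ht h0
    exact ((isClosed_rEscSet (hcu t (by linarith))).csSup_mem (rEscSet_nonempty h0)
      (bddAbove_rEscSet _ _)).2
  · intro a ha
    refine ((frequently_lt_of_lt_limsup hcob ha).and_eventually (eventually_gt_atTop 0)).mono ?_
    rintro t ⟨h1, h2⟩
    rwa [lt_div_iff₀ h2] at h1
  · intro a ha
    filter_upwards [eventually_lt_of_limsup_lt ha hbdd, eventually_gt_atTop 0] with t h1 h2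
    rwa [div_lt_iff₀ h2] at h1

end homogeneous

/-- Uniform smallness on bounded intervals implies smallness in `H¹`. -/
theorem tendsto_integral_of_eventually_le {u v : ℝ → ℝ → Euc n} {x : Euc n} {g : ℝ → ℝ}
    (h : ∀ L η, 0 < η → ∀ᶠ t in atTop, ∀ r, |r| ≤ L →
      ‖u (g t + r) t - x‖ ≤ η ∧ ‖v (g t + r) t‖ ≤ η) {L : ℝ} (hL : 0 < L) :
    Tendsto (fun t => ∫ r in (-L)..L, (‖u (g t + r) t - x‖ ^ 2 + ‖v (g t + r) t‖ ^ 2))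
      atTop (𝓝 0) := by
  rw [Metric.tendsto_nhds]
  intro ε hε
  obtain ⟨η, hη, hlt⟩ : ∃ η : ℝ, 0 < η ∧ 2 * η ^ 2 * (2 * L) < ε := by
    have hc : Tendsto (fun η : ℝ => 2 * η ^ 2 * (2 * L)) (𝓝[>] 0) (𝓝 0) := by
      have : Continuous fun η : ℝ => 2 * η ^ 2 * (2 * L) := by fun_prop
      simpa using (this.tendsto 0).mono_left nhdsWithin_le_nhds
    obtain ⟨η, h1, h2⟩ := ((hc.eventually (gt_mem_nhds hε)).and self_mem_nhdsWithin).exists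
    exact ⟨η, h2, h1⟩
  filter_upwards [h L η hη] with t ht
  rw [dist_zero_right]
  refine lt_of_le_of_lt ?_ hlt
  have := intervalIntegral.norm_integral_le_of_norm_le_const (a := -L) (b := L)
    (f := fun r => ‖u (g t + r) t - x‖ ^ 2 + ‖v (g t + r) t‖ ^ 2) (C := 2 * η ^ 2) fun r hr => by
      rw [uIoc_of_le (by linarith)] at hr
      have h1 := ht r (abs_le.2 ⟨hr.1.le, hr.2⟩)
      rw [Real.norm_of_nonneg (by positivity)]
      nlinarith [norm_nonneg (u (g t + r) t - x), norm_nonneg (v (g t + r) t)]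
  rwa [show L - -L = 2 * L by ring, abs_of_pos (by linarith)] at this

end

/-- invasion implies convergence. -/
theorem stmt1 {n d k : ℕ} (hn : 1 ≤ n) (hd : 2 ≤ d) (hk : 2 ≤ k)
    (V : Euc n → ℝ) (hV : ContDiff ℝ (k : ℕ∞) V) (hcoerc : HCoerc V)
    (D : EscData n V) (hgen : HGen V D.dEsc)
    (u : ℝ → ℝ → Euc n) (hu : IsRadialSolution d V u)
    (m : Euc n) (hm : m ∈ MinSet V)
    (cHom : ℝ) (rHom : ℝ → ℝ) (hhom : HHomWith u m cHom rHom)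
    (hinv : 0 < cEscV u m D.dEsc rHom) :
    (∃ t₀ : ℝ, ∀ t ≥ t₀, (rEscSet u m D.dEsc rHom t).Nonempty ∧
      ContDiffAt ℝ 1 (rEscF u m D.dEsc rHom) t) ∧
    Tendsto (deriv (rEscF u m D.dEsc rHom)) atTop (𝓝 (cEscV u m D.dEsc rHom)) ∧
    ∃ mNext ∈ MinSet V, V mNext < V m ∧
      ∃ φ ∈ PhiNorm V D.dEsc (cEscV u m D.dEsc rHom) mNext m,
        ∃ rNext : ℝ → ℝ, (∀ t : ℝ, DifferentiableAt ℝ rNext t) ∧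
          Tendsto (fun t => rEscF u m D.dEsc rHom t - rNext t) atTop atTop ∧
          Tendsto (deriv rNext) atTop (𝓝 (cEscV u m D.dEsc rHom)) ∧
          (∀ η > (0:ℝ), ∃ t₀ : ℝ, ∀ t ≥ t₀, ∀ r ∈ Icc (rNext t) (rHom t),
            ‖u r t - φ (r - rEscF u m D.dEsc rHom t)‖ ≤ η) ∧
          (∀ L > (0:ℝ),
            Tendsto
              (fun t => ∫ r in (-L)..L,
                (‖u (rNext t + r) t - mNext‖ ^ 2 + ‖ur u (rNext t + r) t‖ ^ 2))
              atTop (𝓝 0)) := by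
  have hV2 : ContDiff ℝ 2 V := hV.of_le (WithTop.coe_le_coe.2 (by exact_mod_cast hk : (2 : ℕ∞) ≤ k))
  obtain ⟨K, hK⟩ := hu.bounded
  obtain ⟨p, hG, hW, hδ, hC⟩ := D.exists_pot hV2 hm (K + ‖m‖)
  rw [← hδ] at hgen hinv ⊢
  have S := hu.radSol (by omega) hK hG hC
  obtain ⟨T, Esc⟩ := hhom.exists_escape hu S hinv
  have hsp := hgen.exists_not_hasFront hV2 hm hG hW
  have hc := Esc.c_pos
  have hwave : ∀ φ ψ, Profile p (cEscV u m p.δ rHom) (RadSol.regConst p ((d:ℝ) - 1) K) φ ψ →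
      ‖φ 0‖ = p.δ → (∀ ξ, 0 < ξ → ‖φ ξ‖ < p.δ) →
      ∃ mm ∈ MinSet V, V mm < V m ∧
        (fun ξ => φ ξ + m) ∈ PhiNorm V p.δ (cEscV u m p.δ rHom) mm m ∧
        deriv (fun ξ => φ ξ + m) = ψ := by
    intro φ ψ hφ h0 hlt
    obtain ⟨mm, hmm, hlow, hmem, hder⟩ := hφ.exists_phi hV2 hm hG hW hgen.1 hgen.2.1 hc
      ⟨0, fun h => by rw [h, norm_zero] at h0; exact p.δ_pos.ne h0⟩
    exact ⟨mm, hmm, hlow, ⟨hmem, by simpa using h0, fun ξ hξ => by simpa using hlt ξ hξ⟩, hder⟩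
  have hX : IsTotallyDisconnected ((fun q : Euc n × Euc n => (q.1 + m, q.2)) ⁻¹'
      {q | ∃ φ ∈ PhiNormInv V p.δ (cEscV u m p.δ rHom) m, q = (φ 0, deriv φ 0)}) := by
    refine isTotallyDisconnected_of_image (f := fun q : Euc n × Euc n => (q.1 + m, q.2))
      (by fun_prop) (fun a b h => ?_) fun s hs => hgen.2.2.2 m hm _ hc s
        (hs.trans (image_preimage_subset _ _))
    simpa [Prod.ext_iff] using h
  obtain ⟨φ, ψ, hφ, h0, hlt, hlu, hlur⟩ := Esc.exists_profile hsp hX fun φ ψ hφ h0 hlt => by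
    obtain ⟨mm, hmm, -, hmem, hder⟩ := hwave φ ψ hφ h0 hlt
    exact ⟨_, mem_iUnion₂.2 ⟨mm, hmm, hmem⟩, by rw [hder]⟩
  obtain ⟨mm, hmm, hlow, hmem, -⟩ := hwave φ ψ hφ h0 hlt
  have hbot : Tendsto φ atBot (𝓝 (mm - m)) := by
    simpa using hmem.1.2.2.2.2.1.sub_const m
  obtain ⟨g, hg, hfg, hg', hclose, hnear⟩ := Esc.exists_next hsp hφ hlu hlur hbot
  refine ⟨?_, Esc.tendsto_deriv hsp, mm, hmm, hlow, _, hmem, g, hg, hfg, hg', fun η hη => ?_,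
    fun L hL => tendsto_integral_of_eventually_le (v := ur u) ?_ hL⟩
  · refine eventually_atTop.1 ?_
    filter_upwards [(Esc.tendsto_atTop hsp).eventually_gt_atTop 0, Esc.eventually_contDiffAt hsp]
      with t ht htc
    exact ⟨rEscSet_nonempty ht, htc⟩
  · refine eventually_atTop.1 ((hclose η hη).mono fun t ht r hr => ?_)
    rw [add_comm, ← sub_sub]
    exact ht r hr
  · simpa only [sub_sub_sub_cancel_right] using hnear
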